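/- Let 2 ≤ k ≤ 650 and suppose nonnegative integers n ≥ m ≥ l ≥ 0 with n ≥ k + 1 and n > 25, d ≥ 2 and 1 ≤ a ≤ 9 satisfy L_n^{(k)} · L_m^{(k)} · L_l^{(k)} = a·(10^d − 1)/9. Then l ≤ 300. -/

import Mathlib

/-- The `k`-generalized Lucas sequence: `L 0 = 2`, `L 1 = 1`, and for `n ≥ 2`,
`L n = L (n-1) + L (n-2) + ⋯ + L (n-k)`, where terms with negative index count as `0`. -/
def lucasK (k : ℕ) : ℕ → ℕ
  | 0 => 2
  | 1 => 1
  | n + 2 => ∑ j ∈ Finset.range k, if _ : j ≤ n + 1 then lucasK k (n + 1 - j) else 0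
termination_by n => n
decreasing_by omega

section
open Polynomial
namespace TL

theorem coeff_prod_le {F : Type*} [CommRing F] {ι : Type*} (s : Finset ι) (p : ι → F[X]) (d : ι → ℕ)
    (h : ∀ i ∈ s, (p i).natDegree ≤ d i) :
    (∏ i ∈ s, p i).coeff (∑ i ∈ s, d i) = ∏ i ∈ s, (p i).coeff (d i) := by
  classical
  induction s using Finset.induction_on with
  | empty => simp
  | insert a s ha ih =>
    rw [Finset.prod_insert ha, Finset.sum_insert ha, Finset.prod_insert ha,
      Polynomial.coeff_mul_add_eq_of_natDegree_le (h a (by simp)) ?_, ih ?_]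
    · intro i hi; exact h i (by simp [hi])
    · refine (Polynomial.natDegree_prod_le _ _).trans (Finset.sum_le_sum ?_)
      intro i hi; exact h i (by simp [hi])

theorem det_coeff {F : Type*} [Field F] {n : ℕ} (M : Matrix (Fin n) (Fin n) F[X]) (d : Fin n → ℕ)
    (h : ∀ i j, (M i j).natDegree ≤ d j) :
    M.det.coeff (∑ j, d j) = (Matrix.of fun i j => (M i j).coeff (d j)).det := by
  rw [Matrix.det_apply, Matrix.det_apply, Polynomial.finsetSum_coeff]
  refine Finset.sum_congr rfl fun σ _ => ?_
  rw [Polynomial.coeff_smul, coeff_prod_le _ _ _ (fun i _ => h _ _)]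
  rfl

theorem det_natDegree {F : Type*} [Field F] {n : ℕ} (M : Matrix (Fin n) (Fin n) F[X]) (d : Fin n → ℕ)
    (h : ∀ i j, (M i j).natDegree ≤ d j) :
    M.det.natDegree ≤ ∑ j, d j := by
  rw [Matrix.det_apply]
  refine Polynomial.natDegree_sum_le_of_forall_le _ _ fun σ _ => ?_
  refine (Polynomial.natDegree_smul_le _ _).trans ?_
  refine (Polynomial.natDegree_prod_le _ _).trans (Finset.sum_le_sum fun i _ => h _ _)

/-- Zero estimate. -/
theorem zero_est {F : Type*} [Field F] [CharZero F] (Kd L R' S u : ℕ) (A B : F) (hA0 : A ≠ 0) (hB0 : B ≠ 0)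
    (hA : Function.Injective fun i : ℕ => A ^ i) (hK : 1 ≤ Kd) (hL : 1 ≤ L)
    (hRS : Kd * L ≤ R' * S) (hu : R' ≤ u)
    (p : Fin L → F[X]) (hp : ∀ l, (p l).natDegree ≤ Kd - 1)
    (hz : ∀ r < R' + L, ∀ s < S,
      ∑ l, (p l).eval ((r : F) - u * s) * (A ^ r * B ^ s) ^ (l : ℕ) = 0) : ∀ l, p l = 0 := by
  classical
  by_contra hne
  push Not at hne
  obtain ⟨l0, hl0⟩ := hne
  set I : Finset (Fin L) := Finset.univ.filter fun l => p l ≠ 0 with hI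
  have hl0I : l0 ∈ I := by simp [hI, hl0]
  set n := I.card with hn
  have hnL : n ≤ L := by
    have := Finset.card_le_univ I
    simpa using this
  have hn0 : 0 < n := Finset.card_pos.mpr ⟨l0, hl0I⟩
  let e : Fin n ≃ I := (I.equivFin).symm
  have hpe : ∀ j, p (e j).1 ≠ 0 := by
    intro j
    have := (e j).2
    exact (Finset.mem_filter.mp this).2
  let M : Matrix (Fin n) (Fin n) F[X] := Matrix.of fun i j =>
    C (A ^ ((i : ℕ) * ((e j).1 : ℕ))) * (p (e j).1).comp (X + C ((i : ℕ) : F))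
  let d : Fin n → ℕ := fun j => (p (e j).1).natDegree
  have hMd : ∀ i j, (M i j).natDegree ≤ d j := by
    intro i j
    have h0 : ((p (e j).1).comp (X + C ((i : ℕ) : F))).natDegree ≤ d j := by
      rw [Polynomial.natDegree_comp, Polynomial.natDegree_X_add_C, mul_one]
    exact (Polynomial.natDegree_C_mul_le _ _).trans h0
  have hMc : ∀ i j, (M i j).coeff (d j) = A ^ ((i : ℕ) * ((e j).1 : ℕ)) * (p (e j).1).leadingCoeff := by
    intro i j
    simp only [M, Matrix.of_apply, Polynomial.coeff_C_mul]
    congr 1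
    have h1 : ((p (e j).1).comp (X + C ((i : ℕ) : F))).natDegree = d j := by
      rw [Polynomial.natDegree_comp, Polynomial.natDegree_X_add_C, mul_one]
    rw [← h1, Polynomial.coeff_natDegree, Polynomial.leadingCoeff_comp (by rw [Polynomial.natDegree_X_add_C]; norm_num),
      Polynomial.leadingCoeff_X_add_C, one_pow, mul_one]
  have hdet : M.det ≠ 0 := by
    intro h0
    have h1 := det_coeff M d hMd
    rw [h0, Polynomial.coeff_zero] at h1
    have h2 : (Matrix.of fun i j => (M i j).coeff (d j)) =
        (Matrix.vandermonde fun j : Fin n => A ^ ((e j).1 : ℕ)).transpose *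
          Matrix.diagonal (fun j => (p (e j).1).leadingCoeff) := by
      ext i j
      rw [Matrix.mul_diagonal]
      simp only [Matrix.of_apply, Matrix.transpose_apply, Matrix.vandermonde_apply]
      rw [hMc, ← pow_mul, mul_comm (i : ℕ)]
    rw [h2, Matrix.det_mul, Matrix.det_transpose, Matrix.det_diagonal] at h1
    have h3 := h1.symm
    rw [mul_eq_zero] at h3
    rcases h3 with h3 | h3
    · have := (Matrix.det_vandermonde_ne_zero_iff (v := fun j : Fin n => A ^ ((e j).1 : ℕ))).mpr ?_
      · exact this h3
      · intro a b hab
        have := hA hab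
        exact e.injective (Subtype.ext (Fin.ext this))
    · rw [Finset.prod_eq_zero_iff] at h3
      obtain ⟨j, -, hj⟩ := h3
      exact hpe j (Polynomial.leadingCoeff_eq_zero.mp hj)
  apply hdet
  have hdeg : M.det.natDegree ≤ n * (Kd - 1) := by
    refine (det_natDegree M d hMd).trans ?_
    refine (Finset.sum_le_card_nsmul _ _ (Kd - 1) fun j _ => hp _).trans ?_
    simp
  refine Polynomial.eq_zero_of_natDegree_lt_card_of_eval_eq_zero M.det
    (f := fun x : Fin R' × Fin S => ((x.1 : ℕ) : F) - u * ((x.2 : ℕ) : F)) ?_ ?_ ?_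
  · rintro ⟨r, s⟩ ⟨r', s'⟩ h
    simp only at h
    have h' : ((r : ℕ) : ℤ) - u * (s : ℕ) = ((r' : ℕ) : ℤ) - u * (s' : ℕ) := by
      have : (((((r : ℕ) : ℤ) - u * (s : ℕ)) : ℤ) : F) = ((((r' : ℕ) : ℤ) - u * (s' : ℕ) : ℤ) : F) := by
        push_cast; exact h
      exact_mod_cast this
    have hr := r.2
    have hr' := r'.2
    have h2 : (s : ℕ) = s' := by
      by_contra hss
      rcases lt_or_gt_of_ne hss with h3 | h3
      · have : (u : ℤ) * ((s : ℕ) + 1) ≤ u * (s' : ℕ) := by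
          apply mul_le_mul_of_nonneg_left _ (by positivity)
          exact_mod_cast h3
        have h5 : ((r : ℕ) : ℤ) < R' := by exact_mod_cast hr
        have h6 : ((r' : ℕ) : ℤ) < R' := by exact_mod_cast hr'
        have h7 : (R' : ℤ) ≤ u := by exact_mod_cast hu
        have h8 : (0:ℤ) ≤ ((r : ℕ) : ℤ) := by positivity
        nlinarith
      · have : (u : ℤ) * ((s' : ℕ) + 1) ≤ u * (s : ℕ) := by
          apply mul_le_mul_of_nonneg_left _ (by positivity)
          exact_mod_cast h3
        have h5 : ((r : ℕ) : ℤ) < R' := by exact_mod_cast hr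
        have h6 : ((r' : ℕ) : ℤ) < R' := by exact_mod_cast hr'
        have h7 : (R' : ℤ) ≤ u := by exact_mod_cast hu
        have h8 : (0:ℤ) ≤ ((r' : ℕ) : ℤ) := by positivity
        nlinarith
    have h3 : (r : ℕ) = r' := by
      rw [h2] at h'
      have : ((r : ℕ) : ℤ) = (r' : ℕ) := by linarith
      exact_mod_cast this
    exact Prod.ext (Fin.ext h3) (Fin.ext h2)
  · rintro ⟨r, s⟩
    rw [← Polynomial.coe_evalRingHom, RingHom.map_det]
    rw [← Matrix.exists_mulVec_eq_zero_iff]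
    refine ⟨fun j => (A ^ (r : ℕ) * B ^ (s : ℕ)) ^ ((e j).1 : ℕ), ?_, ?_⟩
    · intro h
      have := congrFun h ⟨0, hn0⟩
      simp only [Pi.zero_apply] at this
      exact pow_ne_zero _ (mul_ne_zero (pow_ne_zero _ hA0) (pow_ne_zero _ hB0)) this
    · funext i
      have hzi := hz (r + i) (by have := r.2; have := i.2; omega) s s.2
      simp only [Matrix.mulVec, dotProduct, RingHom.mapMatrix_apply, Matrix.map_apply, M,
        Matrix.of_apply, Polynomial.coe_evalRingHom, Pi.zero_apply]
      rw [← hzi]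
      have hsub : ∑ l, (p l).eval (((r + i : ℕ) : F) - u * ((s : ℕ) : F)) * (A ^ ((r : ℕ) + i) * B ^ (s : ℕ)) ^ (l : ℕ)
          = ∑ l ∈ I, (p l).eval (((r + i : ℕ) : F) - u * ((s : ℕ) : F)) * (A ^ ((r : ℕ) + i) * B ^ (s : ℕ)) ^ (l : ℕ) := by
        symm
        apply Finset.sum_subset (Finset.subset_univ _)
        intro l _ hl
        have : p l = 0 := by
          by_contra h
          exact hl (by simp [hI, h])
        simp [this]
      rw [hsub, ← Finset.sum_coe_sort I, ← e.sum_comp]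
      refine Finset.sum_congr rfl fun j _ => ?_
      simp only [Polynomial.eval_mul, Polynomial.eval_C, Polynomial.eval_comp, Polynomial.eval_add, Polynomial.eval_X]
      have : ((r : ℕ) : F) - u * ((s : ℕ) : F) + ((i : ℕ) : F) = ((r + i : ℕ) : F) - u * ((s : ℕ) : F) := by
        push_cast; ring
      rw [this]
      ring
  · simp only [Fintype.card_prod, Fintype.card_fin]
    refine lt_of_le_of_lt hdeg (lt_of_lt_of_le ?_ hRS)
    have h1 : n * (Kd - 1) ≤ L * (Kd - 1) := Nat.mul_le_mul_right _ hnL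
    have h2 : L * (Kd - 1) < L * Kd := Nat.mul_lt_mul_of_pos_left (by omega) (by omega)
    rw [mul_comm Kd L]
    omega

end TL

end

section
open Polynomial
namespace TL

theorem exists_minor {F : Type*} [Field F] {ι G : Type*} [Fintype ι] [DecidableEq ι] [Fintype G]
    (M : Matrix ι G F) (h : ∀ c : ι → F, (∀ g, ∑ i, c i * M i g = 0) → c = 0) :
    ∃ g : ι → G, Function.Injective g ∧ (M.submatrix id g).det ≠ 0 := by
  classical
  have hli : LinearIndependent F M.row := by
    rw [Fintype.linearIndependent_iff]
    intro c hc i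
    have := h c (fun g => by
      have := congrFun hc g
      simpa [Matrix.row, Finset.sum_apply] using this)
    exact congrFun this i
  have hr : M.rank = Fintype.card ι := hli.rank_matrix
  obtain ⟨κ, a, ha, hspan, hlin⟩ := exists_linearIndependent' F M.col
  have hfin : Finite κ := Finite.of_injective a ha
  have : Fintype κ := Fintype.ofFinite κ
  have hcard : Fintype.card κ = Fintype.card ι := by
    rw [← hr, Matrix.rank_eq_finrank_span_cols, ← hspan]
    exact (finrank_span_eq_card hlin).symm
  let e : ι ≃ κ := (Fintype.equivOfCardEq hcard).symm
  refine ⟨a ∘ e, ha.comp e.injective, ?_⟩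
  have h2 : LinearIndependent F (M.submatrix id (a ∘ e)).col := by
    have := hlin.comp e e.injective
    exact this
  rw [Matrix.linearIndependent_cols_iff_isUnit, Matrix.isUnit_iff_isUnit_det] at h2
  exact h2.ne_zero

theorem exists_det {F : Type*} [Field F] [CharZero F] (Kd L R' S u : ℕ) (A B : F) (hA0 : A ≠ 0) (hB0 : B ≠ 0)
    (hA : Function.Injective fun i : ℕ => A ^ i) (hK : 1 ≤ Kd) (hL : 1 ≤ L)
    (hRS : Kd * L ≤ R' * S) (hu : R' ≤ u) :
    ∃ g : Fin Kd × Fin L → Fin (R' + L) × Fin S, Function.Injective g ∧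
      (Matrix.of fun (i j : Fin Kd × Fin L) =>
        (((g j).1 : ℕ) - u * ((g j).2 : ℕ) : F) ^ (i.1 : ℕ) *
          (A ^ ((g j).1 : ℕ) * B ^ ((g j).2 : ℕ)) ^ (i.2 : ℕ)).det ≠ 0 := by
  classical
  obtain ⟨g, hg, hd⟩ := exists_minor (Matrix.of fun (i : Fin Kd × Fin L) (x : Fin (R' + L) × Fin S) =>
        ((x.1 : ℕ) - u * (x.2 : ℕ) : F) ^ (i.1 : ℕ) * (A ^ (x.1 : ℕ) * B ^ (x.2 : ℕ)) ^ (i.2 : ℕ)) (by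
    intro c hc
    let p : Fin L → F[X] := fun l => ∑ κ : Fin Kd, C (c (κ, l)) * X ^ (κ : ℕ)
    have hp : ∀ l, (p l).natDegree ≤ Kd - 1 := by
      intro l
      refine Polynomial.natDegree_sum_le_of_forall_le _ _ fun κ _ => ?_
      refine (Polynomial.natDegree_C_mul_X_pow_le _ _).trans ?_
      have := κ.2; omega
    have h0 := zero_est Kd L R' S u A B hA0 hB0 hA hK hL hRS hu p hp (by
      intro r hr s hs
      have := hc (⟨r, hr⟩, ⟨s, hs⟩)
      rw [← this, Fintype.sum_prod_type_right]
      refine Finset.sum_congr rfl fun l _ => ?_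
      simp only [p, Polynomial.eval_finsetSum, Polynomial.eval_mul, Polynomial.eval_C,
        Polynomial.eval_pow, Polynomial.eval_X, Finset.sum_mul, Matrix.of_apply]
      refine Finset.sum_congr rfl fun κ _ => ?_
      ring)
    funext ⟨κ, l⟩
    have h1 : (p l).coeff κ = c (κ, l) := by
      simp only [p, Polynomial.finsetSum_coeff, Polynomial.coeff_C_mul, Polynomial.coeff_X_pow]
      rw [Finset.sum_eq_single κ]
      · simp
      · intro b _ hb
        rw [if_neg]
        · simp
        · intro h; exact hb (Fin.ext h.symm)
      · simp
    rw [← h1, h0 l]; simp)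
  exact ⟨g, hg, hd⟩

end TL

end

section
namespace TL
open Finset

lemma dd_identity {ι : Type*} [DecidableEq ι] (s : Finset ι) (v : ι → ℂ) (hv : Set.InjOn v s) (hs : s.Nonempty) (w : ℂ)
    (hw : ∀ i ∈ s, w ≠ v i) :
    ∑ i ∈ s, (∏ j ∈ s.erase i, (v i - v j)⁻¹) * (w - v i)⁻¹ = (∏ i ∈ s, (w - v i))⁻¹ := by
  have h := Lagrange.eval_interpolate_not_at_node (s := s) (v := v) (x := w) (fun _ => (1:ℂ)) hw
  have h1 : Lagrange.interpolate s v (fun _ => (1:ℂ)) = 1 := by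
    have := Lagrange.interpolate_one hv hs
    exact this
  rw [h1, Polynomial.eval_one, Lagrange.eval_nodal] at h
  simp only [mul_one, Lagrange.nodalWeight] at h
  exact eq_inv_of_mul_eq_one_right h.symm

lemma dd_bound {ι : Type*} [DecidableEq ι] (s : Finset ι) (v : ι → ℂ) (hv : Set.InjOn v s) (p : ℕ) (hs : s.card = p + 1)
    (f : ℂ → ℂ) (hf : Differentiable ℂ f) (Z M : ℝ) (hZ : 1 ≤ Z)
    (hvZ : ∀ i ∈ s, ‖v i‖ ≤ Z) (hM : ∀ w, ‖w‖ = 111 * Z → ‖f w‖ ≤ M) :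
    ‖∑ i ∈ s, (∏ j ∈ s.erase i, (v i - v j)⁻¹) * f (v i)‖ ≤ 2 * M / (110 * Z) ^ p := by
  have hne : s.Nonempty := by rw [← Finset.card_pos]; omega
  have hnw : ∀ w : ℂ, ‖w‖ = 111 * Z → ∀ i ∈ s, 110 * Z ≤ ‖w - v i‖ := by
    intro w hw i hi
    have := norm_sub_norm_le w (v i)
    have := hvZ i hi
    linarith
  have hneq : ∀ w : ℂ, ‖w‖ = 111 * Z → ∀ i ∈ s, w ≠ v i := by
    intro w hw i hi h
    have := hnw w hw i hi
    rw [h, sub_self, norm_zero] at this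
    linarith
  have hM0 : 0 ≤ M := (norm_nonneg _).trans (hM ((111 * Z : ℝ) : ℂ) (by
    rw [Complex.norm_real, Real.norm_of_nonneg]; linarith))
  have hc : ∀ i ∈ s, f (v i) = (2 * Real.pi * Complex.I : ℂ)⁻¹ • ∮ w in C(0, 111 * Z), (w - v i)⁻¹ • f w := by
    intro i hi
    rw [DiffContOnCl.two_pi_i_inv_smul_circleIntegral_sub_inv_smul (hf.diffContOnCl)]
    rw [Metric.mem_ball, dist_zero_right]
    have := hvZ i hi
    linarith
  have hci : ∀ i ∈ s, CircleIntegrable (fun w => (∏ j ∈ s.erase i, (v i - v j)⁻¹) • ((w - v i)⁻¹ • f w)) 0 (111 * Z) := by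
    intro i hi
    apply ContinuousOn.circleIntegrable (by linarith)
    have hcc : ContinuousOn (fun w => (w - v i)⁻¹) (Metric.sphere 0 (111 * Z)) := by
      apply ContinuousOn.inv₀ (by fun_prop)
      intro w hw
      rw [mem_sphere_iff_norm, sub_zero] at hw
      exact sub_ne_zero.2 (hneq w hw i hi)
    have hfc := hf.continuous
    fun_prop
  have key : ∑ i ∈ s, (∏ j ∈ s.erase i, (v i - v j)⁻¹) * f (v i) =
      (2 * Real.pi * Complex.I : ℂ)⁻¹ • ∮ w in C(0, 111 * Z), (∏ i ∈ s, (w - v i))⁻¹ * f w := by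
    have e1 : ∮ w in C(0, 111 * Z), (∏ i ∈ s, (w - v i))⁻¹ * f w =
       ∮ w in C(0, 111 * Z), ∑ i ∈ s, (∏ j ∈ s.erase i, (v i - v j)⁻¹) • ((w - v i)⁻¹ • f w) := by
      apply circleIntegral.integral_congr (by linarith)
      intro w hw
      rw [mem_sphere_iff_norm, sub_zero] at hw
      simp only
      rw [← dd_identity s v hv hne w (hneq w hw), Finset.sum_mul]
      refine Finset.sum_congr rfl fun i _ => ?_
      simp only [smul_eq_mul]; ring
    rw [e1, circleIntegral.integral_fun_sum hci, Finset.smul_sum]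
    refine Finset.sum_congr rfl fun i hi => ?_
    rw [circleIntegral.integral_smul, hc i hi]
    simp only [smul_eq_mul]; ring
  rw [key]
  have hb := circleIntegral.norm_two_pi_i_inv_smul_integral_le_of_norm_le_const (c := 0) (R := 111 * Z)
    (C := M / (110 * Z) ^ (p+1)) (f := fun w => (∏ i ∈ s, (w - v i))⁻¹ * f w) (by linarith) (by
      intro w hw
      rw [mem_sphere_iff_norm, sub_zero] at hw
      rw [norm_mul, norm_inv, norm_prod, div_eq_inv_mul]
      apply mul_le_mul _ (hM w hw) (norm_nonneg _) (by positivity)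
      apply inv_anti₀ (by positivity)
      rw [← hs, ← Finset.prod_const]
      exact Finset.prod_le_prod (fun i _ => by positivity) (fun i hi => hnw w hw i hi))
  refine hb.trans ?_
  have hz : 0 < (110 * Z) ^ p := by positivity
  rw [pow_succ, ← mul_div_assoc, div_le_div_iff₀ (by positivity) hz]
  have : 111 * Z * M ≤ 2 * M * (110 * Z) := by nlinarith
  calc 111 * Z * M * (110 * Z) ^ p ≤ 2 * M * (110 * Z) * (110 * Z) ^ p := by gcongr
    _ = _ := by ring

lemma norm_det_le_prod {T : ℕ} (A : Matrix (Fin T) (Fin T) ℂ) (b : Fin T → ℝ) (h : ∀ i j, ‖A i j‖ ≤ b j) :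
    ‖A.det‖ ≤ T.factorial * ∏ j, b j := by
  rw [← Matrix.det_transpose, Matrix.det_apply]
  refine (norm_sum_le _ _).trans ?_
  have : ∀ σ ∈ (Finset.univ : Finset (Equiv.Perm (Fin T))), ‖Equiv.Perm.sign σ • ∏ i, A.transpose (σ i) i‖ ≤ ∏ j, b j := by
    intro σ _
    have e : ‖Equiv.Perm.sign σ • ∏ i, A.transpose (σ i) i‖ = ∏ i, ‖A.transpose (σ i) i‖ := by
      rcases Int.units_eq_one_or (Equiv.Perm.sign σ) with h | h <;> simp [h, norm_prod]
    rw [e, ← Equiv.prod_comp σ b]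
    exact Finset.prod_le_prod (fun _ _ => norm_nonneg _) (fun i _ => h _ _)
  refine (Finset.sum_le_card_nsmul _ _ _ this).trans ?_
  rw [Finset.card_univ, Fintype.card_perm, Fintype.card_fin, nsmul_eq_mul]

theorem det_upper (T : ℕ) (z : Fin T → ℤ) (hz : Function.Injective z) (Z M : ℝ) (hZ : 1 ≤ Z)
    (hzZ : ∀ j, |(z j : ℝ)| ≤ Z) (f : Fin T → ℂ → ℂ) (hf : ∀ i, Differentiable ℂ (f i))
    (hM : ∀ i w, ‖w‖ = 111 * Z → ‖f i w‖ ≤ M) (E : Matrix (Fin T) (Fin T) ℂ)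
    (hE : ∀ i j, T * ‖E i j‖ * (110 * Z) ^ T ≤ 2 * M) :
    ‖(Matrix.of fun i j => f i (z j) + E i j).det‖ ≤ T.factorial * (4 * M) ^ T / 55 ^ (T * (T - 1) / 2) := by
  classical
  set F := (Matrix.of fun i j => f i (z j) + E i j) with hF
  let v : Fin T → ℂ := fun j => (z j : ℂ)
  have hv : Function.Injective v := fun a b h => hz (by simpa [v] using h)
  let W : Matrix (Fin T) (Fin T) ℂ := Matrix.of fun j p =>
    if j ≤ p then ∏ i ∈ (Finset.Iic p).erase j, (v j - v i)⁻¹ else 0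
  have hW : W.det = ∏ p : Fin T, ∏ i ∈ Finset.Iio p, (v p - v i)⁻¹ := by
    rw [Matrix.det_of_isUpperTriangular]
    · refine Finset.prod_congr rfl fun p _ => ?_
      simp only [W, Matrix.of_apply, le_refl, if_true]
      congr 1
      ext i; simp [lt_iff_le_and_ne, and_comm]
    · intro i j hij
      simp only [W, Matrix.of_apply]
      exact if_neg (not_le.2 hij)
  have hdist : ∀ i j, i ≠ j → 1 ≤ ‖v i - v j‖ := by
    intro i j hij
    have h1 : z i - z j ≠ 0 := sub_ne_zero.2 (fun h => hij (hz h))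
    have h2 : 1 ≤ |z i - z j| := Int.one_le_abs h1
    have : v i - v j = ((z i - z j : ℤ) : ℂ) := by simp [v]
    rw [this, Complex.norm_intCast]
    exact_mod_cast h2
  have hent : ∀ i p, ‖(F * W) i p‖ ≤ 4 * M / (110 * Z) ^ (p : ℕ) := by
    intro i p
    have hM0 : 0 ≤ M := (norm_nonneg _).trans (hM i ((111 * Z : ℝ) : ℂ) (by
      rw [Complex.norm_real, Real.norm_of_nonneg]; linarith))
    have e : (F * W) i p = ∑ j ∈ Finset.Iic p, (∏ i ∈ (Finset.Iic p).erase j, (v j - v i)⁻¹) * f i (v j)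
        + ∑ j ∈ Finset.Iic p, (∏ i ∈ (Finset.Iic p).erase j, (v j - v i)⁻¹) * E i j := by
      rw [← Finset.sum_add_distrib, Matrix.mul_apply]
      rw [← Finset.sum_subset (Finset.subset_univ (Finset.Iic p))]
      · refine Finset.sum_congr rfl fun j hj => ?_
        rw [Finset.mem_Iic] at hj
        simp only [W, Matrix.of_apply, hF, if_pos hj, v]
        ring
      · intro j _ hj
        rw [Finset.mem_Iic] at hj
        simp only [W, Matrix.of_apply, if_neg hj, mul_zero]
    rw [e]
    refine (norm_add_le _ _).trans ?_
    have b1 := dd_bound (Finset.Iic p) v hv.injOn p (by simp) (f i) (hf i) Z M hZ (by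
      intro j _
      simp only [v]
      rw [Complex.norm_intCast]; exact hzZ j) (hM i)
    have b2 : ‖∑ j ∈ Finset.Iic p, (∏ i ∈ (Finset.Iic p).erase j, (v j - v i)⁻¹) * E i j‖ ≤ 2 * M / (110 * Z) ^ (p:ℕ) := by
      refine (norm_sum_le _ _).trans ?_
      have hT : 0 < (T:ℝ) := by have := p.pos; exact_mod_cast this
      have : ∀ j ∈ Finset.Iic p, ‖(∏ i ∈ (Finset.Iic p).erase j, (v j - v i)⁻¹) * E i j‖ ≤ 2 * M / (110 * Z) ^ (p:ℕ) / T := by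
        intro j _
        rw [norm_mul, norm_prod]
        have : ∏ b ∈ (Finset.Iic p).erase j, ‖(v j - v b)⁻¹‖ ≤ 1 := by
          apply Finset.prod_le_one (fun _ _ => norm_nonneg _)
          intro b hb
          rw [norm_inv]
          exact inv_le_one_of_one_le₀ (hdist j b (Finset.ne_of_mem_erase hb).symm)
        refine (mul_le_of_le_one_left (norm_nonneg _) this).trans ?_
        rw [div_div, le_div_iff₀ (by positivity)]
        refine le_trans ?_ (hE i j)
        have : (110 * Z) ^ (p:ℕ) ≤ (110 * Z) ^ T := pow_le_pow_right₀ (by linarith) p.2.le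
        calc ‖E i j‖ * ((110 * Z) ^ (p:ℕ) * T) ≤ ‖E i j‖ * ((110 * Z) ^ T * T) := by gcongr
          _ = _ := by ring
      refine (Finset.sum_le_card_nsmul _ _ _ this).trans ?_
      rw [Fin.card_Iic, nsmul_eq_mul, mul_div_assoc', div_le_iff₀ hT, mul_comm]
      gcongr
      exact_mod_cast p.2
    calc _ ≤ 2 * M / (110 * Z) ^ (p:ℕ) + 2 * M / (110 * Z) ^ (p:ℕ) := add_le_add b1 b2
      _ = _ := by ring
  have hdet := norm_det_le_prod (F * W) _ (fun i j => hent i j)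
  rw [Matrix.det_mul, norm_mul, hW, norm_prod] at hdet
  have hWp : ∀ p : Fin T, ((2 * Z) ^ (p:ℕ))⁻¹ ≤ ‖∏ i ∈ Finset.Iio p, (v p - v i)⁻¹‖ := by
    intro p
    rw [norm_prod]
    have : ∏ i ∈ Finset.Iio p, (2 * Z)⁻¹ ≤ ∏ i ∈ Finset.Iio p, ‖(v p - v i)⁻¹‖ := by
      apply Finset.prod_le_prod (fun _ _ => by positivity)
      intro i hi
      rw [norm_inv]
      apply inv_anti₀
      · have := hdist p i (Finset.mem_Iio.1 hi).ne'; linarith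
      · refine (norm_sub_le _ _).trans ?_
        simp only [v]
        rw [Complex.norm_intCast, Complex.norm_intCast]
        have := hzZ p; have := hzZ i; linarith
    rw [Finset.prod_const, Fin.card_Iio, inv_pow] at this
    exact this
  have hsum : ∑ p : Fin T, (p:ℕ) = T * (T - 1) / 2 := by
    rw [Fin.sum_univ_eq_sum_range (fun i => i), Finset.sum_range_id]
  have hprodW : ((2 * Z) ^ (T * (T-1)/2))⁻¹ ≤ ∏ p : Fin T, ‖∏ i ∈ Finset.Iio p, (v p - v i)⁻¹‖ := by
    calc _ = ∏ p : Fin T, ((2 * Z) ^ (p:ℕ))⁻¹ := by rw [Finset.prod_inv_distrib, Finset.prod_pow_eq_pow_sum, hsum]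
      _ ≤ _ := Finset.prod_le_prod (fun _ _ => by positivity) (fun p _ => hWp p)
  have h1 : ‖F.det‖ * ((2 * Z) ^ (T * (T-1)/2))⁻¹ ≤ T.factorial * ((4 * M) ^ T / (110 * Z) ^ (T * (T-1)/2)) := by
    refine (mul_le_mul_of_nonneg_left hprodW (norm_nonneg _)).trans (hdet.trans_eq ?_)
    rw [Finset.prod_div_distrib, Finset.prod_pow_eq_pow_sum, hsum, Finset.prod_const]
    simp
  have hpos : 0 < (2 * Z) ^ (T * (T-1)/2) := by positivity
  rw [← div_eq_mul_inv, div_le_iff₀ hpos] at h1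
  refine h1.trans_eq ?_
  have : (110 * Z) = 55 * (2 * Z) := by ring
  rw [this, mul_pow 55]
  field_simp

end TL

end

section
namespace TL
open Finset

theorem det_upper' {ι : Type*} [Fintype ι] [DecidableEq ι] (T : ℕ) (hT : Fintype.card ι = T) (z : ι → ℤ) (hz : Function.Injective z) (Z M : ℝ) (hZ : 1 ≤ Z)
    (hzZ : ∀ j, |(z j : ℝ)| ≤ Z) (f : ι → ℂ → ℂ) (hf : ∀ i, Differentiable ℂ (f i))
    (hM : ∀ i w, ‖w‖ = 111 * Z → ‖f i w‖ ≤ M) (E : Matrix ι ι ℂ)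
    (hE : ∀ i j, T * ‖E i j‖ * (110 * Z) ^ T ≤ 2 * M) :
    ‖(Matrix.of fun i j => f i (z j) + E i j).det‖ ≤ T.factorial * (4 * M) ^ T / 55 ^ (T * (T - 1) / 2) := by
  let e : Fin T ≃ ι := (Fintype.equivFinOfCardEq hT).symm
  rw [← Matrix.det_submatrix_equiv_self e]
  exact det_upper T (z ∘ e) (hz.comp e.injective) Z M hZ (fun j => hzZ _) (fun i => f (e i)) (fun i => hf _)
    (fun i => hM _) (E.submatrix e e) (fun i j => hE _ _)

theorem norm_det_le {ι : Type*} [Fintype ι] [DecidableEq ι] (T : ℕ) (hT : Fintype.card ι = T) (A : Matrix ι ι ℂ) (b : ℝ)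
    (h : ∀ i j, ‖A i j‖ ≤ b) : ‖A.det‖ ≤ T.factorial * b ^ T := by
  let e : Fin T ≃ ι := (Fintype.equivFinOfCardEq hT).symm
  rw [← Matrix.det_submatrix_equiv_self e]
  have := norm_det_le_prod (A.submatrix e e) (fun _ => b) (fun i j => h _ _)
  simpa using this

theorem norm_lower {K : Type*} [Field K] [NumberField K] (φ₀ : K →+* ℂ) (D : ℕ) (hD : Module.finrank ℚ K ≤ D)
    (x : K) (hx : x ≠ 0) (hi : IsIntegral ℤ x) (b : ℝ) (hb1 : 1 ≤ b) (hb : ∀ φ : K →+* ℂ, ‖φ x‖ ≤ b) :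
    1 ≤ ‖φ₀ x‖ * b ^ (D - 1) := by
  classical
  have hN : 1 ≤ |Algebra.norm ℚ x| := by
    have h1 : IsIntegral ℤ (Algebra.norm ℚ x) := Algebra.isIntegral_norm ℚ hi
    obtain ⟨y, hy⟩ := IsIntegrallyClosed.isIntegral_iff.1 h1
    have hy0 : y ≠ 0 := by
      rintro rfl
      rw [map_zero] at hy
      exact hx (Algebra.norm_eq_zero_iff.1 hy.symm)
    rw [← hy]
    have := Int.one_le_abs hy0
    simp only [algebraMap_int_eq, eq_intCast]
    exact_mod_cast this
  have hprod : algebraMap ℚ ℂ (Algebra.norm ℚ x) = ∏ σ : K →ₐ[ℚ] ℂ, σ x := Algebra.norm_eq_prod_embeddings ℚ ℂ x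
  have h2 : (|Algebra.norm ℚ x| : ℝ) = ∏ σ : K →ₐ[ℚ] ℂ, ‖σ x‖ := by
    rw [← norm_prod, ← hprod]
    simp [← Rat.cast_abs]
  have h3 : (1:ℝ) ≤ ∏ σ : K →ₐ[ℚ] ℂ, ‖σ x‖ := by
    rw [← h2]; exact_mod_cast hN
  let σ₀ : K →ₐ[ℚ] ℂ := φ₀.toRatAlgHom
  rw [← Finset.mul_prod_erase _ _ (Finset.mem_univ σ₀)] at h3
  refine h3.trans ?_
  refine mul_le_mul_of_nonneg_left ?_ (norm_nonneg _)
  calc ∏ σ ∈ univ.erase σ₀, ‖σ x‖ ≤ ∏ σ ∈ (univ.erase σ₀ : Finset (K →ₐ[ℚ] ℂ)), b :=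
        Finset.prod_le_prod (fun _ _ => norm_nonneg _) (fun σ _ => hb σ.toRingHom)
    _ = b ^ (Module.finrank ℚ K - 1) := by
        rw [Finset.prod_const, Finset.card_erase_of_mem (Finset.mem_univ _), Finset.card_univ, AlgHom.card]
    _ ≤ _ := pow_le_pow_right₀ hb1 (by omega)

end TL

end

section
namespace TL
open Finset

lemma exp_four_le : Real.exp 4 ≤ 55 := by
  have h : Real.exp 4 = Real.exp 1 ^ 4 := by rw [← Real.exp_nat_mul]; norm_num
  rw [h]
  have := Real.exp_one_lt_d9
  calc Real.exp 1 ^ 4 ≤ 2.7182818286 ^ 4 := by gcongr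
    _ ≤ 55 := by norm_num

lemma num_contra (T D Kd : ℕ) (hT : 1 ≤ T) (hD : 1 ≤ D) (t G H' M y Y : ℝ) 
    (hM0 : 0 ≤ M) (hM : M ≤ Real.exp (Kd * t + H')) (hy : y ≤ Real.exp (G * T) * (T.factorial * (4 * M) ^ T / 55 ^ (T * (T - 1) / 2)))
    (hY0 : 0 ≤ Y) (hY : Y ≤ Real.exp (Kd * t + G)) (hmain : 1 ≤ y * (T.factorial * Y ^ T) ^ (D - 1)) :
    2 * ((T:ℝ) - 1) ≤ D * Real.log T + D * Kd * t + D * G + 2 + H' := by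
  have hT0 : (0:ℝ) < T := by exact_mod_cast hT
  have hfac : (T.factorial : ℝ) ≤ Real.exp (T * Real.log T) := by
    have h1 : (T.factorial : ℝ) ≤ (T:ℝ) ^ T := by exact_mod_cast Nat.factorial_le_pow T
    rw [Real.exp_nat_mul, Real.exp_log hT0]; exact h1
  have h4 : (4 * M) ^ T ≤ Real.exp (T * (2 + Kd * t + H')) := by
    rw [Real.exp_nat_mul]
    apply pow_le_pow_left₀ (by positivity)
    rw [add_assoc, Real.exp_add]
    apply mul_le_mul _ hM hM0 (by positivity)
    have : Real.exp 2 = Real.exp 1 ^ 2 := by rw [← Real.exp_nat_mul]; norm_num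
    rw [this]
    have := Real.exp_one_gt_d9
    nlinarith
  have h55 : Real.exp (2 * (T * (T - 1))) ≤ 55 ^ (T * (T - 1) / 2) := by
    have h2 : 2 * (T * (T - 1) / 2) = T * (T - 1) := Nat.two_mul_div_two_of_even (Nat.even_mul_pred_self T)
    have h3 : ((T * (T - 1) / 2 : ℕ) : ℝ) * 4 = 2 * (T * (T - 1)) := by
      have : (2:ℝ) * ((T * (T - 1) / 2 : ℕ) : ℝ) = T * (T - 1) := by
        have h5 : ((2 * (T * (T - 1) / 2) : ℕ) : ℝ) = ((T * (T - 1) : ℕ) : ℝ) := by rw [h2]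
        push_cast [Nat.cast_sub hT] at h5
        exact_mod_cast h5
      linarith
    rw [← h3, Real.exp_nat_mul]
    exact pow_le_pow_left₀ (by positivity) exp_four_le _
  have hYT : Y ^ T ≤ Real.exp (T * (Kd * t + G)) := by
    rw [Real.exp_nat_mul]; exact pow_le_pow_left₀ hY0 hY _
  have hb : (T.factorial * Y ^ T) ^ (D - 1) ≤ Real.exp ((D - 1 : ℝ) * (T * Real.log T + T * (Kd * t + G))) := by
    have : ((D - 1 : ℕ) : ℝ) = D - 1 := by push_cast [Nat.cast_sub hD]; ring
    rw [← this, Real.exp_nat_mul]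
    apply pow_le_pow_left₀ (by positivity)
    rw [Real.exp_add]
    gcongr
  have hyy : y ≤ Real.exp (G * T + (T * Real.log T + T * (2 + Kd * t + H')) - 2 * (T * (T - 1))) := by
    refine hy.trans ?_
    have e : Real.exp (G * T + (T * Real.log T + T * (2 + Kd * t + H')) - 2 * (T * (T - 1))) =
      Real.exp (G * T) * (Real.exp (T * Real.log T) * Real.exp (T * (2 + Kd * t + H')) / Real.exp (2 * (T * (T - 1)))) := by
      rw [Real.exp_sub, Real.exp_add, Real.exp_add]; ring
    rw [e]
    apply mul_le_mul_of_nonneg_left _ (by positivity)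
    apply div_le_div₀ (by positivity) _ (by positivity) h55
    exact mul_le_mul hfac h4 (by positivity) (by positivity)
  have hfin := hmain.trans (mul_le_mul hyy hb (by positivity) (by positivity))
  rw [← Real.exp_add, Real.one_le_exp_iff] at hfin
  have : 0 ≤ (T:ℝ) * (D * Real.log T + D * Kd * t + D * G + 2 + H' - 2 * ((T:ℝ) - 1)) := by
    nlinarith [hfin]
  have := nonneg_of_mul_nonneg_right this hT0
  linarith

end TL

end

section
namespace TL
open Finset

set_option maxHeartbeats 2000000 in
theorem TL0 {K : Type*} [Field K] [NumberField K] (φ₀ : K →+* ℂ) (D : ℕ) (hD : Module.finrank ℚ K ≤ D)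
    (P1 Q1 P2 Q2 : K) (iP1 : IsIntegral ℤ P1) (iQ1 : IsIntegral ℤ Q1) (iP2 : IsIntegral ℤ P2) (iQ2 : IsIntegral ℤ Q2)
    (nP1 : P1 ≠ 0) (nQ1 : Q1 ≠ 0) (nP2 : P2 ≠ 0) (nQ2 : Q2 ≠ 0) (a1 a2 : ℝ) (ha1 : 0 ≤ a1) (ha2 : 0 ≤ a2)
    (bP1 : ∀ φ : K →+* ℂ, ‖φ P1‖ ≤ Real.exp a1) (bQ1 : ∀ φ : K →+* ℂ, ‖φ Q1‖ ≤ Real.exp a1)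
    (bP2 : ∀ φ : K →+* ℂ, ‖φ P2‖ ≤ Real.exp a2) (bQ2 : ∀ φ : K →+* ℂ, ‖φ Q2‖ ≤ Real.exp a2)
    (l1 l2 : ℝ) (h1 : φ₀ P1 = Complex.exp l1 * φ₀ Q1) (h2 : φ₀ P2 = Complex.exp l2 * φ₀ Q2)
    (hl1 : l1 ≠ 0) (bl1 : |l1| ≤ a1) (bl2 : |l2| ≤ a2)
    (Kd L R' S u : ℕ) (hKd : 1 ≤ Kd) (hL : 1 ≤ L) (hRS : Kd * L = R' * S) (hu : R' + L ≤ u)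
    (t H : ℝ) (hH : H = (R' + L) * a1 + S * a2) (ht : 111 * ((R' + L + u * S : ℕ) : ℝ) ≤ Real.exp t)
    (hnum : D * Real.log (Kd * L : ℕ) + D * Kd * t + D * (L * H) + 2 + 111 * L * (H + S) < 2 * (((Kd * L : ℕ) : ℝ) - 1)) :
    Real.exp (-(t * ((Kd * L : ℕ) + 4))) < |u * l1 + l2| := by
  classical
  by_contra hcon
  rw [not_lt] at hcon
  have hS : 1 ≤ S := by
    rcases Nat.eq_zero_or_pos S with h | h
    · rw [h] at hRS; simp at hRS; omega
    · exact h
  have hR' : 1 ≤ R' := by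
    rcases Nat.eq_zero_or_pos R' with h | h
    · rw [h] at hRS; simp at hRS; omega
    · exact h
  have hD1 : 1 ≤ D := le_trans (Module.finrank_pos (R := ℚ) (M := K)) hD
  set R := R' + L with hR
  set Zn : ℕ := R + u * S with hZn
  set Z : ℝ := (Zn : ℝ) with hZ
  set T := Kd * L with hT
  have hT1 : 1 ≤ T := Nat.mul_pos hKd hL
  have hZn1 : 1 ≤ Zn := by rw [hZn]; omega
  have hZ1 : 1 ≤ Z := by rw [hZ]; exact_mod_cast hZn1
  have hu1 : 1 ≤ u := by omega
  have ht0 : 0 ≤ t := by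
    rw [← Real.one_le_exp_iff]; linarith
  set Lam := u * l1 + l2 with hLam
  obtain ⟨g, hg, hdet⟩ := exists_det Kd L R' S u (P1 / Q1) (P2 / Q2) (div_ne_zero nP1 nQ1) (div_ne_zero nP2 nQ2)
    (by
      intro i j hij
      have hq : φ₀ Q1 ≠ 0 := by simpa using nQ1
      have e1 : φ₀ (P1 / Q1) = Complex.exp l1 := by rw [map_div₀, h1]; field_simp
      have e2 : φ₀ ((P1 / Q1) ^ i) = φ₀ ((P1 / Q1) ^ j) := congrArg φ₀ hij
      rw [map_pow, map_pow, e1, ← Complex.exp_nat_mul, ← Complex.exp_nat_mul] at e2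
      have e3 : Real.exp (i * l1) = Real.exp (j * l1) := by
        have : ((Real.exp (i * l1) : ℝ) : ℂ) = ((Real.exp (j * l1) : ℝ) : ℂ) := by
          push_cast; exact e2
        exact_mod_cast this
      have e4 := Real.exp_injective e3
      exact_mod_cast mul_right_cancel₀ hl1 e4) hKd hL hRS.le (by omega)
  let r : Fin Kd × Fin L → ℕ := fun j => ((g j).1 : ℕ)
  let s : Fin Kd × Fin L → ℕ := fun j => ((g j).2 : ℕ)
  let z : Fin Kd × Fin L → ℤ := fun j => (r j : ℤ) - u * s j
  have hr : ∀ j, r j < R := fun j => (g j).1.2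
  have hs : ∀ j, s j < S := fun j => (g j).2.2
  have hzinj : Function.Injective z := by
    intro i j hij
    have hz1 : ∀ j, (z j) % u = r j := by
      intro j
      simp only [z]
      rw [Int.sub_mul_emod_self_left]
      apply Int.emod_eq_of_lt (by positivity)
      have := hr j; omega
    have e1 : r i = r j := by
      have := hz1 i; rw [hij, hz1 j] at this; exact_mod_cast this.symm
    have e2 : s i = s j := by
      simp only [z] at hij
      rw [e1] at hij
      have : (u:ℤ) * s i = u * s j := by linarith
      have h0 : (u:ℤ) ≠ 0 := by omega
      exact_mod_cast mul_left_cancel₀ h0 this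
    exact hg (Prod.ext (Fin.ext e1) (Fin.ext e2))
  have hzZ : ∀ j, |(z j : ℝ)| ≤ Z := by
    intro j
    have h3 : (r j : ℝ) ≤ R := by exact_mod_cast (hr j).le
    have h4 : (u:ℝ) * s j ≤ u * S := by have := (hs j).le; gcongr
    have h5 : Z = R + u * S := by rw [hZ, hZn]; push_cast; ring
    have h6 : (0:ℝ) ≤ u * s j := by positivity
    have h7 : (0:ℝ) ≤ r j := by positivity
    have h8 : (0:ℝ) ≤ u * S := by positivity
    simp only [z]; push_cast
    rw [abs_le]; constructor <;> linarith
  let ι := Fin Kd × Fin L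
  have hcard : Fintype.card (Fin Kd × Fin L) = T := by simp [hT]
  let N : Matrix ι ι K := Matrix.of fun i j =>
    (z j : K) ^ (i.1 : ℕ) * (P1 ^ (r j) * Q1 ^ (R - r j) * (P2 ^ (s j) * Q2 ^ (S - s j))) ^ (i.2 : ℕ)
  have hNdet : N.det ≠ 0 := by
    have : N = Matrix.of fun i j => (Q1 ^ R * Q2 ^ S) ^ (i.2 : ℕ) * (Matrix.of fun (i j : Fin Kd × Fin L) =>
        (((g j).1 : ℕ) - u * ((g j).2 : ℕ) : K) ^ (i.1 : ℕ) *
          ((P1/Q1) ^ ((g j).1 : ℕ) * (P2/Q2) ^ ((g j).2 : ℕ)) ^ (i.2 : ℕ)) i j := by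
      ext i j
      simp only [N, Matrix.of_apply]
      have e1 : P1 ^ (r j) * Q1 ^ (R - r j) = Q1 ^ R * (P1 / Q1) ^ (r j) := by
        rw [← pow_mul_pow_sub Q1 (hr j).le, div_pow]; field_simp
      have e2 : P2 ^ (s j) * Q2 ^ (S - s j) = Q2 ^ S * (P2 / Q2) ^ (s j) := by
        rw [← pow_mul_pow_sub Q2 (hs j).le, div_pow]; field_simp
      rw [e1, e2]
      simp only [z, r, s]; push_cast
      rw [mul_left_comm ((Q1 ^ R * Q2 ^ S) ^ (i.2:ℕ)), ← mul_pow (Q1 ^ R * Q2 ^ S)]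
      congr 2; ring
    rw [this, Matrix.det_mul_column]
    refine mul_ne_zero ?_ hdet
    exact Finset.prod_ne_zero_iff.2 fun i _ => pow_ne_zero _ (mul_ne_zero (pow_ne_zero _ nQ1) (pow_ne_zero _ nQ2))
  have hNint : IsIntegral ℤ N.det := by
    apply IsIntegral.det
    intro i j
    simp only [N, Matrix.of_apply]
    refine IsIntegral.mul (IsIntegral.pow ?_ _) (IsIntegral.pow (((iP1.pow _).mul (iQ1.pow _)).mul ((iP2.pow _).mul (iQ2.pow _))) _)
    exact isIntegral_algebraMap (R := ℤ) (A := K) (x := z j)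
  have hH0 : 0 ≤ H := by rw [hH]; positivity
  have hpq : ∀ (φ : K →+* ℂ) (a : ℝ) (P Q : K) (m M : ℕ), m ≤ M → 0 ≤ a → ‖φ P‖ ≤ Real.exp a → ‖φ Q‖ ≤ Real.exp a →
      ‖φ (P ^ m * Q ^ (M - m))‖ ≤ Real.exp (M * a) := by
    intro φ a P Q m M hm ha hP hQ
    rw [map_mul, map_pow, map_pow, norm_mul, norm_pow, norm_pow, Real.exp_nat_mul, ← pow_mul_pow_sub _ hm]
    gcongr
  have hRc : (R : ℝ) = R' + L := by rw [hR]; push_cast; ring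
  have hent : ∀ φ : K →+* ℂ, ∀ i j, ‖φ (N i j)‖ ≤ Z ^ Kd * Real.exp (L * H) := by
    intro φ i j
    simp only [N, Matrix.of_apply]
    rw [map_mul, map_pow, map_pow, norm_mul, norm_pow, norm_pow, map_intCast, Complex.norm_intCast]
    have hc1 : |(z j : ℝ)| ^ (i.1:ℕ) ≤ Z ^ Kd := by
      calc |(z j : ℝ)| ^ (i.1:ℕ) ≤ Z ^ (i.1:ℕ) := pow_le_pow_left₀ (abs_nonneg _) (hzZ j) _
        _ ≤ _ := pow_le_pow_right₀ hZ1 i.1.2.le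
    have hc2 : ‖φ (P1 ^ (r j) * Q1 ^ (R - r j) * (P2 ^ (s j) * Q2 ^ (S - s j)))‖ ≤ Real.exp H := by
      rw [map_mul, norm_mul, hH, Real.exp_add, ← hRc]
      exact mul_le_mul (hpq φ a1 P1 Q1 _ _ (hr j).le ha1 (bP1 φ) (bQ1 φ)) (hpq φ a2 P2 Q2 _ _ (hs j).le ha2 (bP2 φ) (bQ2 φ))
        (norm_nonneg _) (by positivity)
    have hc3 : ‖φ (P1 ^ (r j) * Q1 ^ (R - r j) * (P2 ^ (s j) * Q2 ^ (S - s j)))‖ ^ (i.2:ℕ) ≤ Real.exp (L * H) := by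
      rw [Real.exp_nat_mul]
      refine (pow_le_pow_left₀ (norm_nonneg _) hc2 _).trans ?_
      exact pow_le_pow_right₀ (Real.one_le_exp hH0) i.2.2.le
    exact mul_le_mul hc1 hc3 (by positivity) (by positivity)
  set Y := Z ^ Kd * Real.exp (L * H) with hY
  have hY1 : 1 ≤ Y := by
    rw [hY]
    exact one_le_mul_of_one_le_of_one_le (one_le_pow₀ hZ1) (Real.one_le_exp (by positivity))
  have hb : ∀ φ : K →+* ℂ, ‖φ N.det‖ ≤ T.factorial * Y ^ T := by
    intro φ
    rw [RingHom.map_det]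
    exact norm_det_le T hcard _ Y (fun i j => hent φ i j)
  have hb1 : 1 ≤ T.factorial * Y ^ T := by
    refine one_le_mul_of_one_le_of_one_le ?_ (one_le_pow₀ hY1)
    exact_mod_cast Nat.succ_le_of_lt (Nat.factorial_pos T)
  have hlow := norm_lower φ₀ D hD N.det hNdet hNint _ hb1 hb
  -- upper bound at φ₀
  have hZt : 111 * Z ≤ Real.exp t := ht
  have hLam1 : |Lam| ≤ 1 := by
    refine hcon.trans ?_
    rw [Real.exp_le_one_iff]
    have : 0 ≤ t * ((T:ℝ) + 4) := by positivity
    linarith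
  have hl1Z : |l1| * Z ≤ H + S := by
    have e1 : u * |l1| ≤ 1 + a2 := by
      have : |u * l1| = |Lam - l2| := by rw [hLam]; ring_nf
      rw [abs_mul, Nat.abs_cast] at this
      rw [this]
      calc |Lam - l2| ≤ |Lam| + |l2| := abs_sub _ _
        _ ≤ _ := add_le_add hLam1 bl2
    have e2 : Z = R + u * S := by rw [hZ, hZn]; push_cast; ring
    rw [e2, hH, ← hRc]
    have e3 : (R:ℝ) * |l1| ≤ R * a1 := by gcongr
    have e4 : (S:ℝ) * (u * |l1|) ≤ S * (1 + a2) := by gcongr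
    nlinarith
  let f : ι → ℂ → ℂ := fun i w => w ^ (i.1:ℕ) * Complex.exp ((i.2:ℕ) * l1 * w)
  let E : Matrix ι ι ℂ := Matrix.of fun i j => f i (z j) * (Complex.exp ((i.2:ℕ) * s j * Lam) - 1)
  set M := (111 * Z) ^ Kd * Real.exp (111 * L * (H + S)) with hMdef
  have hHS : 0 ≤ H + S := by positivity
  have hfb : ∀ i w, ‖w‖ ≤ 111 * Z → ‖f i w‖ ≤ M := by
    intro i w hw
    simp only [f]
    rw [norm_mul, norm_pow, Complex.norm_exp]
    refine mul_le_mul ?_ ?_ (by positivity) (by positivity)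
    · refine (pow_le_pow_left₀ (norm_nonneg _) hw _).trans ?_
      exact pow_le_pow_right₀ (by linarith) i.1.2.le
    · rw [Real.exp_le_exp]
      refine (Complex.re_le_norm _).trans ?_
      rw [norm_mul, norm_mul, Complex.norm_natCast, Complex.norm_real, Real.norm_eq_abs]
      have hi : ((i.2:ℕ):ℝ) ≤ L := by exact_mod_cast i.2.2.le
      calc ((i.2:ℕ):ℝ) * |l1| * ‖w‖ ≤ L * |l1| * (111 * Z) := by gcongr
        _ = 111 * L * (|l1| * Z) := by ring
        _ ≤ _ := by gcongr
  have hM0 : 0 ≤ M := by positivity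
  have hELL : (T:ℝ) * (L * S) ≤ Z ^ 4 := by
    have e1 : (R':ℝ) ≤ Z := by rw [hZ]; norm_cast; rw [hZn, hR]; omega
    have e2 : (S:ℝ) ≤ Z := by
      rw [hZ]; norm_cast; rw [hZn]
      have : S ≤ u * S := Nat.le_mul_of_pos_left _ hu1
      omega
    have e3 : (L:ℝ) ≤ Z := by rw [hZ]; norm_cast; rw [hZn, hR]; omega
    have e4 : (T:ℝ) = R' * S := by rw [hRS]; push_cast; ring
    rw [e4]
    calc (R':ℝ) * S * (L * S) ≤ Z * Z * (Z * Z) := by gcongr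
      _ = Z ^ 4 := by ring
  have hZe : Z ≤ Real.exp t := by linarith
  have hsm : (T:ℝ) * (L * S * |Lam|) * (110 * Z) ^ T ≤ 1 := by
    have e1 : (110 * Z) ^ T ≤ Real.exp (T * t) := by
      rw [Real.exp_nat_mul]; exact pow_le_pow_left₀ (by positivity) (by linarith) _
    have e2 : (T:ℝ) * (L * S) ≤ Real.exp (4 * t) := by
      refine hELL.trans ?_
      have : Real.exp (4 * t) = Real.exp t ^ 4 := by rw [← Real.exp_nat_mul]; norm_num
      rw [this]
      exact pow_le_pow_left₀ (by positivity) hZe _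
    calc (T:ℝ) * (L * S * |Lam|) * (110 * Z) ^ T = (T * (L * S)) * |Lam| * (110 * Z) ^ T := by ring
      _ ≤ Real.exp (4 * t) * Real.exp (-(t * ((T:ℝ) + 4))) * Real.exp (T * t) := by gcongr
      _ = 1 := by rw [← Real.exp_add, ← Real.exp_add, Real.exp_eq_one_iff]; ring
  have hLS1 : (L:ℝ) * S * |Lam| ≤ 1 := by
    have e1 : (1:ℝ) ≤ T := by exact_mod_cast hT1
    have e2 : (1:ℝ) ≤ (110 * Z) ^ T := one_le_pow₀ (by linarith)
    have e3 : 0 ≤ (L:ℝ) * S * |Lam| := by positivity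
    calc (L:ℝ) * S * |Lam| = 1 * (L * S * |Lam|) * 1 := by ring
      _ ≤ (T:ℝ) * (L * S * |Lam|) * (110 * Z) ^ T := by gcongr
      _ ≤ 1 := hsm
  have hE : ∀ i j, T * ‖E i j‖ * (110 * Z) ^ T ≤ 2 * M := by
    intro i j
    have e1 : ‖Complex.exp ((i.2:ℕ) * s j * Lam) - 1‖ ≤ 2 * (L * S * |Lam|) := by
      have e2 : ‖((i.2:ℕ) * s j * Lam : ℂ)‖ ≤ L * S * |Lam| := by
        rw [norm_mul, norm_mul, Complex.norm_natCast, Complex.norm_natCast, Complex.norm_real, Real.norm_eq_abs]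
        have hi : ((i.2:ℕ):ℝ) ≤ L := by exact_mod_cast i.2.2.le
        have hj : (s j:ℝ) ≤ S := by exact_mod_cast (hs j).le
        gcongr
      refine (Complex.norm_exp_sub_one_le (e2.trans hLS1)).trans ?_
      linarith
    have e3 : ‖f i (z j)‖ ≤ M := hfb i _ (by
      rw [Complex.norm_intCast]; have := hzZ j; linarith)
    simp only [E, Matrix.of_apply]
    rw [norm_mul]
    calc (T:ℝ) * (‖f i (z j)‖ * ‖Complex.exp ((i.2:ℕ) * s j * Lam) - 1‖) * (110 * Z) ^ T
        ≤ T * (M * (2 * (L * S * |Lam|))) * (110 * Z) ^ T := by gcongr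
      _ = 2 * M * (T * (L * S * |Lam|) * (110 * Z) ^ T) := by ring
      _ ≤ 2 * M * 1 := by gcongr
      _ = _ := by ring
  have hup := det_upper' T hcard z hzinj Z M hZ1 hzZ f (fun i => by
      simp only [f]; fun_prop) (fun i w hw => hfb i w hw.le) E hE
  set q := φ₀ (Q1 ^ R * Q2 ^ S) with hq
  have hqb : ‖q‖ ≤ Real.exp H := by
    rw [hq, map_mul, norm_mul, hH, Real.exp_add, ← hRc]
    have := hpq φ₀ a1 Q1 Q1 R R le_rfl ha1 (bQ1 φ₀) (bQ1 φ₀)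
    have := hpq φ₀ a2 Q2 Q2 S S le_rfl ha2 (bQ2 φ₀) (bQ2 φ₀)
    simp only [Nat.sub_self, pow_zero, mul_one] at *
    gcongr
  have hφN : φ₀ N.det = (∏ i : ι, q ^ (i.2:ℕ)) * (Matrix.of fun i j => f i (z j) + E i j).det := by
    rw [← Matrix.det_mul_column, RingHom.map_det]
    congr 1
    ext i j
    simp only [RingHom.mapMatrix_apply, Matrix.map_apply, N, Matrix.of_apply, E, f]
    have e1 : φ₀ (P1 ^ (r j) * Q1 ^ (R - r j)) = φ₀ Q1 ^ R * Complex.exp (r j * l1) := by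
      rw [map_mul, map_pow, map_pow, h1, mul_pow, Complex.exp_nat_mul, ← pow_mul_pow_sub (φ₀ Q1) (hr j).le]; ring
    have e2 : φ₀ (P2 ^ (s j) * Q2 ^ (S - s j)) = φ₀ Q2 ^ S * Complex.exp (s j * l2) := by
      rw [map_mul, map_pow, map_pow, h2, mul_pow, Complex.exp_nat_mul, ← pow_mul_pow_sub (φ₀ Q2) (hs j).le]; ring
    have e3 : Complex.exp (r j * l1) * Complex.exp (s j * l2) = Complex.exp (z j * l1) * Complex.exp (s j * Lam) := by
      rw [← Complex.exp_add, ← Complex.exp_add, hLam]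
      congr 1
      simp only [z]; push_cast; ring
    have e4 : Complex.exp ((i.2:ℕ) * l1 * z j) = Complex.exp (z j * l1) ^ (i.2:ℕ) := by
      rw [← Complex.exp_nat_mul]; ring_nf
    have e5 : Complex.exp ((i.2:ℕ) * s j * Lam) = Complex.exp (s j * Lam) ^ (i.2:ℕ) := by
      rw [← Complex.exp_nat_mul]; ring_nf
    rw [map_mul, map_pow, map_pow, map_mul, e1, e2, map_intCast, hq, map_mul, map_pow, map_pow, e4, e5]
    have e6 : φ₀ Q1 ^ R * Complex.exp (r j * l1) * (φ₀ Q2 ^ S * Complex.exp (s j * l2)) =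
      φ₀ Q1 ^ R * φ₀ Q2 ^ S * (Complex.exp (z j * l1) * Complex.exp (s j * Lam)) := by
      rw [← e3]; ring
    rw [e6]
    ring
  have hyb : ‖φ₀ N.det‖ ≤ Real.exp ((L * H) * T) * (T.factorial * (4 * M) ^ T / 55 ^ (T * (T - 1) / 2)) := by
    rw [hφN, norm_mul]
    refine mul_le_mul ?_ hup (norm_nonneg _) (by positivity)
    rw [norm_prod, mul_comm (L * H : ℝ), Real.exp_nat_mul]
    have : ∏ i : ι, ‖q ^ (i.2:ℕ)‖ ≤ ∏ i : ι, Real.exp (L * H) := by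
      apply Finset.prod_le_prod (fun _ _ => norm_nonneg _)
      intro i _
      rw [norm_pow, Real.exp_nat_mul]
      refine (pow_le_pow_left₀ (norm_nonneg _) hqb _).trans ?_
      exact pow_le_pow_right₀ (Real.one_le_exp hH0) i.2.2.le
    rwa [Finset.prod_const, Finset.card_univ, hcard] at this
  have hfinal := num_contra T D Kd hT1 hD1 t (L * H) (111 * L * (H + S)) M ‖φ₀ N.det‖ Y hM0
    (by
      rw [hMdef, Real.exp_add, Real.exp_nat_mul]
      gcongr) hyb (by linarith) (by
      rw [hY, Real.exp_add, Real.exp_nat_mul t Kd]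
      gcongr) hlow
  linarith

end TL

end

section
namespace TL
open Finset

lemma num_ok (D L a1 a2 : ℕ) (t : ℝ) (hL : 1 ≤ L) (ha1 : 1 ≤ a1) (ha2 : 1 ≤ a2) (hLt : D * t ≤ L) :
    D * Real.log ((25 * (D+222)^2 * L * a1 * a2 * L : ℕ):ℝ) + D * ((25 * (D+222)^2 * L * a1 * a2 : ℕ) : ℝ) * t
      + D * (L * (((5 * (D+222) * L * a2 : ℕ) + L) * (a1:ℝ) + (5 * (D+222) * L * a1 : ℕ) * (a2:ℝ)))
      + 2 + 111 * L * ((((5 * (D+222) * L * a2 : ℕ) + L) * (a1:ℝ) + (5 * (D+222) * L * a1 : ℕ) * (a2:ℝ)) + (5 * (D+222) * L * a1 : ℕ))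
      < 2 * (((25 * (D+222)^2 * L * a1 * a2 * L : ℕ):ℝ) - 1) := by
  set T : ℝ := ((25 * (D+222)^2 * L * a1 * a2 * L : ℕ):ℝ) with hT
  push_cast at hT ⊢
  obtain ⟨x, hx⟩ : ∃ x : ℝ, x = L := ⟨_, rfl⟩
  obtain ⟨y, hy⟩ : ∃ y : ℝ, y = a1 := ⟨_, rfl⟩
  obtain ⟨w, hw⟩ : ∃ y : ℝ, y = a2 := ⟨_, rfl⟩
  obtain ⟨d, hd⟩ : ∃ y : ℝ, y = D + 222 := ⟨_, rfl⟩
  have hD : (D:ℝ) = d - 222 := by rw [hd]; ring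
  have hx1 : 1 ≤ x := by rw [hx]; exact_mod_cast hL
  have hy1 : 1 ≤ y := by rw [hy]; exact_mod_cast ha1
  have hw1 : 1 ≤ w := by rw [hw]; exact_mod_cast ha2
  have hd1 : 222 ≤ d := by rw [hd]; have : (0:ℝ) ≤ D := by positivity
                           linarith
  rw [← hx, ← hd, ← hy, ← hw] at hT ⊢
  rw [← hx] at hLt
  have hx2 : 1 ≤ x * x := by nlinarith
  have hyw : 1 ≤ y * w := by nlinarith
  have hq : 1 ≤ x * x * (y * w) := by nlinarith
  have hyyw : y ≤ y * w := by nlinarith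
  have hTd : (5 * d) ^ 2 ≤ T := by
    rw [hT]; nlinarith [mul_nonneg (sq_nonneg d) (sub_nonneg.2 hq)]
  have hT0 : 0 < T := by nlinarith
  have hlog : D * Real.log T ≤ 0.4 * T := by
    have h1 : Real.log T = 2 * Real.log (Real.sqrt T) := by rw [Real.log_sqrt hT0.le]; ring
    have h2 := Real.log_le_sub_one_of_pos (Real.sqrt_pos.2 hT0)
    have h3 : 5 * d ≤ Real.sqrt T := Real.le_sqrt_of_sq_le hTd
    have h4 := Real.mul_self_sqrt hT0.le
    rw [h1]
    have hD0 : (0:ℝ) ≤ D := by positivity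
    have h5 : D * (2 * Real.log (Real.sqrt T)) ≤ D * (2 * Real.sqrt T) := by
      apply mul_le_mul_of_nonneg_left _ hD0; linarith
    have h6 : (D:ℝ) * (2 * Real.sqrt T) ≤ d * (2 * Real.sqrt T) := by
      apply mul_le_mul_of_nonneg_right _ (by positivity); linarith
    nlinarith [mul_le_mul_of_nonneg_right h3 (Real.sqrt_nonneg T)]
  have h2 : D * (25 * d ^ 2 * x * y * w) * t ≤ T := by
    have : 0 ≤ 25 * d ^ 2 * x * y * w := by positivity
    calc D * (25 * d ^ 2 * x * y * w) * t = (25 * d ^ 2 * x * y * w) * (D * t) := by ring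
      _ ≤ (25 * d ^ 2 * x * y * w) * x := by gcongr
      _ = T := by rw [hT]
  have h3 : D * (x * ((5 * d * x * w + x) * y + 5 * d * x * y * w)) + 111 * x * ((5 * d * x * w + x) * y + 5 * d * x * y * w + 5 * d * x * y) ≤ 0.4 * T := by
    rw [hD, hT]
    have e : 0.4 * (25 * d ^ 2 * x * y * w * x) - ((d - 222) * (x * ((5 * d * x * w + x) * y + 5 * d * x * y * w)) + 111 * x * ((5 * d * x * w + x) * y + 5 * d * x * y * w + 5 * d * x * y))
       = x * x * (1110 * d * (y * w) - (d - 111) * y - 555 * d * y) := by ring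
    have : 0 ≤ x * x * (1110 * d * (y * w) - (d - 111) * y - 555 * d * y) := by
      apply mul_nonneg (by positivity)
      have : d * y ≤ d * (y * w) := by gcongr
      have : 0 ≤ d * y := by positivity
      nlinarith
    linarith
  have hT4 : 1000 ≤ T := by nlinarith
  nlinarith [h2, h3, hlog]

theorem TL1 {K : Type*} [Field K] [NumberField K] (φ₀ : K →+* ℂ) (D : ℕ) (hD : Module.finrank ℚ K ≤ D)
    (P1 Q1 P2 Q2 : K) (iP1 : IsIntegral ℤ P1) (iQ1 : IsIntegral ℤ Q1) (iP2 : IsIntegral ℤ P2) (iQ2 : IsIntegral ℤ Q2)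
    (nP1 : P1 ≠ 0) (nQ1 : Q1 ≠ 0) (nP2 : P2 ≠ 0) (nQ2 : Q2 ≠ 0) (a1 a2 : ℕ) (ha1 : 1 ≤ a1) (ha2 : 1 ≤ a2)
    (bP1 : ∀ φ : K →+* ℂ, ‖φ P1‖ ≤ Real.exp a1) (bQ1 : ∀ φ : K →+* ℂ, ‖φ Q1‖ ≤ Real.exp a1)
    (bP2 : ∀ φ : K →+* ℂ, ‖φ P2‖ ≤ Real.exp a2) (bQ2 : ∀ φ : K →+* ℂ, ‖φ Q2‖ ≤ Real.exp a2)
    (l1 l2 : ℝ) (h1 : φ₀ P1 = Complex.exp l1 * φ₀ Q1) (h2 : φ₀ P2 = Complex.exp l2 * φ₀ Q2)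
    (hl1 : l1 ≠ 0) (bl1 : |l1| ≤ a1) (bl2 : |l2| ≤ a2)
    (L u : ℕ) (t : ℝ) (hL : 1 ≤ L) (hLt : D * t ≤ L) (hu : 5 * (D+222) * L * a2 + L ≤ u)
    (ht : 111 * ((5 * (D+222) * L * a2 + L + u * (5 * (D+222) * L * a1) : ℕ) : ℝ) ≤ Real.exp t) :
    Real.exp (-(t * (25 * (D+222)^2 * L^2 * a1 * a2 + 4))) < |u * l1 + l2| := by
  have := TL0 φ₀ D hD P1 Q1 P2 Q2 iP1 iQ1 iP2 iQ2 nP1 nQ1 nP2 nQ2 a1 a2 (by positivity) (by positivity)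
    bP1 bQ1 bP2 bQ2 l1 l2 h1 h2 hl1 bl1 bl2 (25 * (D+222)^2 * L * a1 * a2) L (5 * (D+222) * L * a2) (5 * (D+222) * L * a1) u
    (by have : 0 < 25 * (D+222)^2 * L * a1 * a2 := by positivity
        omega) hL (by ring) hu t _ rfl ht (num_ok D L a1 a2 t hL ha1 ha2 hLt)
  convert this using 4
  push_cast; ring

end TL

end

section
namespace TL
open Finset

/-- shifted sequence starting with `k-2` zeros -/
def gL (k i : ℕ) : ℕ := if i + 2 < k then 0 else lucasK k (i + 2 - k)

lemma gL_rec (k : ℕ) (hk : 2 ≤ k) (i : ℕ) : gL k (i + k) = ∑ j ∈ range k, gL k (i + j) := by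
  have h1 : gL k (i + k) = lucasK k (i + 2) := by
    unfold gL; rw [if_neg (by omega)]; congr 1; omega
  rw [h1, lucasK, ← Finset.sum_range_reflect]
  refine Finset.sum_congr rfl fun j hj => ?_
  rw [Finset.mem_range] at hj
  unfold gL
  by_cases h : i + j + 2 < k
  · rw [if_pos h, dif_neg (by omega)]
  · rw [if_neg h, dif_pos (by omega)]; congr 1; omega

lemma gL_eq (k n : ℕ) (hk : 2 ≤ k) : gL k (n + k - 2) = lucasK k n := by
  unfold gL; rw [if_neg (by omega)]; congr 1; omega

lemma lucasK_succ' (k n : ℕ) (hk : 2 ≤ k) (hn : k ≤ n) :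
    lucasK k (n + 1) + lucasK k (n - k) = 2 * lucasK k n := by
  have e1 : lucasK k (n+1) = gL k ((n - 1) + k) := by
    rw [← gL_eq k (n+1) hk]; congr 1; omega
  have e2 : lucasK k n = gL k ((n - 2) + k) := by
    rw [← gL_eq k n hk]; congr 1; omega
  have e3 : lucasK k (n - k) = gL k (n - 2) := by
    rw [← gL_eq k (n-k) hk]; congr 1; omega
  rw [e1, gL_rec k hk, e2, e3]
  obtain ⟨m, rfl⟩ : ∃ m, n = m + 2 := ⟨n - 2, by omega⟩
  have h1 := Finset.sum_range_succ (fun j => gL k (m + j)) k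
  have h2 := Finset.sum_range_succ' (fun j => gL k (m + j)) k
  have h3 := gL_rec k hk m
  have h4 : ∀ j, gL k (m + 2 - 1 + j) = gL k (m + (j + 1)) := fun j => by congr 1; omega
  simp only [h4, Nat.add_sub_cancel] at *
  simp only [add_zero] at h2
  omega

lemma lucasK_succ (k n : ℕ) (hk : 2 ≤ k) (hn : k + 1 ≤ n) :
    lucasK k (n + 1) + lucasK k (n - k) = 2 * lucasK k n := lucasK_succ' k n hk (by omega)

lemma lucasK_two (k : ℕ) (hk : 2 ≤ k) : lucasK k 2 = 3 := by
  obtain ⟨m, rfl⟩ : ∃ m, k = m + 2 := ⟨k - 2, by omega⟩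
  rw [lucasK, Finset.sum_range_succ', Finset.sum_range_succ']
  simp [lucasK]

lemma lucasK_double (k m : ℕ) (hk : m + 3 ≤ k) : lucasK k (m + 3) = 2 * lucasK k (m + 2) := by
  obtain ⟨q, rfl⟩ : ∃ q, k = q + 1 := ⟨k - 1, by omega⟩
  have e1 : lucasK (q+1) (m + 2) = ∑ j ∈ range q, if _ : j ≤ m + 1 then lucasK (q+1) (m + 1 - j) else 0 := by
    rw [lucasK, Finset.sum_range_succ, dif_neg (by omega), add_zero]
  have e2 : lucasK (q+1) (m + 3) = (∑ j ∈ range q, if _ : j ≤ m + 1 then lucasK (q+1) (m + 1 - j) else 0) + lucasK (q+1) (m+2) := by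
    rw [show m + 3 = (m + 1) + 2 by ring, lucasK, Finset.sum_range_succ', dif_pos (by omega)]
    congr 1
    refine Finset.sum_congr rfl fun j _ => ?_
    by_cases h : j ≤ m + 1
    · rw [dif_pos h, dif_pos (by omega)]; congr 1; omega
    · rw [dif_neg h, dif_neg (by omega)]
  omega

lemma lucasK_small (k : ℕ) (hk : 2 ≤ k) (l : ℕ) (hl : l + 2 ≤ k) : lucasK k (l + 2) = 3 * 2 ^ l := by
  induction l with
  | zero => simpa using lucasK_two k hk
  | succ m ih =>
    rw [lucasK_double k m (by omega), ih (by omega), pow_succ]; ring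

lemma lucasK_le (k n : ℕ) : lucasK k n ≤ 2 ^ (n + 1) := by
  induction n using Nat.strong_induction_on with
  | _ n ih =>
    match n with
    | 0 => simp [lucasK]
    | 1 => simp [lucasK]
    | n + 2 =>
      rw [lucasK]
      have h1 : ∀ q, ∑ j ∈ range q, (if _ : j ≤ n + 1 then lucasK k (n + 1 - j) else 0) ≤ 2 ^ (n + 3) := by
        intro q
        have : ∀ q, ∑ j ∈ range q, (if _ : j ≤ n + 1 then lucasK k (n + 1 - j) else 0) + 2 ^ (n + 3 - q) ≤ 2 ^ (n + 3) + (if n + 3 ≤ q then 1 else 0) := by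
          intro q
          induction q with
          | zero => simp
          | succ q ihq =>
            rw [Finset.sum_range_succ]
            by_cases h : q ≤ n + 1
            · rw [dif_pos h]
              have h3 := ih (n + 1 - q) (by omega)
              have h4 : 2 ^ (n + 3 - q) = 2 ^ (n + 3 - (q + 1)) + 2 ^ (n + 1 - q + 1) := by
                have a1 : n + 3 - q = (n + 1 - q + 1) + 1 := by omega
                have a2 : n + 3 - (q + 1) = n + 1 - q + 1 := by omega
                rw [a1, a2, pow_succ]; ring
              rw [if_neg (by omega)] at ihq ⊢
              omega
            · rw [dif_neg h]
              by_cases h5 : n + 3 ≤ q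
              · rw [if_pos h5] at ihq
                rw [if_pos (by omega)]
                have a1 : n + 3 - q = 0 := by omega
                have a2 : n + 3 - (q + 1) = 0 := by omega
                rw [a1] at ihq; rw [a2]; omega
              · have a0 : q = n + 2 := by omega
                subst a0
                rw [if_neg (by omega)] at ihq
                rw [if_pos (by omega)]
                have a1 : n + 3 - (n + 2) = 1 := by omega
                have a2 : n + 3 - (n + 2 + 1) = 0 := by omega
                rw [a1] at ihq; rw [a2]; omega
        have h2 := this q
        have h3 : 1 ≤ 2 ^ (n + 3 - q) := Nat.one_le_two_pow
        split_ifs at h2 <;> omega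
      exact h1 k

lemma lucasK_pos (k n : ℕ) (hk : 2 ≤ k) : 1 ≤ lucasK k n := by
  induction n using Nat.strong_induction_on with
  | _ n ih =>
    match n with
    | 0 => simp [lucasK]
    | 1 => simp [lucasK]
    | n + 2 =>
      rw [lucasK]
      obtain ⟨q, rfl⟩ : ∃ q, k = q + 1 := ⟨k - 1, by omega⟩
      rw [Finset.sum_range_succ', dif_pos (by omega)]
      have := ih (n + 1 - 0) (by omega)
      omega

end TL

end

section
namespace TL
open Finset

structure Root (k : ℕ) (α : ℝ) : Prop where
  hk : 2 ≤ k
  lo : 1.6 < α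
  hi : α < 2
  eq : α ^ k * (2 - α) = 1

lemma exists_root (k : ℕ) (hk : 2 ≤ k) : ∃ α, Root k α := by
  have hc : ContinuousOn (fun x : ℝ => x ^ k * (2 - x)) (Set.Icc 1.6 2) := by fun_prop
  have h1 : (1:ℝ) < (1.6:ℝ) ^ k * (2 - 1.6) := by
    have : (1.6:ℝ) ^ 2 ≤ (1.6:ℝ) ^ k := pow_le_pow_right₀ (by norm_num) hk
    norm_num at this ⊢; linarith
  have := intermediate_value_Ioo' (by norm_num : (1.6:ℝ) ≤ 2) hc
  obtain ⟨x, hx, he⟩ := this (show (1:ℝ) ∈ _ from ⟨by simp, h1⟩)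
  exact ⟨x, hk, hx.1, hx.2, he⟩

/-- The leading coefficient. -/
noncomputable def fK (k : ℕ) (α : ℝ) : ℝ := (2 * α - 1) * (α - 1) / (α * ((k + 1) * α - 2 * k))

lemma pow16 (k : ℕ) (hk : 3 ≤ k) : (k + 1 : ℝ) ≤ 0.98 * 1.6 ^ k := by
  induction k, hk using Nat.le_induction with
  | base => norm_num
  | succ m hm ih =>
    rw [pow_succ]; push_cast
    have : (3:ℝ) ≤ m := by exact_mod_cast hm
    linarith

lemma Root.two_sub {k : ℕ} {α : ℝ} (h : Root k α) : (2 - α) = (α⁻¹) ^ k := by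
  have : α ^ k ≠ 0 := by have := h.lo; positivity
  rw [inv_pow]; exact eq_inv_of_mul_eq_one_right h.eq

lemma Root.k2 {α : ℝ} (h : Root 2 α) : α ^ 2 = α + 1 := by
  have := h.eq; have h1 := h.lo
  have : (α - 1) * (α ^ 2 - α - 1) = 0 := by linarith
  rcases mul_eq_zero.1 this with h2 | h2 <;> linarith

lemma Root.kp {k : ℕ} {α : ℝ} (h : Root k α) (hk : 3 ≤ k) : (k + 1 : ℝ) * (2 - α) ≤ 0.98 := by
  have h1 := pow16 k hk
  have h2 : (1.6:ℝ) ^ k ≤ α ^ k := pow_le_pow_left₀ (by norm_num) h.lo.le k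
  have h3 : 0 < 2 - α := by have := h.hi; linarith
  have h4 := h.eq
  nlinarith

lemma Root.del_pos {k : ℕ} {α : ℝ} (h : Root k α) : 0 < (k + 1) * α - 2 * k := by
  rcases Nat.lt_or_ge 2 k with hk | hk
  · have := h.kp hk; linarith
  · have := h.hk
    obtain rfl : k = 2 := by omega
    have := h.lo; push_cast; linarith

lemma fK_two {α : ℝ} (h : Root 2 α) : fK 2 α = 1 := by
  have h1 := h.k2
  have h2 := h.lo
  have h3 : α * ((((2:ℕ):ℝ) + 1) * α - 2 * (2:ℕ)) ≠ 0 := by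
    have := h.del_pos
    positivity
  unfold fK
  rw [div_eq_one_iff_eq h3]; push_cast
  linear_combination (-1) * h1

lemma Root.f_bd {k : ℕ} {α : ℝ} (h : Root k α) : 1 / 3 ≤ fK k α ∧ fK k α ≤ 3 / 2 := by
  rcases Nat.lt_or_ge 2 k with hk | hk
  · have h1 := h.kp hk
    have h2 := h.del_pos
    have h3 := h.lo
    have h4 := h.hi
    have h5 : 0 < α * ((k + 1) * α - 2 * k) := by positivity
    have h6 : 0 ≤ (k+1:ℝ) * (2 - α) := by
      have : 0 ≤ 2 - α := by linarith
      positivity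
    unfold fK
    rw [div_le_div_iff₀ (by norm_num) h5, div_le_div_iff₀ h5 (by norm_num)]
    have e : (k + 1 : ℝ) * α - 2 * k = 2 - (k+1) * (2 - α) := by ring
    rw [e]
    constructor <;> nlinarith
  · have := h.hk
    obtain rfl : k = 2 := by omega
    rw [fK_two h]; norm_num

section
variable {F : Type*} [Field F] (k : ℕ) (b : F) (h : ℕ → F)

/-- The functional annihilating all but the dominant root. -/
def Psi (i : ℕ) : F := ∑ j ∈ range k, (1 - b ^ (j + 1)) * h (i + j)

lemma Psi_succ (i : ℕ) : Psi k b h (i + 1) = ∑ j ∈ range k, (1 - b ^ j) * h (i + j) + (1 - b ^ k) * h (i + k) := by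
  rw [← Finset.sum_range_succ, Finset.sum_range_succ', Psi]
  simp only [pow_zero, sub_self, zero_mul, add_zero]
  refine Finset.sum_congr rfl fun j _ => ?_
  rw [show i + 1 + j = i + (j + 1) by ring]

lemma Psi_mul (a : F) (ha : a * b = 1) (hb : 2 - a = b ^ k) (hrec : ∀ i, h (i + k) = ∑ j ∈ range k, h (i + j)) (i : ℕ) :
    Psi k b h (i + 1) = a * Psi k b h i := by
  rw [Psi_succ, hrec, Psi, Finset.mul_sum, Finset.mul_sum, ← Finset.sum_add_distrib]
  refine Finset.sum_congr rfl fun j _ => ?_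
  rw [← hb, pow_succ]
  linear_combination (b ^ j * h (i + j)) * ha

lemma conv_of_Psi (a : F) (ha : a * b = 1) (hb : 2 - a = b ^ k) (ha1 : a ≠ 1) (hz : ∀ i, Psi k b h i = 0) (i : ℕ) :
    h (i + k) = ∑ j ∈ range k, b ^ (j + 1) * h (i + j) := by
  have h1 := hz (i + 1)
  rw [Psi_succ, ← hb] at h1
  have h2 := hz i
  rw [Psi] at h2
  have h3 : ∑ j ∈ range k, (1 - b ^ j) * h (i + j) - ∑ j ∈ range k, (1 - b ^ (j+1)) * h (i + j) =
     (1 - a) * ∑ j ∈ range k, b ^ (j + 1) * h (i + j) := by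
    rw [← Finset.sum_sub_distrib, Finset.mul_sum]
    refine Finset.sum_congr rfl fun j _ => ?_
    rw [pow_succ]
    linear_combination (b ^ j * h (i+j)) * ha
  rw [h2] at h3
  have h4 : (a - 1) * (h (i + k) - ∑ j ∈ range k, b ^ (j + 1) * h (i + j)) = 0 := by
    linear_combination h1 - h3
  rcases mul_eq_zero.1 h4 with h5 | h5
  · exact absurd (sub_eq_zero.1 h5) ha1
  · exact sub_eq_zero.1 h5
end

lemma Root.sum_inv {k : ℕ} {α : ℝ} (h : Root k α) : ∑ j ∈ range k, (α⁻¹) ^ (j + 1) = 1 := by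
  have h1 := h.lo
  have h2 := h.two_sub
  have hne : α⁻¹ ≠ 1 := by rw [Ne, inv_eq_one]; linarith
  simp only [pow_succ]
  rw [← Finset.sum_mul, geom_sum_eq hne, ← h2]
  have h0 : α ≠ 0 := by linarith
  have h3 : α - 1 ≠ 0 := by linarith
  have h4 : 1 - α ≠ 0 := by intro h; apply h3; linarith
  field_simp
  ring

lemma Root.sum_pow {k : ℕ} {α : ℝ} (h : Root k α) : α ^ k = ∑ j ∈ range k, α ^ j := by
  have h1 := h.lo
  rw [geom_sum_eq (by linarith)]
  have h3 : α - 1 ≠ 0 := by linarith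
  field_simp
  have := h.eq
  linarith

/-- error sequence -/
noncomputable def eK (k : ℕ) (α : ℝ) (i : ℕ) : ℝ := gL k i - fK k α * α ^ i / α ^ (k - 2)

lemma Root.eK_Psi0 {k : ℕ} {α : ℝ} (h : Root k α) : Psi k α⁻¹ (eK k α) 0 = 0 := by
  have h1 := h.lo
  have h2 := h.two_sub
  have hd := h.del_pos
  have h0 : α ≠ 0 := by linarith
  have h3 : α - 1 ≠ 0 := by linarith
  have hk := h.hk
  have e0 : Psi k α⁻¹ (eK k α) 0 = ∑ j ∈ range k, (1 - α⁻¹ ^ (j+1)) * (gL k j : ℝ)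
      - fK k α / α ^ (k-2) * ∑ j ∈ range k, (1 - α⁻¹ ^ (j+1)) * α ^ j := by
    rw [Psi, Finset.mul_sum, ← Finset.sum_sub_distrib]
    refine Finset.sum_congr rfl fun j _ => ?_
    rw [zero_add, eK]; ring
  have e1 : ∑ j ∈ range k, (1 - α⁻¹ ^ (j+1)) * α ^ j = α ^ k - k * α⁻¹ := by
    have : ∀ j ∈ range k, (1 - α⁻¹ ^ (j+1)) * α ^ j = α ^ j - α⁻¹ := by
      intro j _
      rw [sub_mul, one_mul, pow_succ, mul_right_comm, ← mul_pow, inv_mul_cancel₀ h0, one_pow, one_mul]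
    rw [Finset.sum_congr rfl this, Finset.sum_sub_distrib, ← h.sum_pow]
    simp
  obtain ⟨m, rfl⟩ : ∃ m, k = m + 2 := ⟨k - 2, by omega⟩
  have e2 : ∑ j ∈ range (m+2), (1 - α⁻¹ ^ (j+1)) * (gL (m+2) j : ℝ) = (1 - α⁻¹ ^ (m+1)) * 2 + (1 - α⁻¹ ^ (m+2)) := by
    rw [Finset.sum_range_succ, Finset.sum_range_succ, Finset.sum_eq_zero]
    · have a1 : gL (m+2) m = 2 := by unfold gL; rw [if_neg (by omega), Nat.sub_self]; simp [lucasK]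
      have a2 : gL (m+2) (m+1) = 1 := by
        unfold gL; rw [if_neg (by omega), show m + 1 + 2 - (m+2) = 1 by omega]; simp [lucasK]
      rw [a1, a2]; push_cast; ring
    · intro j hj
      rw [Finset.mem_range] at hj
      have : gL (m+2) j = 0 := by unfold gL; rw [if_pos (by omega)]
      rw [this]; simp
  rw [e0, e1, e2, Nat.add_sub_cancel]
  have e3 : α⁻¹ ^ (m+1) = α * (2 - α) := by
    rw [h2, pow_succ α⁻¹ (m+1), mul_left_comm, mul_inv_cancel₀ h0, mul_one]
  rw [e3, ← h2]
  have e4 : α ^ (m+2) = α ^ m * α ^ 2 := pow_add _ _ _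
  have e5 : fK (m+2) α / α ^ m * (α ^ (m+2) - ((m+2 : ℕ):ℝ) * α⁻¹) = fK (m+2) α * (α * ((((m+2:ℕ):ℝ) + 1) * α - 2 * ((m+2:ℕ):ℝ))) := by
    have e6 : (α ^ m)⁻¹ = (2 - α) * α ^ 2 := by
      rw [h2, inv_pow, e4]; field_simp
    rw [div_eq_mul_inv, mul_assoc]
    congr 1
    rw [e4, mul_sub, ← mul_assoc, inv_mul_cancel₀ (by positivity), e6]
    field_simp
    ring
  rw [e5, fK, div_mul_cancel₀ _ (by positivity)]
  ring

lemma Root.eK_rec {k : ℕ} {α : ℝ} (h : Root k α) (i : ℕ) : eK k α (i + k) = ∑ j ∈ range k, eK k α (i + j) := by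
  unfold eK
  rw [Finset.sum_sub_distrib, gL_rec k h.hk]
  push_cast
  congr 1
  rw [pow_add, h.sum_pow, Finset.mul_sum, Finset.mul_sum, Finset.sum_div]
  refine Finset.sum_congr rfl fun j _ => ?_
  rw [pow_add]

lemma Root.eK_bd {k : ℕ} {α : ℝ} (h : Root k α) (i : ℕ) : |eK k α i| ≤ 2 := by
  have h1 := h.lo
  have h2 := h.hi
  have h0 : α ≠ 0 := by linarith
  have hz : ∀ i, Psi k α⁻¹ (eK k α) i = 0 := by
    intro i
    induction i with
    | zero => exact h.eK_Psi0
    | succ i ih => rw [Psi_mul k α⁻¹ _ α (mul_inv_cancel₀ h0) h.two_sub h.eK_rec, ih, mul_zero]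
  obtain ⟨hf1, hf2⟩ := h.f_bd
  have hk := h.hk
  induction i using Nat.strong_induction_on with
  | _ i ih =>
    rcases Nat.lt_or_ge i k with hi | hi
    · unfold eK
      rcases Nat.lt_or_ge (i + 2) k with h3 | h3
      · have : gL k i = 0 := by unfold gL; rw [if_pos h3]
        rw [this, Nat.cast_zero, zero_sub, abs_neg, abs_of_nonneg (by positivity), div_le_iff₀ (by positivity)]
        have : α ^ i ≤ α ^ (k - 2) := pow_le_pow_right₀ (by linarith) (by omega)
        gcongr
        linarith
      · rcases Nat.lt_or_ge (i + 1) k with h4 | h4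
        · obtain rfl : i = k - 2 := by omega
          have : gL k (k - 2) = 2 := by
            unfold gL; rw [if_neg (by omega), show k - 2 + 2 - k = 0 by omega]; simp [lucasK]
          rw [this, mul_div_assoc, div_self (by positivity), abs_le]
          push_cast; constructor <;> linarith
        · obtain rfl : i = k - 2 + 1 := by omega
          have : gL k (k - 2 + 1) = 1 := by
            unfold gL; rw [if_neg (by omega), show k - 2 + 1 + 2 - k = 1 by omega]; simp [lucasK]
          rw [this, pow_succ, mul_div_assoc, mul_div_right_comm, div_self (by positivity), one_mul, abs_le]
          push_cast; constructor <;> nlinarith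
    · obtain ⟨q, rfl⟩ : ∃ q, i = q + k := ⟨i - k, by omega⟩
      rw [conv_of_Psi k α⁻¹ _ α (mul_inv_cancel₀ h0) h.two_sub (by linarith) hz]
      refine (Finset.abs_sum_le_sum_abs _ _).trans ?_
      have : ∀ j ∈ range k, |α⁻¹ ^ (j + 1) * eK k α (q + j)| ≤ α⁻¹ ^ (j + 1) * 2 := by
        intro j hj
        rw [Finset.mem_range] at hj
        rw [abs_mul, abs_of_nonneg (by positivity)]
        exact mul_le_mul_of_nonneg_left (ih _ (by omega)) (by positivity)
      refine (Finset.sum_le_sum this).trans ?_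
      rw [← Finset.sum_mul, h.sum_inv, one_mul]

theorem Root.L_bd {k : ℕ} {α : ℝ} (h : Root k α) (n : ℕ) : |(lucasK k n : ℝ) - fK k α * α ^ n| ≤ 2 := by
  have := h.eK_bd (n + k - 2)
  rw [eK, gL_eq k n h.hk] at this
  have hk := h.hk
  have h1 := h.lo
  rwa [show n + k - 2 = n + (k - 2) by omega, pow_add, mul_div_assoc, mul_div_assoc, div_self (by positivity), mul_one] at this

end TL

end

section
namespace TL
open Finset

lemma abs_log_le {δ : ℝ} (h : |δ| ≤ 1/2) : |Real.log (1 + δ)| ≤ 2 * |δ| := by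
  rw [abs_le] at h
  have h1 : Real.log (1 + δ) ≤ δ := by
    have := Real.log_le_sub_one_of_pos (show 0 < 1 + δ by linarith); linarith
  have h2 : 1 - (1 + δ)⁻¹ ≤ Real.log (1 + δ) := Real.one_sub_inv_le_log_of_pos (by linarith)
  have h3 : 1 - (1 + δ)⁻¹ = δ / (1 + δ) := by
    have : 1 + δ ≠ 0 := by linarith
    field_simp; ring
  rw [h3] at h2
  have h4 : -(2 * |δ|) ≤ δ / (1 + δ) := by
    rw [le_div_iff₀ (by linarith)]
    rcases abs_cases δ with ⟨h5, _⟩ | ⟨h5, _⟩ <;> rw [h5] <;> nlinarith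
  rw [abs_le]
  refine ⟨by linarith, ?_⟩
  have := le_abs_self δ
  have := abs_nonneg δ
  linarith

lemma pow16_big {α : ℝ} (h : 1.6 < α) {i : ℕ} (hi : 301 ≤ i) : (1000:ℝ) ≤ α ^ i := by
  calc (1000:ℝ) ≤ 1.6 ^ 20 := by norm_num
    _ ≤ 1.6 ^ i := pow_le_pow_right₀ (by norm_num) (by omega)
    _ ≤ α ^ i := pow_le_pow_left₀ (by norm_num) h.le i

lemma Root.f_pos {k : ℕ} {α : ℝ} (h : Root k α) : 0 < fK k α := by have := h.f_bd; linarith [this.1]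

lemma Root.log_L {k : ℕ} {α : ℝ} (h : Root k α) {i : ℕ} (hi : 301 ≤ i) :
    |Real.log (lucasK k i) - (Real.log (fK k α) + i * Real.log α)| ≤ 12 * (α ^ i)⁻¹ := by
  have hp := pow16_big h.lo hi
  have hf := h.f_bd
  have hf0 := h.f_pos
  have hL := h.L_bd i
  have h1 := h.lo
  set F := fK k α * α ^ i with hF
  have hFp : 0 < F := by positivity
  have hF3 : α ^ i / 3 ≤ F := by rw [hF]; nlinarith
  set δ := ((lucasK k i : ℝ) - F) / F with hδ
  have e1 : (lucasK k i : ℝ) = F * (1 + δ) := by rw [hδ]; field_simp; ring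
  have hδ2 : |δ| ≤ 6 * (α ^ i)⁻¹ := by
    rw [hδ, abs_div, abs_of_pos hFp, div_le_iff₀ hFp]
    refine hL.trans ?_
    calc (2:ℝ) = 6 * (α ^ i)⁻¹ * (α ^ i / 3) := by field_simp; norm_num
      _ ≤ _ := by gcongr
  have hδ3 : |δ| ≤ 1/2 := hδ2.trans (by
    rw [← div_eq_mul_inv, div_le_iff₀ (by positivity)]; linarith)
  have hδ4 := abs_le.1 hδ3
  rw [e1, Real.log_mul hFp.ne' (by linarith), hF, Real.log_mul hf0.ne' (by positivity), Real.log_pow, add_sub_cancel_left]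
  refine (abs_log_le hδ3).trans (by linarith)

/-- The data of a solution with large smallest index. -/
structure Sol (k n m l d a : ℕ) : Prop where
  hk : 2 ≤ k
  hk' : k ≤ 650
  hnm : m ≤ n
  hml : l ≤ m
  hl : 301 ≤ l
  hd : 2 ≤ d
  ha1 : 1 ≤ a
  ha9 : a ≤ 9
  heq : 9 * (lucasK k n * lucasK k m * lucasK k l) + a = a * 10 ^ d

variable {k n m l d a : ℕ} {α : ℝ}

lemma Sol.d_le (s : Sol k n m l d a) : d ≤ n := by
  have h1 := s.heq
  have h2 : lucasK k n * lucasK k m * lucasK k l ≤ 2 ^ (n+1) * 2 ^ (n+1) * 2 ^ (n+1) := by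
    have b := lucasK_le k m
    have c := lucasK_le k l
    have e : 2 ^ (m+1) ≤ 2 ^ (n+1) := Nat.pow_le_pow_right (by norm_num) (by have := s.hnm; omega)
    have e' : 2 ^ (l+1) ≤ 2 ^ (n+1) := Nat.pow_le_pow_right (by norm_num) (by have := s.hnm; have := s.hml; omega)
    exact Nat.mul_le_mul (Nat.mul_le_mul (lucasK_le k n) (b.trans e)) (c.trans e')
  have h3 : (2:ℕ) ^ (n+1) * 2 ^ (n+1) * 2 ^ (n+1) = 8 * 8 ^ n := by
    rw [show (8:ℕ) = 2 ^ 3 by norm_num, ← pow_mul, ← pow_add, ← pow_add, ← pow_add]; congr 1; omega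
  have h4 : 73 * 8 ^ n ≤ 10 ^ n := by
    have hn : 100 ≤ n := by have := s.hnm; have := s.hml; have := s.hl; omega
    obtain ⟨j, rfl⟩ := Nat.exists_eq_add_of_le hn
    rw [pow_add, pow_add, ← mul_assoc]
    exact Nat.mul_le_mul (by norm_num) (Nat.pow_le_pow_left (by norm_num) j)
  have h5 : 10 ^ d ≤ 10 ^ n := by
    have h6 : 1 ≤ 8 ^ n := Nat.one_le_pow _ _ (by norm_num)
    have ha := s.ha1
    have ha9 := s.ha9
    have : 10 ^ d ≤ a * 10 ^ d := Nat.le_mul_of_pos_left _ (by omega)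
    have : a * 10 ^ d ≤ 72 * 8 ^ n + a := by omega
    rcases Nat.eq_or_lt_of_le ha with h7 | h7
    · subst h7; omega
    · have : 2 * 10 ^ d ≤ a * 10 ^ d := Nat.mul_le_mul_right _ h7
      have : 100 ≤ 8 ^ n := by
        calc 100 ≤ 8 ^ 3 := by norm_num
          _ ≤ 8 ^ n := Nat.pow_le_pow_right (by norm_num) (by have := s.hnm; have := s.hml; have := s.hl; omega)
      omega
  exact (Nat.pow_le_pow_iff_right (by norm_num)).1 h5

lemma Sol.log_eq (s : Sol k n m l d a) (h : Root k α) :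
    |Real.log (lucasK k n) + Real.log (lucasK k m) + Real.log (lucasK k l)
      - (Real.log a - Real.log 9 + d * Real.log 10)| ≤ 8 * (α ^ n)⁻¹ := by
  have hn : 301 ≤ n := by have := s.hnm; have := s.hml; have := s.hl; omega
  have p := pow16_big h.lo hn
  have h1 := h.lo
  have a0 : (0:ℝ) < a := by exact_mod_cast s.ha1
  have b1 : (1:ℝ) ≤ lucasK k n := by exact_mod_cast lucasK_pos k n s.hk
  have b2 : (1:ℝ) ≤ lucasK k m := by exact_mod_cast lucasK_pos k m s.hk
  have b3 : (1:ℝ) ≤ lucasK k l := by exact_mod_cast lucasK_pos k l s.hk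
  have he : (9:ℝ) * (lucasK k n * lucasK k m * lucasK k l) + a = a * 10 ^ d := by exact_mod_cast s.heq
  set ε : ℝ := ((10:ℝ) ^ d)⁻¹ with hε
  have hε0 : 0 < ε := by positivity
  have hε1 : ε ≤ 4 * (α ^ n)⁻¹ := by
    have hL := (abs_le.1 (h.L_bd n)).1
    have hf := h.f_bd.1
    have c1 : α ^ n / 4 ≤ lucasK k n := by nlinarith
    have c2 : (lucasK k n : ℝ) ≤ 10 ^ d := by
      have : (lucasK k n : ℝ) ≤ lucasK k n * lucasK k m * lucasK k l := by
        rw [mul_assoc]; exact le_mul_of_one_le_right (by linarith) (one_le_mul_of_one_le_of_one_le b2 b3)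
      have ha9 : (a:ℝ) ≤ 9 := by exact_mod_cast s.ha9
      have : (a:ℝ) * 10 ^ d ≤ 9 * 10 ^ d := by gcongr
      linarith
    rw [hε, inv_le_iff_one_le_mul₀ (by positivity)]
    calc (1:ℝ) = 4 * (α ^ n)⁻¹ * (α ^ n / 4) := by field_simp
      _ ≤ _ := by gcongr; linarith
  have hε2 : ε ≤ 1/2 := hε1.trans (by rw [← div_eq_mul_inv, div_le_iff₀ (by positivity)]; linarith)
  have key : (lucasK k n : ℝ) * lucasK k m * lucasK k l = a / 9 * (10 ^ d * (1 + -ε)) := by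
    have : (10:ℝ) ^ d * (1 + -ε) = 10 ^ d - 1 := by rw [hε]; field_simp; ring
    rw [this]; linarith
  have e : Real.log (lucasK k n) + Real.log (lucasK k m) + Real.log (lucasK k l)
      - (Real.log a - Real.log 9 + d * Real.log 10) = Real.log (1 + -ε) := by
    rw [← Real.log_mul (by linarith) (by linarith), ← Real.log_mul (by nlinarith) (by linarith), key,
      Real.log_mul (by positivity) (by have : 0 < 1 + -ε := by linarith
                                       positivity), Real.log_div a0.ne' (by norm_num),
      Real.log_mul (by positivity) (by linarith), Real.log_pow]
    ring
  rw [e]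
  have := abs_log_le (δ := -ε) (by rw [abs_neg, abs_of_pos hε0]; exact hε2)
  rw [abs_neg, abs_of_pos hε0] at this
  linarith

lemma inv_pow_anti {α : ℝ} (h : 1.6 < α) {i j : ℕ} (hij : i ≤ j) : (α ^ j)⁻¹ ≤ (α ^ i)⁻¹ := by
  have : α ^ i ≤ α ^ j := pow_le_pow_right₀ (by linarith) hij
  have : 0 < α ^ i := by positivity
  gcongr

lemma Sol.lam1 (s : Sol k n m l d a) (h : Root k α) :
    |((n + m + l : ℕ) : ℝ) * Real.log α - d * Real.log 10 + (3 * Real.log (fK k α) + Real.log 9 - Real.log a)| ≤ 50 * (α ^ l)⁻¹ := by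
  have h0 := s.log_eq h
  have hl := s.hl
  have hml := s.hml
  have hnm := s.hnm
  have h1 := h.log_L (i := n) (by omega)
  have h2 := h.log_L (i := m) (by omega)
  have h3 := h.log_L (i := l) (by omega)
  have q1 := inv_pow_anti h.lo hml
  have q2 := inv_pow_anti h.lo hnm
  have q3 : 0 < (α ^ n)⁻¹ := by have := h.lo; positivity
  push_cast
  rw [abs_le] at *
  constructor <;> linarith [h0.1, h0.2, h1.1, h1.2, h2.1, h2.2, h3.1, h3.2]

lemma Sol.lam2 (s : Sol k n m l d a) (h : Root k α) :
    |((n + m : ℕ) : ℝ) * Real.log α - d * Real.log 10 + (2 * Real.log (fK k α) + Real.log 9 - Real.log a + Real.log (lucasK k l))| ≤ 50 * (α ^ m)⁻¹ := by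
  have h0 := s.log_eq h
  have hl := s.hl
  have hml := s.hml
  have hnm := s.hnm
  have h1 := h.log_L (i := n) (by omega)
  have h2 := h.log_L (i := m) (by omega)
  have q2 := inv_pow_anti h.lo hnm
  have q3 : 0 < (α ^ n)⁻¹ := by have := h.lo; positivity
  push_cast
  rw [abs_le] at *
  constructor <;> linarith [h0.1, h0.2, h1.1, h1.2, h2.1, h2.2]

lemma Sol.lam3 (s : Sol k n m l d a) (h : Root k α) :
    |(n : ℝ) * Real.log α - d * Real.log 10 + (Real.log (fK k α) + Real.log 9 - Real.log a + (Real.log (lucasK k l) + Real.log (lucasK k m)))| ≤ 50 * (α ^ n)⁻¹ := by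
  have h0 := s.log_eq h
  have hl := s.hl
  have hml := s.hml
  have hnm := s.hnm
  have h1 := h.log_L (i := n) (by omega)
  have q3 : 0 < (α ^ n)⁻¹ := by have := h.lo; positivity
  rw [abs_le] at *
  constructor <;> linarith [h0.1, h0.2, h1.1, h1.2]

/-- `16` does not divide `L_l`. -/
lemma Sol.mod16 (s : Sol k n m l d a) : lucasK k l % 16 ≠ 0 := by
  intro h
  have h1 : 16 ∣ lucasK k l := Nat.dvd_of_mod_eq_zero h
  have h2 : 16 ∣ lucasK k n * lucasK k m * lucasK k l := Dvd.dvd.mul_left h1 _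
  have h3 := s.heq
  obtain ⟨w, hw⟩ := h2
  rw [hw] at h3
  have hd := s.hd
  obtain ⟨e, rfl⟩ : ∃ e, d = e + 2 := ⟨d - 2, by omega⟩
  rw [pow_add] at h3
  have ha1 := s.ha1
  have ha9 := s.ha9
  rcases Nat.lt_or_ge e 2 with he | he
  · interval_cases e <;> interval_cases a <;> omega
  · obtain ⟨g, rfl⟩ : ∃ g, e = g + 2 := ⟨e - 2, by omega⟩
    rw [pow_add] at h3
    have h4 : a * (10 ^ g * 10 ^ 2 * 10 ^ 2) = 16 * (625 * (a * 10 ^ g)) := by ring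
    rw [h4] at h3
    interval_cases a <;> omega

lemma Sol.k_lt (s : Sol k n m l d a) : k < l := by
  by_contra hc
  have hl := s.hl
  obtain ⟨e, rfl⟩ : ∃ e, l = e + 4 + 2 := ⟨l - 6, by omega⟩
  have := lucasK_small k s.hk (e + 4) (by omega)
  apply s.mod16
  rw [this, pow_add]
  omega

end TL

end

section
namespace TL
open Finset

lemma norm_root_le (k : ℕ) (z : ℂ) (hz : z ^ k = ∑ i ∈ range k, z ^ i) : ‖z‖ ≤ 2 := by
  by_contra hc
  push Not at hc
  have h1 : ‖z‖ ^ k ≤ ∑ i ∈ range k, ‖z‖ ^ i := by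
    rw [← norm_pow, hz]
    refine (norm_sum_le _ _).trans (le_of_eq ?_)
    simp [norm_pow]
  have h2 : (∑ i ∈ range k, ‖z‖ ^ i) * (‖z‖ - 1) = ‖z‖ ^ k - 1 := geom_sum_mul _ _
  have h3 : 0 ≤ ∑ i ∈ range k, ‖z‖ ^ i := Finset.sum_nonneg fun i _ => by positivity
  nlinarith

open Polynomial in
lemma pol_monic (k : ℕ) : (X ^ k - ∑ i ∈ range k, X ^ i : ℤ[X]).Monic ∧ (X ^ k - ∑ i ∈ range k, X ^ i : ℤ[X]).natDegree = k := by
  have h1 : (∑ i ∈ range k, X ^ i : ℤ[X]).degree < k := by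
    refine (Polynomial.degree_sum_le _ _).trans_lt ((Finset.sup_lt_iff (WithBot.bot_lt_coe k)).2 ?_)
    intro i hi
    rw [Finset.mem_range] at hi
    rw [degree_X_pow]
    exact WithBot.coe_lt_coe.2 hi
  have h2 : (X ^ k - ∑ i ∈ range k, X ^ i : ℤ[X]).Monic := monic_X_pow_sub_of_degree_lt h1
  refine ⟨h2, natDegree_eq_of_degree_eq_some ?_⟩
  rw [degree_sub_eq_left_of_degree_lt, degree_X_pow]
  rwa [degree_X_pow]
where
  monic_X_pow_sub_of_degree_lt {k : ℕ} {p : ℤ[X]} (h : p.degree < k) : (X ^ k - p).Monic :=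
    (monic_X_pow k).sub_of_left (by rwa [degree_X_pow])

lemma exists_field {k : ℕ} {α : ℝ} (h : Root k α) : ∃ (K : Type) (_ : Field K) (_ : NumberField K) (φ₀ : K →+* ℂ) (θ : K),
    Module.finrank ℚ K ≤ k ∧ φ₀ θ = α ∧ IsIntegral ℤ θ ∧ ∀ φ : K →+* ℂ, ‖φ θ‖ ≤ 2 := by
  obtain ⟨hm, hdeg⟩ := pol_monic k
  have hs : (α:ℂ) ^ k = ∑ i ∈ range k, (α:ℂ) ^ i := by
    have := h.sum_pow
    exact_mod_cast this
  have hae : Polynomial.aeval (α:ℂ) (Polynomial.X ^ k - ∑ i ∈ range k, Polynomial.X ^ i : Polynomial ℤ) = 0 := by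
    simp [hs]
  have hi : IsIntegral ℤ (α:ℂ) := ⟨_, hm, by rw [← Polynomial.aeval_def]; exact hae⟩
  have hiQ : IsIntegral ℚ (α:ℂ) := hi.tower_top
  have := IntermediateField.adjoin.finiteDimensional hiQ
  let θ : IntermediateField.adjoin ℚ {(α:ℂ)} := IntermediateField.AdjoinSimple.gen ℚ (α:ℂ)
  have hθ : algebraMap (IntermediateField.adjoin ℚ {(α:ℂ)}) ℂ θ = α := IntermediateField.AdjoinSimple.algebraMap_gen ℚ (α:ℂ)
  have hinj : Function.Injective (algebraMap (IntermediateField.adjoin ℚ {(α:ℂ)}) ℂ) :=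
    fun a b hab => Subtype.ext hab
  have : NumberField (IntermediateField.adjoin ℚ {(α:ℂ)}) := ⟨⟩
  refine ⟨IntermediateField.adjoin ℚ {(α:ℂ)}, inferInstance, inferInstance, algebraMap _ ℂ, θ, ?_, hθ, ?_, ?_⟩
  · rw [IntermediateField.adjoin.finrank hiQ]
    have h1 := minpoly.min ℚ (α:ℂ) (hm.map (Int.castRingHom ℚ)) (by
      rw [← hae]; simp [Polynomial.map_sum])
    have h2 := Polynomial.natDegree_le_natDegree h1
    rw [hm.natDegree_map, hdeg] at h2
    exact h2
  · rw [← isIntegral_algebraMap_iff hinj, hθ]; exact hi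
  · intro φ
    apply norm_root_le k
    have : θ ^ k = ∑ i ∈ range k, θ ^ i := by
      apply hinj
      rw [map_pow, map_sum, hθ, hs]
      simp only [map_pow, hθ]
    rw [← map_pow, this, map_sum]
    simp only [map_pow]

lemma lam_ne {k : ℕ} {α : ℝ} (h : Root k α) (x y : ℕ) (hx : 1 ≤ x) : (x:ℝ) * Real.log α - y * Real.log 10 ≠ 0 := by
  intro h0
  have h1 := h.lo
  have e1 : α ^ x = 10 ^ y := by
    apply Real.log_injOn_pos (Set.mem_Ioi.2 (by positivity)) (Set.mem_Ioi.2 (by positivity))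
    rw [Real.log_pow, Real.log_pow]; linarith
  rcases Nat.eq_zero_or_pos y with hy | hy
  · subst hy
    have : 1 < α ^ x := one_lt_pow₀ (by linarith) (by omega)
    rw [e1] at this; simp at this
  · -- the inverse of the root is integral
    obtain ⟨hm, hdeg⟩ := pol_monic k
    have hs := h.sum_pow
    have hi : IsIntegral ℤ α := ⟨_, hm, by
      rw [← Polynomial.aeval_def]; simp [hs]⟩
    obtain ⟨j, rfl⟩ : ∃ j, k = j + 1 := ⟨k - 1, by have := h.hk; omega⟩
    have hb : α * (α ^ j - ∑ i ∈ range j, α ^ i) = 1 := by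
      rw [Finset.sum_range_succ'] at hs
      rw [mul_sub, Finset.mul_sum]
      have : ∑ i ∈ range j, α ^ (i+1) = ∑ i ∈ range j, α * α ^ i := Finset.sum_congr rfl fun i _ => by ring
      rw [this] at hs
      rw [← pow_succ', hs]; simp
    have hbi : IsIntegral ℤ (α ^ j - ∑ i ∈ range j, α ^ i) :=
      (hi.pow j).sub (IsIntegral.sum _ fun i _ => hi.pow i)
    have e2 : (α ^ j - ∑ i ∈ range j, α ^ i) ^ x = algebraMap ℚ ℝ (((10:ℚ) ^ y)⁻¹) := by
      have e3 : α ^ x * (α ^ j - ∑ i ∈ range j, α ^ i) ^ x = 1 := by rw [← mul_pow, hb, one_pow]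
      rw [e1] at e3
      have := eq_inv_of_mul_eq_one_right e3
      rw [this]; simp
    have hc := hbi.pow x
    rw [e2, isIntegral_algebraMap_iff (algebraMap ℚ ℝ).injective, IsIntegrallyClosed.isIntegral_iff] at hc
    obtain ⟨w, hw⟩ := hc
    simp only [eq_intCast] at hw
    have e4 : (w:ℚ) * 10 ^ y = 1 := by rw [hw]; field_simp
    have e5 : w * 10 ^ y = 1 := by exact_mod_cast e4
    have e6 : (10:ℤ) ∣ 1 := by
      rw [← e5]; exact Dvd.dvd.mul_left (dvd_pow_self _ (by omega)) _
    norm_num at e6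

end TL

end

section
namespace TL
open Finset

lemma dirich (N d X : ℕ) (hX : 1 ≤ X) (hN : 1 ≤ N) (hd : d ≤ N) : ∃ x y u e ep em : ℕ, 1 ≤ x ∧ x ≤ X ∧ y ≤ x ∧
    N = u * x + e ∧ e ≤ x ∧ d + em = u * y + ep ∧ x * (ep + em) * X ≤ N + x * x * X := by
  obtain ⟨j, q, hq0, hqX, hq⟩ := Real.exists_int_int_abs_mul_sub_le ((d:ℝ)/N) (n := X) (by omega)
  have N0 : (0:ℝ) < N := by exact_mod_cast hN
  have X0 : (1:ℝ) ≤ X := by exact_mod_cast hX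
  have h1 : |(q:ℝ) * d - j * N| * X ≤ N := by
    have e : (q:ℝ) * d - j * N = (q * (d / N) - j) * N := by field_simp
    rw [e, abs_mul, abs_of_pos N0]
    have : |(q:ℝ) * (d / N) - j| * X ≤ 1 := by
      have h2 : 1 / ((X:ℝ)+1) * X ≤ 1 := by rw [div_mul_eq_mul_div, div_le_one (by linarith)]; linarith
      exact (mul_le_mul_of_nonneg_right hq (by linarith)).trans h2
    nlinarith
  have h2 : |(q:ℤ) * d - j * N| * X ≤ N := by exact_mod_cast h1
  have hlt : |(q:ℝ) * (d / N) - j| < 1 := hq.trans_lt (by rw [div_lt_one (by linarith)]; linarith)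
  have hdn0 : 0 ≤ (d:ℝ)/N := by positivity
  have hdn1 : (d:ℝ)/N ≤ 1 := by rw [div_le_one N0]; exact_mod_cast hd
  have q0 : (0:ℝ) < q := by exact_mod_cast hq0
  rw [abs_lt] at hlt
  have hj0 : 0 ≤ j := by
    by_contra hc
    have : (j:ℝ) ≤ -1 := by exact_mod_cast (by omega : j ≤ -1)
    have : 0 ≤ (q:ℝ) * (d/N) := by positivity
    linarith [hlt.2]
  have hjq : j ≤ q := by
    by_contra hc
    have : (q:ℝ) + 1 ≤ j := by exact_mod_cast (by omega : q + 1 ≤ j)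
    have : (q:ℝ) * (d/N) ≤ q := by nlinarith
    linarith [hlt.1]
  lift q to ℕ using hq0.le
  lift j to ℕ using hj0
  have hq1 : 1 ≤ q := by exact_mod_cast hq0
  have hjq' : j ≤ q := by exact_mod_cast hjq
  obtain ⟨w, hw⟩ : ∃ w : ℤ, w = (d:ℤ) - (N / q : ℕ) * j := ⟨_, rfl⟩
  have hNdiv : (N:ℤ) = (N / q : ℕ) * q + (N % q : ℕ) := by
    have := Nat.div_add_mod N q
    have : q * (N / q) + N % q = N := this
    exact_mod_cast (by rw [mul_comm]; exact this.symm)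
  have hr : N % q < q := Nat.mod_lt _ hq1
  refine ⟨q, j, N / q, N % q, w.toNat, (-w).toNat, hq1, by exact_mod_cast hqX, hjq', by exact_mod_cast hNdiv, hr.le, ?_, ?_⟩
  · have : ((d + (-w).toNat : ℕ) : ℤ) = ((N / q * j + w.toNat : ℕ):ℤ) := by
      push_cast
      have := Int.toNat_sub_toNat_neg w
      push_cast at hw
      linarith
    exact_mod_cast this
  · have e : ((w.toNat + (-w).toNat : ℕ) : ℤ) = |w| := by
      rcases le_total 0 w with h | h
      · rw [abs_of_nonneg h]; omega
      · rw [abs_of_nonpos h]; omega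
    have : (((q * (w.toNat + (-w).toNat) * X : ℕ)) : ℤ) ≤ ((N + q * q * X : ℕ) : ℤ) := by
      rw [Nat.cast_mul, Nat.cast_mul, e]
      have e2 : (q:ℤ) * w = ((q:ℤ) * d - j * N) + (N % q : ℕ) * j := by
        rw [hw]; linear_combination (j:ℤ) * hNdiv
      have e3 : (q:ℤ) * |w| ≤ |(q:ℤ) * d - j * N| + q * q := by
        rw [← abs_of_nonneg (Int.natCast_nonneg q), ← abs_mul, abs_of_nonneg (Int.natCast_nonneg q), e2]
        refine (abs_add_le _ _).trans ?_
        have : |((N % q : ℕ):ℤ) * j| ≤ q * q := by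
          rw [abs_of_nonneg (by positivity)]
          exact_mod_cast Nat.mul_le_mul hr.le hjq'
        linarith
      have X0' : (0:ℤ) ≤ X := by positivity
      push_cast at *
      nlinarith
    exact_mod_cast this

/-- Parameter bookkeeping. -/
lemma par_u (D' D τ X g N x u e w : ℕ) (hD' : 222 ≤ D') (hD : 1 ≤ D) (hτ : 1 ≤ τ) (hX : 30 * D' * D * τ ≤ X)
    (hN : 12 * D' * D * τ * X * (28 + g + 4 * X) ≤ N) (hx : 1 ≤ x) (hxX : x ≤ X) (he : N = u * x + e) (hex : e ≤ x)
    (hw : x * w * X ≤ N + x * x * X) :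
    5 * D' * (D * τ) * (28 + g + x + 3 * w) + D * τ ≤ u := by
  by_contra hc
  push Not at hc
  obtain ⟨q, hq⟩ : ∃ q, q = D' * D * τ := ⟨_, rfl⟩
  have hq1 : 222 ≤ q := by
    rw [hq]; calc 222 ≤ D' := hD'
      _ ≤ D' * D * τ := by nlinarith [Nat.mul_le_mul hD hτ, Nat.mul_le_mul (le_refl D') (Nat.mul_le_mul hD hτ)]
  have hq2 : D * τ + 1 ≤ 5 * q := by
    have : 1 ≤ D * τ := Nat.mul_pos hD hτ
    have : D * τ ≤ q := by rw [hq, mul_assoc]; exact Nat.le_mul_of_pos_left _ (by omega)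
    omega
  have hX' : 30 * q ≤ X := by rw [hq]; linarith
  have hN' : 12 * q * X * (28 + g + 4 * X) ≤ N := by rw [hq]; linarith
  have e1 : 5 * D' * (D * τ) = 5 * q := by rw [hq]; ring
  rw [e1] at hc
  have h1 : N ≤ (5 * q * (28 + g + x + 3 * w) + 5 * q) * x := by
    have : u + 1 ≤ 5 * q * (28 + g + x + 3 * w) + D * τ := hc
    have h2 : u + 1 ≤ 5 * q * (28 + g + x + 3 * w) + 5 * q - 1 + 0 := by omega
    have : u + 1 ≤ 5 * q * (28 + g + x + 3 * w) + 5 * q := by omega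
    calc N ≤ (u + 1) * x := by rw [he]; nlinarith
      _ ≤ _ := Nat.mul_le_mul_right _ this
  have h2 : N * X ≤ 5 * q * ((29 + g + x) * (x * X)) + 15 * q * (N + x * x * X) := by
    calc N * X ≤ ((5 * q * (28 + g + x + 3 * w) + 5 * q) * x) * X := Nat.mul_le_mul_right _ h1
      _ = 5 * q * ((29 + g + x) * (x * X)) + 15 * q * (x * w * X) := by ring
      _ ≤ _ := by gcongr
  have h3 : (29 + g + x) * (x * X) ≤ (29 + g + X) * (X * X) := by gcongr
  have h4 : x * x * X ≤ X * X * X := by gcongr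
  have h5 : N * X ≤ 5 * q * ((29 + g + 4 * X) * (X * X)) + 15 * q * N := by
    calc N * X ≤ 5 * q * ((29 + g + x) * (x * X)) + 15 * q * (N + x * x * X) := h2
      _ ≤ 5 * q * ((29 + g + X) * (X * X)) + 15 * q * (N + X * X * X) := by gcongr
      _ = _ := by ring
  have h6 : 30 * q * N ≤ N * X := by rw [mul_comm N X]; exact Nat.mul_le_mul_right _ hX'
  have h7 : N * X ≤ 10 * q * ((29 + g + 4 * X) * (X * X)) := by linarith
  have h8 : (12 * q * X * (28 + g + 4 * X)) * X ≤ 10 * q * ((29 + g + 4 * X) * (X * X)) := (Nat.mul_le_mul_right _ hN').trans h7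
  have h9 : 10 * q * ((29 + g + 4 * X) * (X * X)) < (12 * q * X * (28 + g + 4 * X)) * X := by
    have : 10 * (29 + g + 4 * X) < 12 * (28 + g + 4 * X) := by omega
    have hp : 0 < q * (X * X) := by
      have : 0 < X := by omega
      positivity
    have := Nat.mul_lt_mul_of_pos_right this hp
    linarith
  omega

lemma par_t (D' D τ X g N x u w : ℕ) (hD' : 222 ≤ D') (hD : 1 ≤ D) (hτ : 1 ≤ τ) (hX : 30 * D' * D * τ ≤ X)
    (hN : 12 * D' * D * τ * X * (28 + g + 4 * X) ≤ N) (hx : 1 ≤ x) (he : u * x ≤ N) 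
    (hu : 5 * D' * (D * τ) * w + D * τ ≤ u) :
    111 * (5 * D' * (D * τ) * w + D * τ + u * (5 * D' * (D * τ) * (3 * x))) ≤ N * N := by
  obtain ⟨q, hq⟩ : ∃ q, q = D' * D * τ := ⟨_, rfl⟩
  have hq1 : 222 ≤ q := by
    rw [hq]; calc 222 ≤ D' := hD'
      _ ≤ D' * D * τ := by nlinarith [Nat.mul_le_mul hD hτ, Nat.mul_le_mul (le_refl D') (Nat.mul_le_mul hD hτ)]
  have hX' : 30 * q ≤ X := by rw [hq]; linarith
  have hN' : 12 * q * X * (28 + g + 4 * X) ≤ N := by rw [hq]; linarith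
  have e2 : u * (5 * D' * (D * τ) * (3 * x)) = 15 * q * (u * x) := by rw [hq]; ring
  rw [e2]
  have h1 : 15 * q * (u * x) ≤ 15 * q * N := Nat.mul_le_mul_left _ he
  have h2 : u ≤ N := (Nat.le_mul_of_pos_right _ hx).trans he
  have h3 : N ≤ q * N := Nat.le_mul_of_pos_left _ (by omega)
  have h4 : 111 * (16 * q) ≤ N := by
    refine le_trans ?_ hN'
    have : 148 ≤ X * (28 + g + 4 * X) := by nlinarith
    calc 111 * (16 * q) = 12 * q * 148 := by ring
      _ ≤ 12 * q * (X * (28 + g + 4 * X)) := Nat.mul_le_mul_left _ this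
      _ = _ := by ring
  calc _ ≤ 111 * (16 * q) * N := by linarith
    _ ≤ N * N := Nat.mul_le_mul_right _ h4

end TL

end

section
namespace TL
open Finset

lemma exp_two (n : ℕ) : (2:ℝ) ^ n ≤ Real.exp n := by
  have : (2:ℝ) ≤ Real.exp 1 := by have := Real.add_one_le_exp (1:ℝ); linarith
  calc (2:ℝ) ^ n ≤ Real.exp 1 ^ n := pow_le_pow_left₀ (by norm_num) this n
    _ = Real.exp n := by rw [← Real.exp_nat_mul]; simp

lemma exp_ten (n : ℕ) : (10:ℝ) ^ n ≤ Real.exp (3 * n) := by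
  have h1 : (10:ℝ) ≤ Real.exp 3 := by
    have h := Real.exp_one_gt_d9
    have : Real.exp 3 = Real.exp 1 ^ 3 := by rw [← Real.exp_nat_mul]; norm_num
    rw [this]
    calc (10:ℝ) ≤ 2.7 ^ 3 := by norm_num
      _ ≤ _ := pow_le_pow_left₀ (by norm_num) (by linarith) 3
  calc (10:ℝ) ^ n ≤ Real.exp 3 ^ n := pow_le_pow_left₀ (by norm_num) h1 n
    _ = Real.exp (3 * n) := by rw [← Real.exp_nat_mul]; congr 1; ring

lemma exp_28 : (9:ℝ) * 5204 ^ 3 ≤ Real.exp 28 := by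
  have h := Real.exp_one_gt_d9
  have : Real.exp 28 = Real.exp 1 ^ 28 := by rw [← Real.exp_nat_mul]; norm_num
  rw [this]
  calc (9:ℝ) * 5204 ^ 3 ≤ 2.71828 ^ 28 := by norm_num
    _ ≤ _ := pow_le_pow_left₀ (by norm_num) (by linarith) 28

lemma log10_lt : Real.log 10 ≤ 3 := by
  rw [Real.log_le_iff_le_exp (by norm_num)]
  have := exp_ten 1
  norm_num at this; exact this

lemma Root.log_bd {k : ℕ} {α : ℝ} (h : Root k α) : 0.47 ≤ Real.log α ∧ Real.log α ≤ 1 := by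
  have h1 := h.lo
  have h2 := h.hi
  constructor
  · have h3 : Real.log 1.6 ≤ Real.log α := Real.log_le_log (by norm_num) h1.le
    have h4 : (0.47:ℝ) ≤ Real.log 1.6 := by
      rw [Real.le_log_iff_exp_le (by norm_num)]
      have h := Real.exp_one_lt_d9
      have e : Real.exp 0.47 ^ 100 = Real.exp 1 ^ 47 := by
        rw [← Real.exp_nat_mul, ← Real.exp_nat_mul]; norm_num
      have : Real.exp 0.47 ^ 100 ≤ 1.6 ^ 100 := by
        rw [e]
        calc Real.exp 1 ^ 47 ≤ 2.7182818286 ^ 47 := pow_le_pow_left₀ (by positivity) h.le 47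
          _ ≤ _ := by norm_num
      exact le_of_pow_le_pow_left₀ (by norm_num) (by norm_num) this
    linarith
  · have := Real.log_le_sub_one_of_pos (show 0 < α by linarith); linarith

lemma Root.logf_bd {k : ℕ} {α : ℝ} (h : Root k α) : |Real.log (fK k α)| ≤ 2 := by
  have h1 := h.f_bd
  have h2 := h.f_pos
  rw [abs_le]
  constructor
  · have := Real.one_sub_inv_le_log_of_pos h2
    have h3 : (fK k α)⁻¹ ≤ 3 := by rw [inv_le_comm₀ h2 (by norm_num)]; linarith [h1.1]
    linarith
  · have := Real.log_le_sub_one_of_pos h2; linarith [h1.2]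

lemma log9_bd {a : ℕ} (h1 : 1 ≤ a) (h9 : a ≤ 9) : 0 ≤ Real.log a ∧ Real.log a ≤ 8 := by
  have : (1:ℝ) ≤ a := by exact_mod_cast h1
  have h' : (a:ℝ) ≤ 9 := by exact_mod_cast h9
  refine ⟨Real.log_nonneg this, ?_⟩
  have := Real.log_le_sub_one_of_pos (show (0:ℝ) < a by linarith); linarith

lemma mul_bd {x l c : ℝ} (hx : 0 ≤ x) (h0 : 0 ≤ l) (h1 : l ≤ c) : 0 ≤ x * l ∧ x * l ≤ x * c :=
  ⟨mul_nonneg hx h0, mul_le_mul_of_nonneg_left h1 hx⟩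

lemma app_k {k z : ℝ} (h0 : 0 ≤ k) (hk : k ≤ 650) (hz : z ≤ 2) : (k + 1) * z + 2 * k ≤ 2602 := by
  nlinarith

lemma app_fin (D X τ N x g ep em : ℕ) (hD : 1 ≤ D) (hX1 : 1 ≤ X) (hτ : 1 ≤ τ) (hx : 1 ≤ x) (hxX : x ≤ X)
    (hw : x * (ep + em) * X ≤ N + x * x * X) :
    (τ:ℝ) * (25 * ((D:ℝ)+222)^2 * ((D * τ : ℕ):ℝ)^2 * ((3 * x : ℕ):ℝ) * ((28 + g + x + 3 * (ep + em) : ℕ) : ℝ) + 4)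
     ≤ 26 * ((D:ℝ)+222)^2 * (D:ℝ)^2 * (τ:ℝ)^3 * (9 * ((N:ℝ) / X) + 12 * (X:ℝ)^2 + 3 * X * (28 + g)) := by
  have X1 : (1:ℝ) ≤ X := by exact_mod_cast hX1
  have xX : (x:ℝ) ≤ X := by exact_mod_cast hxX
  have hw' : (x:ℝ) * (ep + em) * X ≤ N + x * x * X := by exact_mod_cast hw
  have hw2 : (x:ℝ) * (ep + em) ≤ N / X + x * x := by
    rw [← sub_le_iff_le_add, le_div_iff₀ (by linarith)]; linarith
  have b1 : ((3 * x : ℕ):ℝ) * ((28 + g + x + 3 * (ep + em) : ℕ) : ℝ) ≤ 9 * (N / X) + 12 * X^2 + 3 * X * (28 + g) := by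
    push_cast
    have : (x:ℝ) * x ≤ X ^ 2 := by rw [← sq]; gcongr
    have : (x:ℝ) * (28 + g) ≤ X * (28 + g) := by gcongr
    linarith
  set w := ((3 * x : ℕ):ℝ) * ((28 + g + x + 3 * (ep + em) : ℕ) : ℝ) with hwdef
  have w1 : 1 ≤ w := by
    rw [hwdef]
    have : 1 ≤ (3 * x) * (28 + g + x + 3 * (ep + em)) := Nat.mul_pos (by omega) (by omega)
    exact_mod_cast this
  have τ1 : (1:ℝ) ≤ τ := by exact_mod_cast hτ
  have D1 : (1:ℝ) ≤ D := by exact_mod_cast hD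
  have e4 : (τ:ℝ) * (25 * (D+222)^2 * ((D * τ : ℕ):ℝ)^2 * ((3 * x : ℕ):ℝ) * ((28 + g + x + 3 * (ep + em) : ℕ) : ℝ) + 4)
     = τ * (25 * ((D+222)^2 * D^2 * τ^2 * w) + 4) := by rw [hwdef]; push_cast; ring
  rw [e4]
  have b2 : (4:ℝ) ≤ (D+222)^2 * D^2 * τ^2 * w := by
    calc (4:ℝ) ≤ 222^2 * 1^2 * 1^2 * 1 := by norm_num
      _ ≤ _ := by gcongr; linarith
  calc _ ≤ (τ:ℝ) * (26 * ((D+222)^2 * D^2 * τ^2 * w)) := by gcongr; linarith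
    _ = 26 * (D+222)^2 * D^2 * τ^3 * w := by ring
    _ ≤ _ := by gcongr

set_option maxHeartbeats 1000000 in
theorem app {k : ℕ} {α : ℝ} (h : Root k α) (hk : k ≤ 650) (D : ℕ) (hkD : k ≤ D) (r : ℕ) (hr : r ≤ 3)
    (G g : ℕ) (hG : 1 ≤ G) (hGg : (G:ℝ) ≤ Real.exp g) (a : ℕ) (ha1 : 1 ≤ a) (ha9 : a ≤ 9) (N d X τ : ℕ) (hτ : 1 ≤ τ)
    (hτN : (N:ℝ) * N ≤ Real.exp τ) (hX : 30 * (D + 222) * D * τ ≤ X)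
    (hN : 12 * (D+222) * D * τ * X * (28 + g + 4 * X) ≤ N) (hd : d ≤ N) :
    Real.exp (-(26 * (D+222)^2 * D^2 * τ^3 * (9 * (N / X) + 12 * X^2 + 3 * X * (28 + g)) : ℝ)) <
      |(N:ℝ) * Real.log α - d * Real.log 10 + (r * Real.log (fK k α) + Real.log 9 - Real.log a + Real.log G)| := by
  have hD : 1 ≤ D := by have := h.hk; omega
  have hX1 : 1 ≤ X := le_trans (by have : 0 < 30 * (D+222) * D * τ := by positivity
                                   omega) hX
  have hN1 : 1 ≤ N := le_trans (by
    have : 0 < 12 * (D+222) * D * τ * X * (28 + g + 4 * X) := by positivity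
    omega) hN
  obtain ⟨x, y, u, e, ep, em, hx, hxX, hyx, hNe, hex, hde, hw⟩ := dirich N d X hX1 hN1 hd
  obtain ⟨K, iK, nK, φ₀, θ, hfr, hθ, hint, hcon⟩ := exists_field h
  have h1 := h.lo
  have h2 := h.hi
  have hlog := h.log_bd
  have hlogf := h.logf_bd
  have hla := log9_bd ha1 ha9
  have hl9 := log9_bd (a := 9) (by norm_num) le_rfl
  have hl10 := log10_lt
  have hl10' : 0 ≤ Real.log 10 := Real.log_nonneg (by norm_num)
  have hlG : Real.log G ≤ g := (Real.log_le_iff_le_exp (by exact_mod_cast hG)).2 hGg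
  have hlG0 : 0 ≤ Real.log G := Real.log_nonneg (by exact_mod_cast hG)
  have hu := par_u (D+222) D τ X g N x u e (ep+em) (by omega) hD hτ hX hN hx hxX hNe hex hw
  have ht := par_t (D+222) D τ X g N x u (28 + g + x + 3 * (ep+em)) (by omega) hD hτ hX hN hx (by omega) hu
  have hdp := h.del_pos
  have la0 : 0 ≤ Real.log α := by linarith [hlog.1]
  have hnum : (0:ℝ) < (2 * α - 1) * (α - 1) := by apply mul_pos <;> linarith
  have hden : (0:ℝ) < α * ((k+1) * α - 2 * k) := by positivity
  have a0 : (0:ℝ) < a := by exact_mod_cast ha1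
  have G0 : (0:ℝ) < G := by exact_mod_cast hG
  have x1 : (1:ℝ) ≤ x := by exact_mod_cast hx
  have yx : (y:ℝ) ≤ x := by exact_mod_cast hyx
  have ex : (e:ℝ) ≤ x := by exact_mod_cast hex
  have e0 : (0:ℝ) ≤ e := by positivity
  have y0 : (0:ℝ) ≤ y := by positivity
  have g0 : (0:ℝ) ≤ g := by positivity
  have ep0 : (0:ℝ) ≤ ep := by positivity
  have em0 : (0:ℝ) ≤ em := by positivity
  have iN : ∀ n : ℕ, IsIntegral ℤ (n : K) := fun n => by
    have := isIntegral_algebraMap (R := ℤ) (A := K) (x := (n:ℤ)); simpa using this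
  -- the four algebraic integers
  obtain ⟨P2, hP2⟩ : ∃ P : K, P = ((9:ℕ):K) * ((((2:ℕ):K) * θ - ((1:ℕ):K)) * (θ - ((1:ℕ):K))) ^ r * (G:K) * θ ^ e * ((10:ℕ):K) ^ em := ⟨_, rfl⟩
  obtain ⟨Q2, hQ2⟩ : ∃ P : K, P = (a:K) * (θ * (((k+1:ℕ):K) * θ - ((2*k:ℕ):K))) ^ r * ((10:ℕ):K) ^ ep := ⟨_, rfl⟩
  have cP2 : φ₀ P2 = ((9 * ((2 * α - 1) * (α - 1)) ^ r * G * α ^ e * 10 ^ em : ℝ) : ℂ) := by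
    rw [hP2]; simp only [map_mul, map_pow, map_sub, map_natCast, hθ]; push_cast; ring
  have cQ2 : φ₀ Q2 = ((a * (α * ((k+1) * α - 2 * k)) ^ r * 10 ^ ep : ℝ) : ℂ) := by
    rw [hQ2]; simp only [map_mul, map_pow, map_sub, map_natCast, hθ]; push_cast; ring
  have cP1 : φ₀ (θ ^ x) = ((α ^ x : ℝ) : ℂ) := by simp [hθ]
  have cQ1 : φ₀ (((10:ℕ):K) ^ y) = ((10 ^ y : ℝ) : ℂ) := by rw [map_pow, map_natCast]; push_cast; ring
  have ne_of : ∀ (P : K) (z : ℝ), φ₀ P = (z:ℂ) → 0 < z → P ≠ 0 := by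
    rintro P z hz hz0 rfl
    rw [map_zero] at hz
    have : z = 0 := by exact_mod_cast hz.symm
    linarith
  have rel : ∀ z w : ℝ, 0 < z → 0 < w → ((z : ℝ) : ℂ) = Complex.exp ((Real.log z - Real.log w : ℝ)) * ((w : ℝ) : ℂ) := by
    intro z w hz hw
    rw [← Complex.ofReal_exp, ← Complex.ofReal_mul, Real.exp_sub, Real.exp_log hz, Real.exp_log hw, div_mul_cancel₀ _ hw.ne']
  have zP2 : 0 < 9 * ((2 * α - 1) * (α - 1)) ^ r * G * α ^ e * 10 ^ em := by positivity
  have zQ2 : 0 < a * (α * ((k+1) * α - 2 * k)) ^ r * 10 ^ ep := by positivity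
  have eN : (((10:ℕ):K)) = (10:K) := by norm_num
  have nrm10 : ∀ (φ : K →+* ℂ) (j : ℕ), ‖φ (((10:ℕ):K) ^ j)‖ = 10 ^ j := by
    intro φ j; rw [map_pow, norm_pow, map_natCast, Complex.norm_natCast]; norm_num
  have l2eq : Real.log (9 * ((2 * α - 1) * (α - 1)) ^ r * G * α ^ e * 10 ^ em) - Real.log (a * (α * ((k+1) * α - 2 * k)) ^ r * 10 ^ ep)
      = e * Real.log α + em * Real.log 10 - ep * Real.log 10 + (r * Real.log (fK k α) + Real.log 9 - Real.log a + Real.log G) := by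
    rw [fK, Real.log_mul (by positivity) (by positivity), Real.log_mul (by positivity) (by positivity), Real.log_mul (by positivity) (by positivity),
      Real.log_mul (by norm_num) (by positivity), Real.log_mul (by positivity) (by positivity), Real.log_mul (by positivity) (by positivity),
      Real.log_div hnum.ne' hden.ne', Real.log_pow, Real.log_pow, Real.log_pow, Real.log_pow, Real.log_pow]
    ring
  have r3 : (r:ℝ) ≤ 3 := by exact_mod_cast hr
  have rf : |(r:ℝ) * Real.log (fK k α)| ≤ 6 := by
    rw [abs_mul, abs_of_nonneg (by positivity : (0:ℝ) ≤ r)]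
    calc (r:ℝ) * |Real.log (fK k α)| ≤ 3 * 2 := mul_le_mul r3 hlogf (abs_nonneg _) (by norm_num)
      _ = 6 := by norm_num
  rw [abs_le] at rf
  have one_le_exp : ∀ j : ℕ, (1:ℝ) ≤ Real.exp j := fun j => Real.one_le_exp (by positivity)
  have key := TL1 φ₀ D (hfr.trans hkD) (θ ^ x) (((10:ℕ):K) ^ y) P2 Q2 (hint.pow x) ((iN 10).pow y)
    (by rw [hP2]
        exact (((((iN 9).mul ((((iN 2).mul hint).sub (iN 1)).mul (hint.sub (iN 1)) |>.pow r)).mul (iN G)).mul (hint.pow e)).mul ((iN 10).pow em)))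
    (by rw [hQ2]
        exact ((iN a).mul ((hint.mul (((iN (k+1)).mul hint).sub (iN (2*k)))).pow r)).mul ((iN 10).pow ep))
    (ne_of _ _ cP1 (by positivity)) (ne_of _ _ cQ1 (by positivity)) (ne_of _ _ cP2 zP2) (ne_of _ _ cQ2 zQ2)
    (3 * x) (28 + g + x + 3 * (ep + em)) (by omega) (by omega)
    (by intro φ
        rw [map_pow, norm_pow]
        calc ‖φ θ‖ ^ x ≤ 2 ^ x := pow_le_pow_left₀ (norm_nonneg _) (hcon φ) x
          _ ≤ Real.exp x := exp_two x
          _ ≤ _ := Real.exp_le_exp.2 (by push_cast; linarith))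
    (by intro φ
        rw [nrm10]
        exact (exp_ten y).trans (Real.exp_le_exp.2 (by push_cast; linarith)))
    (by intro φ
        have n1 : ‖φ ((((2:ℕ):K) * θ - ((1:ℕ):K)) * (θ - ((1:ℕ):K)))‖ ≤ 15 := by
          rw [map_mul, norm_mul, map_sub, map_sub, map_mul, map_natCast, map_natCast]
          have b1 : ‖((2:ℕ):ℂ) * φ θ - ((1:ℕ):ℂ)‖ ≤ 5 := by
            refine (norm_sub_le _ _).trans ?_
            rw [norm_mul]; simp; have := hcon φ; linarith
          have b2 : ‖φ θ - ((1:ℕ):ℂ)‖ ≤ 3 := by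
            refine (norm_sub_le _ _).trans ?_
            simp; have := hcon φ; linarith
          calc _ ≤ (5:ℝ) * 3 := mul_le_mul b1 b2 (norm_nonneg _) (by norm_num)
            _ = 15 := by norm_num
        rw [hP2, map_mul, map_mul, map_mul, map_mul, norm_mul, norm_mul, norm_mul, norm_mul, map_pow _ _ r, map_pow _ _ e, nrm10, norm_pow, norm_pow, map_natCast, map_natCast]
        have b3 : ‖φ ((((2:ℕ):K) * θ - ((1:ℕ):K)) * (θ - ((1:ℕ):K)))‖ ^ r ≤ 5204 ^ 3 :=
          (pow_le_pow_left₀ (norm_nonneg _) (n1.trans (by norm_num : (15:ℝ) ≤ 5204)) r).trans (pow_le_pow_right₀ (by norm_num) hr)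
        have b4 : ‖φ θ‖ ^ e ≤ Real.exp x := by
          calc ‖φ θ‖ ^ e ≤ 2 ^ e := pow_le_pow_left₀ (norm_nonneg _) (hcon φ) e
            _ ≤ Real.exp e := exp_two e
            _ ≤ _ := Real.exp_le_exp.2 ex
        have b5 : ‖((9:ℕ):ℂ)‖ * ‖φ ((((2:ℕ):K) * θ - ((1:ℕ):K)) * (θ - ((1:ℕ):K)))‖ ^ r ≤ Real.exp 28 := by
          refine le_trans ?_ exp_28
          have : ‖((9:ℕ):ℂ)‖ = 9 := by simp
          rw [this]; gcongr
        have b6 : ‖((G:ℕ):ℂ)‖ ≤ Real.exp g := by rw [Complex.norm_natCast]; exact hGg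
        calc _ ≤ Real.exp 28 * Real.exp g * Real.exp x * Real.exp (3 * em) := by
              gcongr
              exact exp_ten em
          _ ≤ _ := by
              rw [← Real.exp_add, ← Real.exp_add, ← Real.exp_add]
              apply Real.exp_le_exp.2
              push_cast; linarith)
    (by intro φ
        have kk : (k:ℝ) ≤ 650 := by exact_mod_cast hk
        have n1 : ‖φ (θ * (((k+1:ℕ):K) * θ - ((2*k:ℕ):K)))‖ ≤ 5204 := by
          rw [map_mul, norm_mul, map_sub, map_mul, map_natCast, map_natCast]
          have b1 : ‖((k+1:ℕ):ℂ) * φ θ - ((2*k:ℕ):ℂ)‖ ≤ 2602 := by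
            refine (norm_sub_le _ _).trans ?_
            rw [norm_mul, Complex.norm_natCast, Complex.norm_natCast]
            push_cast
            exact app_k (by positivity) kk (hcon φ)
          calc _ ≤ (2:ℝ) * 2602 := mul_le_mul (hcon φ) b1 (norm_nonneg _) (by norm_num)
            _ = 5204 := by norm_num
        rw [hQ2, map_mul, map_mul, norm_mul, norm_mul, map_pow _ _ r, nrm10, norm_pow, map_natCast]
        have b3 : ‖φ (θ * (((k+1:ℕ):K) * θ - ((2*k:ℕ):K)))‖ ^ r ≤ 5204 ^ 3 :=
          (pow_le_pow_left₀ (norm_nonneg _) n1 r).trans (pow_le_pow_right₀ (by norm_num) hr)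
        have b5 : ‖((a:ℕ):ℂ)‖ * ‖φ (θ * (((k+1:ℕ):K) * θ - ((2*k:ℕ):K)))‖ ^ r ≤ Real.exp 28 := by
          refine le_trans ?_ exp_28
          rw [Complex.norm_natCast]
          have : (a:ℝ) ≤ 9 := by exact_mod_cast ha9
          gcongr
        calc _ ≤ Real.exp 28 * Real.exp (3 * ep) := by
              gcongr
              exact exp_ten ep
          _ ≤ _ := by
              rw [← Real.exp_add]
              apply Real.exp_le_exp.2
              push_cast; linarith)
    (Real.log (α ^ x) - Real.log (10 ^ y)) (Real.log (9 * ((2 * α - 1) * (α - 1)) ^ r * G * α ^ e * 10 ^ em) - Real.log (a * (α * ((k+1) * α - 2 * k)) ^ r * 10 ^ ep))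
    (by rw [cP1, cQ1]; exact rel _ _ (by positivity) (by positivity))
    (by rw [cP2, cQ2]; exact rel _ _ zP2 zQ2)
    (by rw [Real.log_pow, Real.log_pow]; exact lam_ne h x y hx)
    (by rw [Real.log_pow, Real.log_pow, abs_le]; push_cast
        have q1 := mul_bd (by linarith : (0:ℝ) ≤ x) la0 hlog.2
        have q2 := mul_bd y0 hl10' hl10
        constructor <;> linarith [q1.1, q1.2, q2.1, q2.2])
    (by rw [l2eq, abs_le]; push_cast
        have q1 := mul_bd e0 la0 hlog.2
        have q2 := mul_bd em0 hl10' hl10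
        have q3 := mul_bd ep0 hl10' hl10
        have hl9' := hl9.2
        have hl9'' := hl9.1
        push_cast at hl9' hl9''
        constructor <;> linarith [rf.1, rf.2, hla.1, hla.2, q1.1, q1.2, q2.1, q2.2, q3.1, q3.2])
    (D * τ) u τ (Nat.mul_pos hD hτ) (by push_cast; exact le_rfl) (by simpa using hu)
    (by refine le_trans ?_ hτN
        exact_mod_cast ht)
  have eLam : (u:ℝ) * (Real.log (α ^ x) - Real.log (10 ^ y)) + (Real.log (9 * ((2 * α - 1) * (α - 1)) ^ r * G * α ^ e * 10 ^ em) - Real.log (a * (α * ((k+1) * α - 2 * k)) ^ r * 10 ^ ep))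
      = (N:ℝ) * Real.log α - d * Real.log 10 + (r * Real.log (fK k α) + Real.log 9 - Real.log a + Real.log G) := by
    rw [l2eq, Real.log_pow, Real.log_pow]
    have c1 : (N:ℝ) = u * x + e := by exact_mod_cast hNe
    have c2 : (d:ℝ) + em = u * y + ep := by exact_mod_cast hde
    rw [c1]
    linear_combination (Real.log 10) * c2
  rw [eLam] at key
  exact lt_of_le_of_lt (Real.exp_le_exp.2 (neg_le_neg (app_fin D X τ N x g ep em hD hX1 hτ hx hxX hw))) key

end TL

end

section
namespace TL

lemma log50_lt : Real.log 50 ≤ 4 := by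
  rw [Real.log_le_iff_le_exp (by norm_num)]
  have h := Real.exp_one_gt_d9
  have : Real.exp 4 = Real.exp 1 ^ 4 := by rw [← Real.exp_nat_mul]; norm_num
  rw [this]
  calc (50:ℝ) ≤ 2.7 ^ 4 := by norm_num
    _ ≤ _ := pow_le_pow_left₀ (by norm_num) (by linarith) 4

lemma chain_step {k : ℕ} {α : ℝ} (h : Root k α) (hk : k ≤ 650) (D : ℕ) (hkD : k ≤ D) (r : ℕ) (hr : r ≤ 3)
    (G g : ℕ) (hG : 1 ≤ G) (hGg : (G:ℝ) ≤ Real.exp g) (a : ℕ) (ha1 : 1 ≤ a) (ha9 : a ≤ 9) (N d X τ : ℕ) (hτ : 1 ≤ τ)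
    (hτN : (N:ℝ) * N ≤ Real.exp τ) (q y w : ℕ) (hq : 150 * (26 * (D+222)^2 * D^2 * τ^3) ≤ q) (hX : q ≤ X)
    (hN : q * X * (28 + g + 4 * X) ≤ 100 * N) (hd : d ≤ N)
    (hY : 9 * N + 12 * X ^ 3 + 3 * X ^ 2 * (28 + g) ≤ y * X)
    (hΛ : |(N:ℝ) * Real.log α - d * Real.log 10 + (r * Real.log (fK k α) + Real.log 9 - Real.log a + Real.log G)| ≤ 50 * (α ^ w)⁻¹) :
    141 * w < 1200 + 2 * q * y := by
  have hD : 1 ≤ D := by have := h.hk; omega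
  have hc : 1200 * ((D+222) * D * τ) ≤ q := by
    refine le_trans ?_ hq
    have : (D+222) * D * τ ≤ (D+222)^2 * D^2 * τ^3 := by gcongr <;> first | exact Nat.le_self_pow (by norm_num) _ | skip
    calc 1200 * ((D+222) * D * τ) ≤ 3900 * ((D+222)^2 * D^2 * τ^3) := by omega
      _ = _ := by ring
  have hq0 : 0 < q := lt_of_lt_of_le (by positivity) hc
  have hX0 : 0 < X := by omega
  have key := app h hk D hkD r hr G g hG hGg a ha1 ha9 N d X τ hτ hτN
    (by refine le_trans ?_ hX; refine le_trans ?_ hc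
        nlinarith [Nat.zero_le ((D+222) * D * τ)])
    (by have : 100 * (12 * (D+222) * D * τ * X * (28 + g + 4 * X)) ≤ 100 * N := by
          refine le_trans ?_ hN
          calc _ = (1200 * ((D+222) * D * τ)) * X * (28 + g + 4 * X) := by ring
            _ ≤ _ := by gcongr
        omega) hd
  have hl := h.log_bd
  have hα : 0 < α := by linarith [h.lo]
  have k2 := lt_of_lt_of_le key hΛ
  have k3 := Real.log_lt_log (Real.exp_pos _) k2
  rw [Real.log_exp, Real.log_mul (by norm_num) (by positivity), Real.log_inv, Real.log_pow] at k3
  have k4 := log50_lt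
  have X0 : (0:ℝ) < X := by exact_mod_cast hX0
  have hYr : 9 * ((N:ℝ) / X) + 12 * (X:ℝ)^2 + 3 * X * (28 + g) ≤ y := by
    have : (9:ℝ) * N + 12 * X ^ 3 + 3 * X ^ 2 * (28 + g) ≤ y * X := by exact_mod_cast hY
    rw [← mul_le_mul_iff_left₀ X0]
    refine le_trans (le_of_eq ?_) this
    field_simp
  have hqr : 150 * (26 * ((D:ℝ)+222)^2 * D^2 * τ^3) ≤ q := by exact_mod_cast hq
  have c0 : 0 ≤ 26 * ((D:ℝ)+222)^2 * D^2 * τ^3 := by positivity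
  have y0 : (0:ℝ) ≤ y := by positivity
  have k5 : 26 * ((D:ℝ)+222)^2 * D^2 * τ^3 * (9 * ((N:ℝ) / X) + 12 * (X:ℝ)^2 + 3 * X * (28 + g)) ≤ 26 * ((D:ℝ)+222)^2 * D^2 * τ^3 * y :=
    mul_le_mul_of_nonneg_left hYr c0
  have k6 : 150 * (26 * ((D:ℝ)+222)^2 * D^2 * τ^3) * y ≤ q * y := mul_le_mul_of_nonneg_right hqr y0
  have k7 : 0.47 * (w:ℝ) ≤ w * Real.log α := by
    rw [mul_comm]; exact mul_le_mul_of_nonneg_left hl.1 (by positivity)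
  have : (141:ℝ) * w < 1200 + 2 * q * y := by linarith
  exact_mod_cast this

lemma succ_pow_le (q p : ℕ) (h : 2 * p ≤ q) : (q + 1) ^ p ≤ 2 * q ^ p := by
  have hr : (q + 1 : ℝ) ^ p ≤ 2 * q ^ p := by
    have h1 := one_add_mul_le_pow (a := -(1 / ((q:ℝ) + 1))) (by
      have : 1 / ((q:ℝ) + 1) ≤ 1 := by rw [div_le_one (by positivity)]; linarith [(Nat.cast_nonneg q : (0:ℝ) ≤ q)]
      linarith) p
    have e : 1 + -(1 / ((q:ℝ) + 1)) = q / (q + 1) := by field_simp; ring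
    rw [e, div_pow] at h1
    have h2 : (1:ℝ) / 2 ≤ 1 + p * -(1 / ((q:ℝ) + 1)) := by
      have : (p:ℝ) * (1 / ((q:ℝ) + 1)) ≤ 1 / 2 := by
        rw [mul_one_div, div_le_div_iff₀ (by positivity) (by norm_num)]
        have : (2 * p : ℝ) ≤ q := by exact_mod_cast h
        linarith
      linarith
    have h3 := h2.trans h1
    rw [le_div_iff₀ (by positivity)] at h3
    linarith
  exact_mod_cast hr

/-- threshold function -/
lemma thr (K p ν₀ : ℕ) (h1 : 42 * p ≤ 7 * ν₀) (h0 : (K * (7 * ν₀ + 26) ^ 3) ^ p ≤ 125 ^ p * 2 ^ ν₀) (ν : ℕ) (hν : ν₀ ≤ ν) :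
    (K * (7 * ν + 26) ^ 3) ^ p ≤ 125 ^ p * 2 ^ ν := by
  induction ν, hν using Nat.le_induction with
  | base => exact h0
  | succ ν hν ih =>
    have h2 : (7 * (ν + 1) + 26) ^ (3 * p) ≤ 2 * (7 * ν + 26) ^ (3 * p) := by
      have e1 : (7 * (ν + 1) + 26 : ℝ) ^ (3 * p) ≤ 2 * (7 * ν + 26) ^ (3 * p) := by
        have h1' := one_add_mul_le_pow (a := -(7 / (7 * (ν:ℝ) + 33))) (by
          have : 7 / (7 * (ν:ℝ) + 33) ≤ 1 := by rw [div_le_one (by positivity)]; linarith [(Nat.cast_nonneg ν : (0:ℝ) ≤ ν)]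
          linarith) (3 * p)
        have e : 1 + -(7 / (7 * (ν:ℝ) + 33)) = (7 * ν + 26) / (7 * ν + 33) := by field_simp; ring
        rw [e, div_pow] at h1'
        have h2 : (1:ℝ) / 2 ≤ 1 + ((3 * p : ℕ) : ℝ) * -(7 / (7 * (ν:ℝ) + 33)) := by
          have : ((3 * p : ℕ) : ℝ) * (7 / (7 * (ν:ℝ) + 33)) ≤ 1 / 2 := by
            rw [mul_div_assoc', div_le_div_iff₀ (by positivity) (by norm_num)]
            have : (42 * p : ℝ) ≤ 7 * ν := by exact_mod_cast h1.trans (Nat.mul_le_mul_left 7 hν)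
            push_cast
            linarith
          linarith
        have h3 := h2.trans h1'
        rw [le_div_iff₀ (by positivity)] at h3
        have e2 : (7 * ((ν:ℝ) + 1) + 26) = 7 * ν + 33 := by ring
        rw [e2]; linarith
      exact_mod_cast e1
    calc (K * (7 * (ν + 1) + 26) ^ 3) ^ p = K ^ p * (7 * (ν + 1) + 26) ^ (3 * p) := by rw [mul_pow, pow_mul]
      _ ≤ K ^ p * (2 * (7 * ν + 26) ^ (3 * p)) := by gcongr
      _ = 2 * (K * (7 * ν + 26) ^ 3) ^ p := by rw [mul_pow, pow_mul]; ring
      _ ≤ 2 * (125 ^ p * 2 ^ ν) := by gcongr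
      _ = 125 ^ p * 2 ^ (ν + 1) := by ring

lemma exp_7_5 (j : ℕ) : (2:ℝ) ^ (2 * j) ≤ Real.exp ((7 * j : ℝ) / 5) := by
  have h1 : (2:ℝ) ^ 10 ≤ Real.exp 7 := by
    have h := Real.exp_one_gt_d9
    have : Real.exp 7 = Real.exp 1 ^ 7 := by rw [← Real.exp_nat_mul]; norm_num
    rw [this]
    calc (2:ℝ) ^ 10 ≤ 2.7182 ^ 7 := by norm_num
      _ ≤ _ := pow_le_pow_left₀ (by norm_num) (by linarith) 7
  refine le_of_pow_le_pow_left₀ (n := 5) (by norm_num) (by positivity) ?_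
  rw [← Real.exp_nat_mul]
  calc ((2:ℝ) ^ (2 * j)) ^ 5 = (2 ^ 10) ^ j := by rw [← pow_mul, ← pow_mul]; congr 1; ring
    _ ≤ Real.exp 7 ^ j := pow_le_pow_left₀ (by norm_num) h1 j
    _ = _ := by rw [← Real.exp_nat_mul]; congr 1; push_cast; ring

/-- choice of the parameters -/
lemma params (D p ν₀ n : ℕ) (hD : 1 ≤ D) (hp : 1 ≤ p) (hp' : p ≤ 24) (h1 : 42 * p ≤ 7 * ν₀)
    (h0 : (3900 * ((D + 222) ^ 2 * D ^ 2) * (7 * ν₀ + 26) ^ 3) ^ p ≤ 125 ^ p * 2 ^ ν₀) (hn : 2 ^ ν₀ ≤ n) :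
    ∃ τ q : ℕ, 1 ≤ τ ∧ (∀ N : ℕ, N ≤ 3 * n → (N:ℝ) * N ≤ Real.exp τ) ∧ 150 * (26 * (D+222)^2 * D^2 * τ^3) ≤ q ∧
      q ^ p ≤ n ∧ n ≤ 2 * q ^ p ∧ 1000000 ≤ q := by
  have hn0 : n ≠ 0 := by have : 0 < 2 ^ ν₀ := by positivity
                         omega
  obtain ⟨ν, hν⟩ : ∃ ν, ν = Nat.log 2 n := ⟨_, rfl⟩
  have l1 : 2 ^ ν ≤ n := by rw [hν]; exact Nat.pow_log_le_self 2 hn0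
  have l2 : n < 2 ^ (ν + 1) := by rw [hν]; exact Nat.lt_pow_succ_log_self (by norm_num) n
  have l3 : ν₀ ≤ ν := by rw [hν]; exact Nat.le_log_of_pow_le (by norm_num) hn
  have t := thr _ p ν₀ h1 h0 ν l3
  obtain ⟨τ, hτ⟩ : ∃ τ, τ = 7 * (ν + 3) / 5 + 1 := ⟨_, rfl⟩
  have τ1 : 5 * τ ≤ 7 * ν + 26 := by omega
  have τ2 : 7 * (ν + 3) ≤ 5 * τ := by omega
  obtain ⟨c, hc⟩ : ∃ c, c = 150 * (26 * (D+222)^2 * D^2 * τ^3) := ⟨_, rfl⟩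
  have hcp : c ^ p ≤ n := by
    refine le_trans ?_ l1
    have : 125 ^ p * c ^ p ≤ 125 ^ p * 2 ^ ν := by
      refine le_trans ?_ t
      rw [← mul_pow]
      apply Nat.pow_le_pow_left
      calc 125 * c = 3900 * ((D + 222) ^ 2 * D ^ 2) * (5 * τ) ^ 3 := by rw [hc]; ring
        _ ≤ _ := by gcongr
    exact Nat.le_of_mul_le_mul_left this (by positivity)
  have hcn : c ≤ n := le_trans (Nat.le_self_pow (by omega) c) hcp
  have c6 : 1000000 ≤ c := by
    have : 1 ≤ D ^ 2 * τ ^ 3 := by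
      have : 0 < τ := by omega
      exact Nat.succ_le_of_lt (by positivity)
    have h3 : 222 ^ 2 ≤ (D + 222) ^ 2 := by gcongr; omega
    calc 1000000 ≤ 150 * (26 * 222 ^ 2 * 1) := by norm_num
      _ ≤ 150 * (26 * (D+222) ^ 2 * (D ^ 2 * τ ^ 3)) := by gcongr
      _ = c := by rw [hc]; ring
  obtain ⟨q, hq⟩ : ∃ q, q = Nat.findGreatest (fun q => q ^ p ≤ n) n := ⟨_, rfl⟩
  have q1 : c ≤ q := by rw [hq]; exact Nat.le_findGreatest hcn hcp
  have q2 : q ^ p ≤ n := by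
    rw [hq]; exact Nat.findGreatest_spec (P := fun q => q ^ p ≤ n) hcn hcp
  have q3 : n < (q + 1) ^ p := by
    by_contra hh
    push Not at hh
    have : q + 1 ≤ q := by
      conv_rhs => rw [hq]
      exact Nat.le_findGreatest (le_trans (Nat.le_self_pow (by omega) _) hh) hh
    omega
  refine ⟨τ, q, by omega, ?_, by omega, q2, ?_, by omega⟩
  · intro N hN
    have n1 : N ≤ 2 ^ (ν + 3) := by
      have : 2 ^ (ν + 3) = 4 * 2 ^ (ν + 1) := by ring
      omega
    have n2 : (N:ℝ) ≤ 2 ^ (ν + 3) := by exact_mod_cast n1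
    calc (N:ℝ) * N ≤ 2 ^ (ν + 3) * 2 ^ (ν + 3) := by gcongr
      _ = 2 ^ (2 * (ν + 3)) := by ring
      _ ≤ Real.exp ((7 * ((ν + 3 : ℕ):ℝ)) / 5) := exp_7_5 (ν + 3)
      _ ≤ _ := by
        apply Real.exp_le_exp.2
        rw [div_le_iff₀ (by norm_num)]
        have : ((7 * (ν + 3) : ℕ) : ℝ) ≤ ((5 * τ : ℕ) : ℝ) := by exact_mod_cast τ2
        push_cast at this ⊢; linarith
  · have := succ_pow_le q p (by omega)
    omega

end TL

end

section
namespace TL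

variable {k n m l d a : ℕ} {α : ℝ}

lemma pm {q : ℕ} (hq : 1000000 ≤ q) (i j : ℕ) (h : i < j) : 1000000 * q ^ i ≤ q ^ j := by
  obtain ⟨t, rfl⟩ := Nat.exists_eq_add_of_lt h
  calc 1000000 * q ^ i ≤ q * q ^ i := by gcongr
    _ = q ^ (i + 1) := by ring
    _ ≤ _ := Nat.pow_le_pow_right (by omega) (by omega)

lemma L_exp (k l : ℕ) : (lucasK k l : ℝ) ≤ Real.exp ((l + 1 : ℕ):ℝ) := by
  refine le_trans ?_ (exp_two (l+1))
  exact_mod_cast lucasK_le k l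

lemma Sol.step1 (s : Sol k n m l d a) (h : Root k α) (D : ℕ) (hkD : k ≤ D) (X τ q y : ℕ) (hτ : 1 ≤ τ)
    (hτN : ∀ N : ℕ, N ≤ 3 * n → (N:ℝ) * N ≤ Real.exp τ) (hq : 150 * (26 * (D+222)^2 * D^2 * τ^3) ≤ q) (hX : q ≤ X)
    (hN : q * X * (28 + 4 * X) ≤ 100 * n)
    (hY : 27 * n + 12 * X ^ 3 + 3 * X ^ 2 * 28 ≤ y * X) : 141 * l < 1200 + 2 * q * y := by
  have hnm := s.hnm
  have hml := s.hml
  have hd := s.d_le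
  refine chain_step h s.hk' D hkD 3 le_rfl 1 0 le_rfl (by simp) a s.ha1 s.ha9 (n+m+l) d X τ hτ (hτN _ (by omega)) q y l hq hX
    ?_ (by omega) ?_ ?_
  · rw [Nat.add_zero]; omega
  · rw [Nat.add_zero]; omega
  · have := s.lam1 h
    simpa using this

lemma Sol.step2 (s : Sol k n m l d a) (h : Root k α) (D : ℕ) (hkD : k ≤ D) (X τ q y : ℕ) (hτ : 1 ≤ τ)
    (hτN : ∀ N : ℕ, N ≤ 3 * n → (N:ℝ) * N ≤ Real.exp τ) (hq : 150 * (26 * (D+222)^2 * D^2 * τ^3) ≤ q) (hX : q ≤ X)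
    (g : ℕ) (hg : l + 1 ≤ g)
    (hN : q * X * (28 + g + 4 * X) ≤ 100 * n)
    (hY : 18 * n + 12 * X ^ 3 + 3 * X ^ 2 * (28 + g) ≤ y * X) : 141 * m < 1200 + 2 * q * y := by
  have hnm := s.hnm
  have hml := s.hml
  have hd := s.d_le
  refine chain_step h s.hk' D hkD 2 (by norm_num) (lucasK k l) g (lucasK_pos k l s.hk) ?_ a s.ha1 s.ha9 (n+m) d X τ hτ (hτN _ (by omega)) q y m hq hX
    (by omega) (by omega) (by omega) ?_
  · refine (L_exp k l).trans (Real.exp_le_exp.2 ?_)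
    exact_mod_cast hg
  · have := s.lam2 h
    simpa using this

lemma Sol.step3 (s : Sol k n m l d a) (h : Root k α) (D : ℕ) (hkD : k ≤ D) (X τ q y : ℕ) (hτ : 1 ≤ τ)
    (hτN : ∀ N : ℕ, N ≤ 3 * n → (N:ℝ) * N ≤ Real.exp τ) (hq : 150 * (26 * (D+222)^2 * D^2 * τ^3) ≤ q) (hX : q ≤ X)
    (g : ℕ) (hg : (l + 1) + (m + 1) ≤ g)
    (hN : q * X * (28 + g + 4 * X) ≤ 100 * n)
    (hY : 9 * n + 12 * X ^ 3 + 3 * X ^ 2 * (28 + g) ≤ y * X) : 141 * n < 1200 + 2 * q * y := by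
  have hnm := s.hnm
  have hml := s.hml
  have hd := s.d_le
  have p1 := lucasK_pos k l s.hk
  have p2 := lucasK_pos k m s.hk
  refine chain_step h s.hk' D hkD 1 (by norm_num) (lucasK k l * lucasK k m) g (Nat.mul_pos p1 p2) ?_ a s.ha1 s.ha9 n d X τ hτ (hτN _ (by omega)) q y n hq hX
    (by omega) (by omega) (by omega) ?_
  · push_cast
    calc _ ≤ Real.exp ((l + 1 : ℕ):ℝ) * Real.exp ((m + 1 : ℕ):ℝ) :=
          mul_le_mul (L_exp k l) (L_exp k m) (by positivity) (by positivity)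
      _ = Real.exp (((l + 1) + (m + 1) : ℕ) : ℝ) := by rw [← Real.exp_add]; push_cast; rfl
      _ ≤ _ := Real.exp_le_exp.2 (by exact_mod_cast hg)
  · have := s.lam3 h
    rw [Nat.cast_mul, Real.log_mul (by positivity) (by positivity)]
    simpa using this

theorem Sol.chainA (s : Sol k n m l d a) (h : Root k α) : n < 2 ^ 2030 := by
  by_contra hn
  push Not at hn
  obtain ⟨τ, q, hτ, hτN, hq, q1, q2, q6⟩ := params 650 24 2030 n (by norm_num) (by norm_num) (by norm_num) (by norm_num)
    (by decide +kernel) hn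
  clear hn
  have P := fun i j h => pm q6 i j h
  have hml := s.hml
  have hl : l + 1 ≤ q ^ 17 := by
    have := s.step1 h 650 s.hk' (q ^ 8) τ q (67 * q ^ 16) hτ hτN hq
      (by linarith [P 1 8 (by norm_num), P 0 1 (by norm_num)])
      (by linarith [P 9 24 (by norm_num), P 17 24 (by norm_num)])
      (by linarith [P 16 24 (by norm_num)])
    linarith [P 0 17 (by norm_num)]
  have hm : m + 1 ≤ q ^ 22 := by
    have := s.step2 h 650 s.hk' (q ^ 3) τ q (40 * q ^ 21) hτ hτN hq
      (by linarith [P 1 3 (by norm_num), P 0 1 (by norm_num)]) (q ^ 17) hl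
      (by linarith [P 4 24 (by norm_num), P 7 24 (by norm_num), P 21 24 (by norm_num)])
      (by linarith [P 6 24 (by norm_num), P 9 24 (by norm_num), P 23 24 (by norm_num)])
    linarith [P 0 22 (by norm_num)]
  have := s.step3 h 650 s.hk' q τ q (25 * q ^ 23) hτ hτN hq le_rfl (2 * q ^ 22) (by omega)
    (by linarith [P 2 24 (by norm_num), P 3 24 (by norm_num)])
    (by linarith [P 2 24 (by norm_num), P 3 24 (by norm_num)])
  linarith [P 0 24 (by norm_num)]

theorem Sol.chainA2 (s : Sol k n m l d a) (h : Root k α) (hl : l ≤ 3200) : n < 2 ^ 722 := by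
  by_contra hn
  push Not at hn
  obtain ⟨τ, q, hτ, hτN, hq, q1, q2, q6⟩ := params 650 9 722 n (by norm_num) (by norm_num) (by norm_num) (by norm_num)
    (by decide +kernel) hn
  clear hn
  have P := fun i j h => pm q6 i j h
  have hml := s.hml
  have hm : m + 1 ≤ q ^ 7 := by
    have := s.step2 h 650 s.hk' (q ^ 3) τ q (50 * q ^ 6) hτ hτN hq
      (by linarith [P 1 3 (by norm_num), P 0 1 (by norm_num)]) 3201 (by omega)
      (by linarith [P 4 9 (by norm_num), P 7 9 (by norm_num)])
      (by linarith [P 6 9 (by norm_num)])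
    linarith [P 0 7 (by norm_num)]
  have := s.step3 h 650 s.hk' q τ q (25 * q ^ 8) hτ hτN hq le_rfl (2 * q ^ 7) (by omega)
    (by linarith [P 2 9 (by norm_num), P 3 9 (by norm_num)])
    (by linarith [P 2 9 (by norm_num), P 3 9 (by norm_num)])
  linarith [P 0 9 (by norm_num)]

theorem Sol.chainF (s : Sol k n m l d a) (h : Root k α) (hl : m ≤ 3200) (D ν₀ : ℕ) (hkD : k ≤ D) (h1 : 42 * 3 ≤ 7 * ν₀)
    (h0 : (3900 * ((D + 222) ^ 2 * D ^ 2) * (7 * ν₀ + 26) ^ 3) ^ 3 ≤ 125 ^ 3 * 2 ^ ν₀) : n < 2 ^ ν₀ := by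
  by_contra hn
  push Not at hn
  have hml := s.hml
  obtain ⟨τ, q, hτ, hτN, hq, q1, q2, q6⟩ := params D 3 ν₀ n (by have := s.hk; omega) (by norm_num) (by norm_num) h1 h0 hn
  clear hn
  have P := fun i j h => pm q6 i j h
  have := s.step3 h D hkD q τ q (31 * q ^ 2) hτ hτN hq le_rfl 6402 (by omega)
    (by linarith [P 2 3 (by norm_num)])
    (by linarith [P 2 3 (by norm_num)])
  linarith [P 0 3 (by norm_num)]

theorem Sol.chainF3 (s : Sol k n m l d a) (h : Root k α) (hl : m ≤ 3200) : n < 2 ^ 226 :=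
  s.chainF h hl 650 226 s.hk' (by norm_num) (by decide +kernel)

theorem Sol.chainF2 (s : Sol 2 n m l d a) (h : Root 2 α) (hl : m ≤ 3200) : n < 2 ^ 160 :=
  s.chainF h hl 2 160 le_rfl (by norm_num) (by decide +kernel)

end TL

end

noncomputable section
namespace TL

/-- evaluate a natural number before passing it on -/
def force {β : Type} (n : ℕ) (f : ℕ → β) : β := Nat.rec (f 0) (fun m _ => f (Nat.succ m)) n

lemma force_eq {β : Type} (n : ℕ) (f : ℕ → β) : force n f = f n := by cases n <;> rfl

def gs (S X : ℕ) : ℕ → ℕ → ℕ → ℕ → ℕ :=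
  Nat.rec (fun _ _ acc => acc) (fun _ ih t j acc =>
    Nat.rec (motive := fun _ => ℕ) acc (fun t' _ =>
      force (Nat.add acc (Nat.div (Nat.succ t') j)) fun acc' =>
      force (Nat.div (Nat.mul (Nat.succ t') X) S) fun t2 =>
      force (Nat.succ j) fun j' => ih t2 j' acc') t)

lemma gs_zero (S X t j acc : ℕ) : gs S X 0 t j acc = acc := rfl
lemma gs_succ_zero (S X n j acc : ℕ) : gs S X (n+1) 0 j acc = acc := rfl
lemma gs_succ_succ (S X n t j acc : ℕ) :
    gs S X (n+1) (t+1) j acc = gs S X n ((t+1) * X / S) (j+1) (acc + (t+1) / j) := by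
  have : gs S X (n+1) (t+1) j acc = force (Nat.add acc (Nat.div (Nat.succ t) j)) fun acc' =>
      force (Nat.div (Nat.mul (Nat.succ t) X) S) fun t2 =>
      force (Nat.succ j) fun j' => gs S X n t2 j' acc' := rfl
  rw [this, force_eq, force_eq, force_eq]; rfl

lemma gs_spec (S X : ℕ) (hS : 0 < S) (hX : 2 * X ≤ S) (n : ℕ) : ∀ (t j acc : ℕ) (T : ℝ), 1 ≤ j → (t:ℝ) ≤ T → T ≤ t + 2 →
    (gs S X n t j acc : ℝ) ≤ acc + ∑ i ∈ Finset.range n, T * ((X:ℝ) / S) ^ i / (j + i) ∧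
    acc + ∑ i ∈ Finset.range n, T * ((X:ℝ) / S) ^ i / (j + i) ≤ gs S X n t j acc + 3 * n + 4 := by
  have S0 : (0:ℝ) < S := by exact_mod_cast hS
  have x0 : 0 ≤ (X:ℝ) / S := by positivity
  have x1 : (X:ℝ) / S ≤ 1 / 2 := by
    rw [div_le_div_iff₀ S0 (by norm_num)]
    have : (2 * X : ℝ) ≤ S := by exact_mod_cast hX
    linarith
  set x := (X:ℝ) / S with hx
  induction n with
  | zero => intro t j acc T hj h1 h2; simp [gs_zero]
  | succ n ih =>
    intro t j acc T hj h1 h2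
    have j1 : (1:ℝ) ≤ j := by exact_mod_cast hj
    have T0 : 0 ≤ T := le_trans (by positivity) h1
    rcases t with _ | t
    · rw [gs_succ_zero]
      have s0 : 0 ≤ ∑ i ∈ Finset.range (n+1), T * x ^ i / (j + i) := Finset.sum_nonneg fun i _ => by positivity
      have s1 : ∑ i ∈ Finset.range (n+1), T * x ^ i / (j + i) ≤ 4 := by
        calc _ ≤ ∑ i ∈ Finset.range (n+1), 2 * (1/2:ℝ) ^ i := by
              refine Finset.sum_le_sum fun i _ => ?_
              have : T ≤ 2 := by simpa using h2
              calc T * x ^ i / (j + i) ≤ T * x ^ i / 1 := by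
                    apply div_le_div_of_nonneg_left (by positivity) (by norm_num)
                    linarith [(Nat.cast_nonneg i : (0:ℝ) ≤ i)]
                _ = T * x ^ i := by rw [div_one]
                _ ≤ _ := by gcongr
          _ = 2 * ∑ i ∈ Finset.range (n+1), (1/2:ℝ) ^ i := by rw [Finset.mul_sum]
          _ ≤ 4 := by
              rw [geom_sum_eq (by norm_num)]
              have : (0:ℝ) ≤ (1/2) ^ (n+1) := by positivity
              have e : 2 * (((1/2:ℝ) ^ (n+1) - 1) / (1/2 - 1)) = 4 - 4 * (1/2) ^ (n+1) := by ring
              rw [e]; linarith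
      constructor
      · linarith
      · push_cast
        linarith [(Nat.cast_nonneg n : (0:ℝ) ≤ n)]
    · rw [gs_succ_succ]
      have f1 : (((t+1) * X / S : ℕ) : ℝ) ≤ T * x := by
        calc (((t+1) * X / S : ℕ) : ℝ) ≤ (((t+1) * X : ℕ) : ℝ) / S := Nat.cast_div_le
          _ = ((t+1 : ℕ) : ℝ) * x := by rw [hx]; push_cast; ring
          _ ≤ _ := by gcongr
      have f2 : T * x ≤ (((t+1) * X / S : ℕ) : ℝ) + 2 := by
        have : (((t+1) * X : ℕ) : ℝ) / S < (((t+1) * X / S : ℕ) : ℝ) + 1 := by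
          rw [div_lt_iff₀ S0]
          have := Nat.lt_mul_div_succ ((t+1) * X) hS
          rw [mul_comm S] at this
          exact_mod_cast this
        have e : (((t+1) * X : ℕ) : ℝ) / S = ((t+1 : ℕ) : ℝ) * x := by rw [hx]; push_cast; ring
        rw [e] at this
        nlinarith
      obtain ⟨i1, i2⟩ := ih ((t+1) * X / S) (j+1) (acc + (t+1) / j) (T * x) (by omega) f1 f2
      have g1 : (((t+1) / j : ℕ) : ℝ) ≤ T / j := by
        calc (((t+1) / j : ℕ) : ℝ) ≤ ((t+1 : ℕ) : ℝ) / j := Nat.cast_div_le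
          _ ≤ _ := by gcongr
      have g2 : T / j ≤ (((t+1) / j : ℕ) : ℝ) + 3 := by
        have : ((t+1 : ℕ) : ℝ) / j < (((t+1) / j : ℕ) : ℝ) + 1 := by
          rw [div_lt_iff₀ (by linarith)]
          have := Nat.lt_mul_div_succ (t+1) (show 0 < j by omega)
          rw [mul_comm j] at this
          exact_mod_cast this
        have h3 : T / j ≤ (((t+1 : ℕ) : ℝ) + 2) / j := by gcongr
        have h4 : (2:ℝ) / j ≤ 2 := by rw [div_le_iff₀ (by linarith)]; linarith
        rw [add_div] at h3
        linarith
      have e : ∑ i ∈ Finset.range (n+1), T * x ^ i / (j + i) =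
          T / j + ∑ i ∈ Finset.range n, T * x * x ^ i / (((j+1 : ℕ) : ℝ) + i) := by
        rw [Finset.sum_range_succ', add_comm]
        congr 1
        · simp
        · refine Finset.sum_congr rfl fun i _ => ?_
          push_cast; congr 1 <;> ring
      rw [e]
      push_cast at i1 i2 ⊢
      constructor <;> linarith

/-- approximation of `- log (U / S)` -/
def ng (S P U : ℕ) : ℕ := force (Nat.sub S U) fun X => gs S X (Nat.add P 2) X 1 0

lemma ng_spec (P U : ℕ) (h1 : 2 ^ P ≤ 2 * U) (h2 : U ≤ 2 ^ P) :
    |(2:ℝ) ^ P * Real.log (U / 2 ^ P) + ng (2 ^ P) P U| ≤ 3 * P + 11 := by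
  obtain ⟨S, hS⟩ : ∃ S, S = 2 ^ P := ⟨_, rfl⟩
  have hSr : (2:ℝ) ^ P = S := by rw [hS]; push_cast; rfl
  rw [← hS] at h1 h2 ⊢
  rw [hSr]
  have S0 : 0 < S := by rw [hS]; positivity
  have S0r : (0:ℝ) < S := by exact_mod_cast S0
  have e1 : ng S P U = gs S (S - U) (P + 2) (S - U) 1 0 := by
    unfold ng; rw [force_eq]; rfl
  rw [e1]
  obtain ⟨X, hX⟩ : ∃ X, X = S - U := ⟨_, rfl⟩
  rw [← hX]
  have s := gs_spec S X S0 (by omega) (P+2) X 1 0 X le_rfl le_rfl (by linarith)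
  have x0 : 0 ≤ (X:ℝ) / S := by positivity
  have x1 : (X:ℝ) / S ≤ 1 / 2 := by
    rw [div_le_div_iff₀ S0r (by norm_num)]
    have : 2 * X ≤ S := by omega
    have : (2 * X : ℝ) ≤ S := by exact_mod_cast this
    linarith
  have eU : (U:ℝ) / S = 1 - X / S := by
    have : U + X = S := by omega
    have : (U:ℝ) + X = S := by exact_mod_cast this
    field_simp; linarith
  have b := Real.abs_log_sub_add_sum_range_le (x := (X:ℝ)/S) (by rw [abs_of_nonneg x0]; linarith) (P+2)
  rw [abs_of_nonneg x0] at b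
  have eS : ∑ i ∈ Finset.range (P+2), (X:ℝ) * ((X:ℝ) / S) ^ i / ((1:ℕ) + i) = S * ∑ i ∈ Finset.range (P+2), ((X:ℝ) / S) ^ (i+1) / (i + 1) := by
    rw [Finset.mul_sum]
    refine Finset.sum_congr rfl fun i _ => ?_
    rw [pow_succ]; push_cast; field_simp; ring
  rw [eS] at s
  have tl : ((X:ℝ) / S) ^ (P+2+1) / (1 - (X:ℝ) / S) * S ≤ 1 := by
    have : ((X:ℝ) / S) ^ (P+2+1) ≤ (1/2) ^ (P + 2 + 1) := pow_le_pow_left₀ x0 x1 _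
    calc ((X:ℝ) / S) ^ (P+2+1) / (1 - (X:ℝ) / S) * S ≤ (1/2) ^ (P + 2 + 1) / (1/2) * S := by
          gcongr; linarith
      _ = (1/2) ^ P * S * (1/4) := by ring
      _ = 1/4 := by
          rw [← hSr, ← mul_pow]; norm_num
      _ ≤ 1 := by norm_num
  rw [eU]
  have b2 : |S * ∑ i ∈ Finset.range (P+2), ((X:ℝ) / S) ^ (i+1) / (i + 1) + S * Real.log (1 - X / S)| ≤ 1 := by
    rw [← mul_add, abs_mul, abs_of_pos S0r]
    refine le_trans ?_ tl
    rw [mul_comm]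
    exact mul_le_mul_of_nonneg_right b S0r.le
  rw [abs_le] at b2 ⊢
  push_cast at s
  constructor <;> linarith [s.1, s.2, b2.1, b2.2]

lemma log_lip {u v : ℝ} (hu : 1 / 2 ≤ u) (hv : 1 / 2 ≤ v) : |Real.log u - Real.log v| ≤ 2 * |u - v| := by
  have key : ∀ u v : ℝ, 1/2 ≤ u → 1/2 ≤ v → u ≤ v → |Real.log u - Real.log v| ≤ 2 * |u - v| := by
    intro u v hu hv h
    rw [abs_of_nonpos (by linarith [Real.log_le_log (by linarith) h]), abs_of_nonpos (by linarith)]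
    have := Real.log_le_sub_one_of_pos (x := v / u) (by positivity)
    rw [Real.log_div (by linarith) (by linarith)] at this
    have : v / u - 1 ≤ 2 * (v - u) := by
      have u0 : 0 < u := by linarith
      rw [div_sub_one u0.ne', div_le_iff₀ u0]; nlinarith
    linarith
  rcases le_total u v with h | h
  · exact key u v hu hv h
  · rw [abs_sub_comm, abs_sub_comm u v]; exact key v u hv hu h

lemma ng_apx (P U : ℕ) (hP : P ≤ 5000) (h1 : 2 ^ P ≤ 2 * U) (h2 : U ≤ 2 ^ P) (u δ : ℝ) (hu : 1 / 2 ≤ u)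
    (h : |u * 2 ^ P - U| ≤ δ) : |(2:ℝ) ^ P * Real.log u + ng (2 ^ P) P U| ≤ 16000 + 2 * δ := by
  have a := ng_spec P U h1 h2
  have S0 : (0:ℝ) < 2 ^ P := by positivity
  have hv : (1:ℝ) / 2 ≤ U / 2 ^ P := by
    rw [div_le_div_iff₀ (by norm_num) S0]
    have : ((2 ^ P : ℕ) : ℝ) ≤ ((2 * U : ℕ) : ℝ) := by exact_mod_cast h1
    push_cast at this; linarith
  have b := log_lip hu hv
  have c : |u - U / 2 ^ P| * 2 ^ P ≤ δ := by
    rw [← abs_of_pos S0, ← abs_mul, abs_of_pos S0, sub_mul, div_mul_cancel₀ _ S0.ne']; exact h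
  have d : |(2:ℝ) ^ P * Real.log u - 2 ^ P * Real.log (U / 2 ^ P)| ≤ 2 * δ := by
    rw [← mul_sub, abs_mul, abs_of_pos S0]
    nlinarith
  have hPr : (P:ℝ) ≤ 5000 := by exact_mod_cast hP
  rw [abs_le] at *
  constructor <;> linarith [a.1, a.2, d.1, d.2]

/-- power in fixed point, rounded down (`c = 0`) or up (`c = 1`) -/
def pw (c S A : ℕ) : ℕ → ℕ → ℕ :=
  Nat.rec (fun _ => S) (fun _ ih k => Nat.rec (motive := fun _ => ℕ) S (fun k' _ =>
    force (ih (Nat.div (Nat.succ k') 2)) fun h =>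
    force (Nat.add (Nat.div (Nat.mul h h) S) c) fun s =>
    Nat.rec (motive := fun _ => ℕ) s (fun _ _ => Nat.add (Nat.div (Nat.mul s A) S) c) (Nat.mod (Nat.succ k') 2)) k)

lemma pw_step (c S A n k : ℕ) : pw c S A (n+1) (k+1) =
    if (k+1) % 2 = 0 then pw c S A n ((k+1)/2) * pw c S A n ((k+1)/2) / S + c
    else (pw c S A n ((k+1)/2) * pw c S A n ((k+1)/2) / S + c) * A / S + c := by
  have : pw c S A (n+1) (k+1) = force (pw c S A n (Nat.div (Nat.succ k) 2)) fun h =>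
    force (Nat.add (Nat.div (Nat.mul h h) S) c) fun s =>
    Nat.rec (motive := fun _ => ℕ) s (fun _ _ => Nat.add (Nat.div (Nat.mul s A) S) c) (Nat.mod (Nat.succ k) 2) := rfl
  rw [this, force_eq, force_eq]
  have h2 := Nat.mod_two_eq_zero_or_one (k+1)
  rcases h2 with h | h
  · rw [if_pos h]
    have : Nat.mod (Nat.succ k) 2 = 0 := h
    rw [this]; rfl
  · rw [if_neg (by omega)]
    have : Nat.mod (Nat.succ k) 2 = 1 := h
    rw [this]; rfl

lemma pw_lo (S A : ℕ) (hS : 0 < S) (x : ℝ) (h : (A:ℝ) ≤ S * x) (n : ℕ) : ∀ k, k < 2 ^ n → (pw 0 S A n k : ℝ) ≤ S * x ^ k := by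
  have S0 : (0:ℝ) < S := by exact_mod_cast hS
  have x0 : 0 ≤ x := by
    have : 0 ≤ S * x := le_trans (by positivity) h
    exact nonneg_of_mul_nonneg_right this S0
  induction n with
  | zero =>
    intro k hk
    have : k = 0 := by simpa using hk
    subst this
    have : pw 0 S A 0 0 = S := rfl
    rw [this]; simp
  | succ n ih =>
    intro k hk
    rcases k with _ | k
    · have : pw 0 S A (n+1) 0 = S := rfl
      rw [this]; simp
    · have i := ih ((k+1)/2) (by rw [pow_succ] at hk; omega)
      obtain ⟨h', hh⟩ : ∃ h', h' = pw 0 S A n ((k+1)/2) := ⟨_, rfl⟩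
      obtain ⟨j, hj⟩ : ∃ j, j = (k+1)/2 := ⟨_, rfl⟩
      rw [pw_step, ← hh]
      rw [← hh, ← hj] at i
      have sq : ((h' * h' / S + 0 : ℕ) : ℝ) ≤ S * x ^ (2 * j) := by
        rw [Nat.add_zero]
        calc ((h' * h' / S : ℕ) : ℝ) ≤ ((h' * h' : ℕ) : ℝ) / S := Nat.cast_div_le
          _ ≤ (S * x ^ j) * (S * x ^ j) / S := by push_cast; gcongr
          _ = S * x ^ (2 * j) := by field_simp; ring
      split_ifs with hp
      · have : k + 1 = 2 * j := by omega
        rw [this]; exact sq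
      · have : k + 1 = 2 * j + 1 := by omega
        rw [this]
        obtain ⟨s, hs⟩ : ∃ s, s = h' * h' / S + 0 := ⟨_, rfl⟩
        rw [← hs] at sq ⊢
        rw [Nat.add_zero]
        calc ((s * A / S : ℕ) : ℝ) ≤ ((s * A : ℕ) : ℝ) / S := Nat.cast_div_le
          _ ≤ (S * x ^ (2*j)) * (S * x) / S := by push_cast; gcongr
          _ = _ := by field_simp; ring

lemma le_div_add_one (a S : ℕ) (hS : 0 < S) : (a:ℝ) / S ≤ ((a / S + 1 : ℕ) : ℝ) := by
  have S0 : (0:ℝ) < S := by exact_mod_cast hS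
  rw [div_le_iff₀ S0]
  have := Nat.lt_mul_div_succ a hS
  rw [mul_comm] at this
  exact_mod_cast this.le

lemma pw_hi (S A : ℕ) (hS : 0 < S) (x : ℝ) (x0 : 0 ≤ x) (h : S * x ≤ (A:ℝ)) (n : ℕ) : ∀ k, k < 2 ^ n → S * x ^ k ≤ (pw 1 S A n k : ℝ) := by
  have S0 : (0:ℝ) < S := by exact_mod_cast hS
  induction n with
  | zero =>
    intro k hk
    have : k = 0 := by simpa using hk
    subst this
    have : pw 1 S A 0 0 = S := rfl
    rw [this]; simp
  | succ n ih =>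
    intro k hk
    rcases k with _ | k
    · have : pw 1 S A (n+1) 0 = S := rfl
      rw [this]; simp
    · have i := ih ((k+1)/2) (by rw [pow_succ] at hk; omega)
      obtain ⟨h', hh⟩ : ∃ h', h' = pw 1 S A n ((k+1)/2) := ⟨_, rfl⟩
      obtain ⟨j, hj⟩ : ∃ j, j = (k+1)/2 := ⟨_, rfl⟩
      rw [pw_step, ← hh]
      rw [← hh, ← hj] at i
      have sq : S * x ^ (2 * j) ≤ ((h' * h' / S + 1 : ℕ) : ℝ) := by
        calc S * x ^ (2 * j) = (S * x ^ j) * (S * x ^ j) / S := by field_simp; ring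
          _ ≤ ((h' * h' : ℕ) : ℝ) / S := by push_cast; gcongr
          _ ≤ _ := le_div_add_one _ S hS
      split_ifs with hp
      · have : k + 1 = 2 * j := by omega
        rw [this]; exact sq
      · have : k + 1 = 2 * j + 1 := by omega
        rw [this]
        obtain ⟨s, hs⟩ : ∃ s, s = h' * h' / S + 1 := ⟨_, rfl⟩
        rw [← hs] at sq ⊢
        calc S * x ^ (2 * j + 1) = (S * x ^ (2*j)) * (S * x) / S := by field_simp; ring
          _ ≤ ((s * A : ℕ) : ℝ) / S := by push_cast; gcongr
          _ ≤ _ := le_div_add_one _ S hS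

end TL

end

noncomputable section
namespace TL

def kand (b c : Bool) : Bool := Bool.rec (motive := fun _ => Bool) false c b

/-- continued fraction denominators -/
def cf (B : ℕ) : ℕ → ℕ → ℕ → ℕ → ℕ → ℕ :=
  Nat.rec (fun _ _ _ _ => 0) (fun _ ih r0 r1 q0 q1 =>
    Bool.rec (motive := fun _ => ℕ) (
     Nat.rec (motive := fun _ => ℕ) 0 (fun m _ => Nat.rec (motive := fun _ => ℕ) 0 (fun m2 _ =>
       ih r1 (Nat.succ m) q1 (Nat.succ m2)) (Nat.add (Nat.mul (Nat.div r0 r1) q1) q0)) (Nat.mod r0 r1)) q1 (Nat.ble B q1))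

def newton (S k : ℕ) : ℕ → ℕ → ℕ :=
  Nat.rec (fun e => e) (fun _ ih e =>
    force (Nat.sub (Nat.mul 2 S) e) fun A =>
    force (Nat.div (Nat.mul S S) (pw 0 S A 12 k)) fun w =>
    force (Nat.div (Nat.mul (Nat.mul k w) S) A) fun ρ =>
    force (Nat.div (Nat.sub (Nat.mul w S) (Nat.mul e ρ)) (Nat.sub S ρ)) ih)

def nm (S k A : ℕ) : ℕ := Nat.mul (Nat.mul 3 A) (Nat.sub (Nat.mul (Nat.succ k) A) (Nat.mul (Nat.mul 2 k) S))
def dn (S A : ℕ) : ℕ := Nat.mul (Nat.mul 4 (Nat.sub (Nat.mul 2 A) S)) (Nat.sub A S)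

def withK (P S l2 k : ℕ) (F : ℕ → ℕ → ℕ → ℕ → ℕ → ℕ → Bool) : Bool :=
  force (Nat.sub (Nat.mul 2 S) (newton S k 14 (Nat.div S (Nat.pow 2 k)))) fun A =>
  force (Nat.sub A 1024) fun Alo =>
  force (Nat.add A 1024) fun Ahi =>
  kand (Nat.ble (Nat.succ S) Alo) <|
  kand (Nat.ble Ahi (Nat.mul 2 S)) <|
  kand (Nat.ble (Nat.mul S S) (Nat.mul (pw 0 S Alo 12 k) (Nat.sub (Nat.mul 2 S) Alo))) <|
  kand (Nat.ble (Nat.mul (pw 1 S Ahi 12 k) (Nat.sub (Nat.mul 2 S) Ahi)) (Nat.mul S S)) <|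
  kand (Nat.ble (Nat.mul (Nat.mul 2 k) S) (Nat.mul (Nat.succ k) Alo)) <|
  force (Nat.div (Nat.mul S (nm S k Alo)) (dn S Ahi)) fun rlo =>
  force (Nat.succ (Nat.div (Nat.mul S (nm S k Ahi)) (dn S Alo))) fun rhi =>
  kand (Nat.ble rhi (Nat.add rlo 1073741824)) <|
  kand (Nat.ble S (Nat.mul 2 rlo)) <|
  kand (Nat.ble rlo S) <|
  force (ng S P (Nat.div A 2)) fun gA =>
  kand (Nat.ble gA l2) <|
  force (Nat.sub l2 gA) fun LA =>
  force (ng S P rlo) fun gf => F Alo Ahi LA rlo rhi gf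

/-- total error -/
def errb (S T LA q p NB E Plo : ℕ) : ℕ :=
  Nat.succ (Nat.add (Nat.add (Nat.mul q E)
    (Nat.mul NB (Nat.add (Nat.mul (Nat.mul 3 q) E) (Nat.add (Nat.sub (Nat.mul q LA) (Nat.mul p T)) (Nat.sub (Nat.mul p T) (Nat.mul q LA))))))
    (Nat.div (Nat.mul (Nat.mul 50 q) (Nat.mul S S)) Plo))

def redA (T q er M la : ℕ) : Bool :=
  kand (Nat.ble la M) <|
  force (Nat.mod (Nat.mul q (Nat.sub M la)) T) fun r => kand (Nat.ble (Nat.succ er) r) (Nat.ble (Nat.succ (Nat.add er r)) T)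

def allA (l2 l3 l5 l7 T q er M k : ℕ) : Bool :=
  kand (redA T q er M 0) <| kand (redA T q er M l2) <| kand (redA T q er M l3) <| kand (redA T q er M (Nat.mul 2 l2)) <|
  kand (redA T q er M l5) <| kand (redA T q er M (Nat.add l2 l3)) <| kand (redA T q er M l7) <| kand (redA T q er M (Nat.mul 3 l2)) <|
  Bool.rec (motive := fun _ => Bool) (redA T q er M (Nat.mul 2 l3)) true (Nat.beq k 2)

def withC (P : ℕ) (F : ℕ → ℕ → ℕ → ℕ → ℕ → ℕ → Bool) : Bool :=
  force (Nat.pow 2 P) fun S =>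
  force (ng S P (Nat.sub S (Nat.div S 10))) fun a =>
  force (ng S P (Nat.sub S (Nat.div S 25))) fun b =>
  force (ng S P (Nat.sub S (Nat.div S 81))) fun c =>
  force (ng S P (Nat.sub S (Nat.div S 126))) fun e =>
  force (Nat.add (Nat.mul 7 a) (Nat.mul 3 c)) fun x2 =>
  force (Nat.add (Nat.mul 11 a) (Nat.mul 5 c)) fun x3 =>
  force (Nat.add (Nat.mul 16 a) (Nat.mul 7 c)) fun x5 =>
  kand (Nat.ble (Nat.mul 2 b) x2) <|
  kand (Nat.ble (Nat.mul 3 b) x3) <|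
  kand (Nat.ble (Nat.mul 4 b) x5) <|
  force (Nat.sub x2 (Nat.mul 2 b)) fun l2 =>
  force (Nat.sub x3 (Nat.mul 3 b)) fun l3 =>
  force (Nat.sub x5 (Nat.mul 4 b)) fun l5 =>
  kand (Nat.ble (Nat.add l2 (Nat.mul 2 l3)) (Nat.add e (Nat.mul 3 l5))) <|
  force (Nat.sub (Nat.add e (Nat.mul 3 l5)) (Nat.add l2 (Nat.mul 2 l3))) fun l7 =>
  force (Nat.add l2 l5) fun T => F S l2 l3 l5 l7 T

def withM (l2 l3 T gf : ℕ) (F : ℕ → Bool) : Bool :=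
  force (Nat.add (Nat.add (Nat.mul 3 T) (Nat.mul 5 l3)) (Nat.mul 3 gf)) fun M1 =>
  kand (Nat.ble (Nat.mul 6 l2) M1) <|
  force (Nat.sub M1 (Nat.mul 6 l2)) F

/-- find a denominator and its error bound -/
def withQ (T LA B : ℕ) (F : ℕ → ℕ → Bool) : Bool :=
  force (cf B 4000 T LA 0 1) fun q =>
  force (Nat.div (Nat.add (Nat.mul q LA) (Nat.div T 2)) T) fun p =>
  kand (Nat.ble p q) <| F q p

def EE : ℕ := 18446744073709551616

def loopK (f : ℕ → Bool) : ℕ → ℕ → Bool :=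
  Nat.rec (fun _ => true) (fun _ ih k => kand (f k) (force (Nat.succ k) ih))

def run1 (k0 cnt : ℕ) : Bool :=
  withC 4300 fun S l2 l3 l5 l7 T =>
  loopK (fun k => withK 4300 S l2 k fun Alo _ LA _ _ gf =>
    withM l2 l3 T gf fun M =>
    withQ T LA (Nat.pow 10 626) fun q p =>
    force (errb S T LA q p (Nat.pow 2 2032) EE (pw 0 S Alo 12 3200)) fun er =>
    allA l2 l3 l5 l7 T q er M k) cnt k0

def l2f (k : ℕ) : ℕ := Bool.rec (motive := fun _ => ℕ) (Bool.rec (motive := fun _ => ℕ) (Bool.rec (motive := fun _ => ℕ) 1200 950 (Nat.ble 3 k)) 880 (Nat.ble 4 k)) 820 (Nat.ble 8 k)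

def rv : List ℕ → List ℕ → List ℕ := List.rec (fun acc => acc) (fun y _ ih acc => ih (y :: acc))

def pop (front back : List ℕ) (F : ℕ → List ℕ → List ℕ → Bool) : Bool :=
  List.rec (motive := fun _ => Bool) (List.rec (motive := fun _ => Bool) false (fun x xs _ => F x xs []) (rv back []))
    (fun x xs _ => F x xs back) front

/-- the list of `L_j + j`, starting from `x = L_j + j` -/
def pows : ℕ → ℕ → ℕ → List ℕ := Nat.rec (fun _ _ => []) (fun _ ih x j => x ::
  force (Nat.sub (Nat.succ (Nat.mul 2 x)) j) fun x' => force (Nat.succ j) fun j' => ih x' j')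

/-- stage B check for one index -/
def chkB (P S l2 l3 l5 l7 T Gc q er Alo Ahi rlo rhi M k l L : ℕ) : Bool :=
  force (Nat.div (Nat.mul (Nat.mul (Nat.mul 4 L) rlo) S) (Nat.mul 3 (pw 1 S Ahi 12 l))) fun blo =>
  kand (Nat.ble (Nat.succ (Nat.div (Nat.mul (Nat.mul (Nat.mul 4 L) rhi) S) (Nat.mul 3 (pw 0 S Alo 12 l)))) (Nat.add blo 1099511627776)) <|
  force (Nat.sub blo (Nat.div blo (Nat.pow 2 200))) fun b =>
  kand (Nat.ble b S) <| kand (Nat.ble S (Nat.mul 2 b)) <|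
  force (ng S P b) fun g =>
  kand (Nat.ble g (Nat.add M Gc)) <|
  force (Nat.sub (Nat.add M Gc) g) fun M' => allA l2 l3 l5 l7 T q er M' k

/-- the numbers are stored as `L_n + n` -/
def stB (f : ℕ → ℕ → Bool) (k1 : ℕ) : ℕ → ℕ → ℕ → List ℕ → List ℕ → Bool :=
  Nat.rec (fun _ _ _ _ => true) (fun _ ih n Y front back =>
    pop front back fun x front' back' =>
    force (Nat.sub (Nat.mul 2 Y) (Nat.add x k1)) fun Y' =>
    force (Nat.succ n) fun n' =>
    kand (Bool.rec (motive := fun _ => Bool) true (Nat.rec (motive := fun _ => Bool) true (fun _ _ => f n' (Nat.sub Y' n')) (Nat.mod (Nat.sub Y' n') 16)) (Nat.ble 301 n'))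
      (ih n' Y' front' (Y' :: back')))

def run2 (k0 cnt : ℕ) : Bool :=
  withC 1650 fun S l2 l3 l5 l7 T =>
  force (ng S 1650 (Nat.sub S (Nat.pow 2 1450))) fun Gc =>
  loopK (fun k => withK 1650 S l2 k fun Alo Ahi LA rlo rhi gf =>
    withM l2 l3 T gf fun M =>
    kand (withQ T LA (Nat.pow 10 (Bool.rec (motive := fun _ => ℕ) 75 56 (Nat.beq k 2))) fun q p =>
      force (errb S T LA q p (Nat.pow 2 (Bool.rec (motive := fun _ => ℕ) 228 162 (Nat.beq k 2))) EE (pw 0 S Alo 12 301)) fun er =>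
      allA l2 l3 l5 l7 T q er M k) <|
    withQ T LA (Nat.pow 10 231) fun q p =>
    kand (force (errb S T LA q p (Nat.pow 2 724) EE (pw 0 S Alo 12 (l2f k))) fun er =>
      allA l2 l3 l5 l7 T q er M k) <|
    force (errb S T LA q p (Nat.pow 2 724) EE (pw 0 S Alo 12 3200)) fun er =>
    force (Nat.add (Nat.mul 3 (Nat.pow 2 (Nat.sub k 2))) k) fun Y =>
    stB (fun l L => chkB 1650 S l2 l3 l5 l7 T Gc q er Alo Ahi rlo rhi M k l L) (Nat.pred k) (Nat.sub (l2f k) k) k Y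
      (2 :: 2 :: pows (Nat.pred k) 5 2) []) cnt k0

end TL

end

noncomputable section
namespace TL

lemma kand_elim {b c : Bool} (h : kand b c = true) : b = true ∧ c = true := by
  cases b
  · exact absurd h (by simp [kand])
  · exact ⟨rfl, h⟩

lemma kle {a b : ℕ} {c : Bool} (h : kand (Nat.ble a b) c = true) : a ≤ b ∧ c = true :=
  ⟨Nat.le_of_ble_eq_true (kand_elim h).1, (kand_elim h).2⟩

lemma force_elim {n : ℕ} {f : ℕ → Bool} (h : force n f = true) : ∃ x, x = n ∧ f x = true :=
  ⟨n, rfl, by rwa [force_eq] at h⟩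

lemma ng_apx' (S P U : ℕ) (hS : S = 2 ^ P) (hP : P ≤ 5000) (h1 : S ≤ 2 * U) (h2 : U ≤ S) (u δ : ℝ) (hu : 1 / 2 ≤ u)
    (h : |u * S - U| ≤ δ) : |(S:ℝ) * Real.log u + ng S P U| ≤ 16000 + 2 * δ := by
  have e : (S:ℝ) = 2 ^ P := by rw [hS]; push_cast; rfl
  rw [e] at h ⊢
  rw [hS] at h1 h2 ⊢
  exact ng_apx P U hP h1 h2 u δ hu h

lemma ng_const (S P x : ℕ) (hS : S = 2 ^ P) (hP : P ≤ 5000) (hx : 2 ≤ x) :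
    |(S:ℝ) * Real.log (1 - 1 / x) + ng S P (Nat.sub S (Nat.div S x))| ≤ 16002 := by
  have h0 : S / x ≤ S / 2 := Nat.div_le_div_left hx (by norm_num)
  have h1 : Nat.sub S (Nat.div S x) = S - S / x := rfl
  have hx' : (2:ℝ) ≤ x := by exact_mod_cast hx
  rw [h1]
  have hle : S / x ≤ S := Nat.div_le_self _ _
  refine (ng_apx' S P (S - S / x) hS hP (by generalize S / x = y at *; omega) (Nat.sub_le _ _) (1 - 1 / x) 1 ?_ ?_).trans (by norm_num)
  · have : (1:ℝ) / x ≤ 1 / 2 := one_div_le_one_div_of_le (by norm_num) hx'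
    linarith
  · rw [Nat.cast_sub hle]
    have a := Nat.div_add_mod S x
    have b := Nat.mod_lt S (show 0 < x by omega)
    have a' : (x:ℝ) * ((S / x : ℕ):ℝ) + ((S % x : ℕ) : ℝ) = S := by exact_mod_cast a
    have b' : ((S % x : ℕ) : ℝ) < x := by exact_mod_cast b
    have x0 : (0:ℝ) < x := by linarith
    have : (1 - 1 / (x:ℝ)) * S - (S - ((S / x : ℕ):ℝ)) = - (((S % x : ℕ) : ℝ) / x) := by
      field_simp
      linear_combination a'
    rw [this, abs_neg, abs_of_nonneg (by positivity), div_le_one x0]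
    exact b'.le

/-- the error bound for the constants -/
def W : ℝ := 4194304

lemma withC_sound (P : ℕ) (hP : P ≤ 5000) (F : ℕ → ℕ → ℕ → ℕ → ℕ → ℕ → Bool) (h : withC P F = true) :
    ∃ S l2 l3 l5 l7 T : ℕ, S = 2 ^ P ∧ |Real.log 2 * S - l2| ≤ W ∧ |Real.log 3 * S - l3| ≤ W ∧ |Real.log 5 * S - l5| ≤ W ∧
      |Real.log 7 * S - l7| ≤ W ∧ |Real.log 10 * S - T| ≤ W ∧ F S l2 l3 l5 l7 T = true := by
  unfold withC at h
  obtain ⟨S, hS, h⟩ := force_elim h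
  obtain ⟨a, ha, h⟩ := force_elim h
  obtain ⟨b, hb, h⟩ := force_elim h
  obtain ⟨c, hc, h⟩ := force_elim h
  obtain ⟨e, he, h⟩ := force_elim h
  obtain ⟨x2, hx2, h⟩ := force_elim h
  obtain ⟨x3, hx3, h⟩ := force_elim h
  obtain ⟨x5, hx5, h⟩ := force_elim h
  obtain ⟨g2, h⟩ := kle h
  obtain ⟨g3, h⟩ := kle h
  obtain ⟨g5, h⟩ := kle h
  obtain ⟨l2, hl2, h⟩ := force_elim h
  obtain ⟨l3, hl3, h⟩ := force_elim h
  obtain ⟨l5, hl5, h⟩ := force_elim h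
  obtain ⟨g7, h⟩ := kle h
  obtain ⟨l7, hl7, h⟩ := force_elim h
  obtain ⟨T, hT, h⟩ := force_elim h
  simp only [Nat.add_eq, Nat.mul_eq, Nat.sub_eq] at hx2 hx3 hx5 g2 g3 g5 hl2 hl3 hl5 g7 hl7 hT
  have ca := ng_const S P 10 hS hP (by norm_num)
  have cb := ng_const S P 25 hS hP (by norm_num)
  have cc := ng_const S P 81 hS hP (by norm_num)
  have ce := ng_const S P 126 hS hP (by norm_num)
  rw [← ha] at ca
  rw [← hb] at cb
  rw [← hc] at cc
  rw [← he] at ce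
  clear ha hb hc he
  have r2 : (l2:ℝ) = 7 * a + 3 * c - 2 * b := by
    have : l2 + 2 * b = 7 * a + 3 * c := by omega
    have : (l2:ℝ) + 2 * b = 7 * a + 3 * c := by exact_mod_cast this
    linarith
  have r3 : (l3:ℝ) = 11 * a + 5 * c - 3 * b := by
    have : l3 + 3 * b = 11 * a + 5 * c := by omega
    have : (l3:ℝ) + 3 * b = 11 * a + 5 * c := by exact_mod_cast this
    linarith
  have r5 : (l5:ℝ) = 16 * a + 7 * c - 4 * b := by
    have : l5 + 4 * b = 16 * a + 7 * c := by omega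
    have : (l5:ℝ) + 4 * b = 16 * a + 7 * c := by exact_mod_cast this
    linarith
  have r7 : (l7:ℝ) = e + 3 * l5 - l2 - 2 * l3 := by
    have : l7 + l2 + 2 * l3 = e + 3 * l5 := by omega
    have : (l7:ℝ) + l2 + 2 * l3 = e + 3 * l5 := by exact_mod_cast this
    linarith
  have rT : (T:ℝ) = l2 + l5 := by rw [hT]; push_cast; rfl
  have m10 : Real.log 10 = Real.log 2 + Real.log 5 := by
    rw [← Real.log_mul (by norm_num) (by norm_num)]; norm_num
  have q1 : Real.log (1 - 1 / ((10:ℕ):ℝ)) = 2 * Real.log 3 - Real.log 2 - Real.log 5 := by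
    have : (1 - 1 / ((10:ℕ):ℝ)) = 3 ^ 2 / (2 * 5) := by norm_num
    rw [this, Real.log_div (by norm_num) (by norm_num), Real.log_mul (by norm_num) (by norm_num), Real.log_pow]
    push_cast; ring
  have q2 : Real.log (1 - 1 / ((25:ℕ):ℝ)) = 3 * Real.log 2 + Real.log 3 - 2 * Real.log 5 := by
    have : (1 - 1 / ((25:ℕ):ℝ)) = 2 ^ 3 * 3 / 5 ^ 2 := by norm_num
    rw [this, Real.log_div (by norm_num) (by norm_num), Real.log_mul (by norm_num) (by norm_num), Real.log_pow, Real.log_pow]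
    push_cast; ring
  have q3 : Real.log (1 - 1 / ((81:ℕ):ℝ)) = 4 * Real.log 2 + Real.log 5 - 4 * Real.log 3 := by
    have : (1 - 1 / ((81:ℕ):ℝ)) = 2 ^ 4 * 5 / 3 ^ 4 := by norm_num
    rw [this, Real.log_div (by norm_num) (by norm_num), Real.log_mul (by norm_num) (by norm_num), Real.log_pow, Real.log_pow]
    push_cast; ring
  have q4 : Real.log (1 - 1 / ((126:ℕ):ℝ)) = 3 * Real.log 5 - Real.log 2 - 2 * Real.log 3 - Real.log 7 := by
    have : (1 - 1 / ((126:ℕ):ℝ)) = 5 ^ 3 / (2 * 3 ^ 2 * 7) := by norm_num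
    rw [this, Real.log_div (by norm_num) (by norm_num), Real.log_mul (by norm_num) (by norm_num),
      Real.log_mul (by norm_num) (by norm_num), Real.log_pow, Real.log_pow]
    push_cast; ring
  rw [q1] at ca
  rw [q2] at cb
  rw [q3] at cc
  rw [q4] at ce
  rw [abs_le] at ca cb cc ce
  refine ⟨S, l2, l3, l5, l7, T, hS, ?_, ?_, ?_, ?_, ?_, h⟩
  all_goals
    try rw [m10]
    rw [abs_le, W]
    constructor <;> linarith [ca.1, ca.2, cb.1, cb.2, cc.1, cc.2, ce.1, ce.2]

end TL

end

noncomputable section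
namespace TL

lemma geom_inv (x : ℝ) (hx : 1 < x) (k : ℕ) : (∑ j ∈ Finset.range k, (x⁻¹) ^ (j + 1)) * (x - 1) = 1 - (x⁻¹) ^ k := by
  induction k with
  | zero => simp
  | succ n ih =>
    rw [Finset.sum_range_succ, add_mul, ih]
    have : x * x⁻¹ = 1 := mul_inv_cancel₀ (by linarith)
    linear_combination (x⁻¹) ^ n * this

lemma Root.cmp_gt {k : ℕ} {α x : ℝ} (h : Root k α) (hx : α < x) : x ^ k * (2 - x) < 1 := by
  have h1 := h.lo
  have x1 : 1 < x := by linarith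
  have g := geom_inv x x1 k
  have hs : ∑ j ∈ Finset.range k, (x⁻¹) ^ (j + 1) < ∑ j ∈ Finset.range k, (α⁻¹) ^ (j + 1) := by
    apply Finset.sum_lt_sum_of_nonempty
    · rw [Finset.nonempty_range_iff]; have := h.hk; omega
    · intro j _
      exact pow_lt_pow_left₀ (inv_strictAnti₀ (by linarith) hx) (by positivity) (by omega)
  rw [h.sum_inv] at hs
  have : 1 - (x⁻¹) ^ k < 1 * (x - 1) := by rw [← g]; exact mul_lt_mul_of_pos_right hs (by linarith)
  have h2 : 2 - x < (x⁻¹) ^ k := by linarith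
  have p : 0 < x ^ k := by positivity
  calc x ^ k * (2 - x) < x ^ k * (x⁻¹) ^ k := mul_lt_mul_of_pos_left h2 p
    _ = 1 := by rw [← mul_pow, mul_inv_cancel₀ (by linarith), one_pow]

lemma Root.cmp_lt {k : ℕ} {α x : ℝ} (h : Root k α) (x1 : 1 < x) (hx : x < α) : 1 < x ^ k * (2 - x) := by
  have g := geom_inv x x1 k
  have hs : ∑ j ∈ Finset.range k, (α⁻¹) ^ (j + 1) < ∑ j ∈ Finset.range k, (x⁻¹) ^ (j + 1) := by
    apply Finset.sum_lt_sum_of_nonempty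
    · rw [Finset.nonempty_range_iff]; have := h.hk; omega
    · intro j _
      exact pow_lt_pow_left₀ (inv_strictAnti₀ (by linarith) hx) (by have := h.lo; positivity) (by omega)
  rw [h.sum_inv] at hs
  have : 1 * (x - 1) < 1 - (x⁻¹) ^ k := by rw [← g]; exact mul_lt_mul_of_pos_right hs (by linarith)
  have h2 : (x⁻¹) ^ k < 2 - x := by linarith
  have p : 0 < x ^ k := by positivity
  calc 1 = x ^ k * (x⁻¹) ^ k := by rw [← mul_pow, mul_inv_cancel₀ (by linarith), one_pow]
    _ < x ^ k * (2 - x) := mul_lt_mul_of_pos_left h2 p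

/-- `fK = (3/4) / rK` -/
def rK (k : ℕ) (α : ℝ) : ℝ := (3 * α * ((k + 1) * α - 2 * k)) / (4 * (2 * α - 1) * (α - 1))

lemma Root.rK_pos {k : ℕ} {α : ℝ} (h : Root k α) : 0 < rK k α := by
  have h1 := h.lo
  have h2 := h.del_pos
  unfold rK
  have : 0 < 2 * α - 1 := by linarith
  have : 0 < α - 1 := by linarith
  positivity

lemma Root.fK_eq {k : ℕ} {α : ℝ} (h : Root k α) : fK k α = 3 / (4 * rK k α) := by
  have h1 := h.lo
  have h2 := h.del_pos
  have : 2 * α - 1 ≠ 0 := by linarith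
  have : α - 1 ≠ 0 := by linarith
  have : (k + 1) * α - 2 * k ≠ 0 := by linarith
  have : α ≠ 0 := by linarith
  unfold rK fK
  field_simp

lemma Root.log_f {k : ℕ} {α : ℝ} (h : Root k α) : Real.log (fK k α) = Real.log 3 - 2 * Real.log 2 - Real.log (rK k α) := by
  have := h.rK_pos
  rw [h.fK_eq, Real.log_div (by norm_num) (by positivity), Real.log_mul (by norm_num) (by positivity)]
  have : Real.log 4 = 2 * Real.log 2 := by
    rw [show (4:ℝ) = 2 ^ 2 by norm_num, Real.log_pow]; push_cast; ring
  rw [this]; ring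

/-- what is known about the numbers computed for `k` -/
structure KD (P S k : ℕ) (α : ℝ) (Alo Ahi LA rlo rhi gf : ℕ) : Prop where
  a1 : (Alo:ℝ) ≤ S * α
  a2 : S * α ≤ Ahi
  a0 : S < Alo
  la : |Real.log α * S - LA| ≤ 2 ^ 24
  r1 : (rlo:ℝ) ≤ S * rK k α
  r2 : S * rK k α ≤ rhi
  rr : rhi ≤ rlo + 2 ^ 30
  rS : S ≤ 2 * rlo
  rS' : rlo ≤ S
  gf : |Real.log (rK k α) * S + gf| ≤ 2 ^ 33

set_option maxHeartbeats 2000000 in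
lemma withK_core {P S l2 k : ℕ} {α : ℝ} (hP : P ≤ 5000) (hS : S = 2 ^ P) (hl2 : |Real.log 2 * S - l2| ≤ W) (h : Root k α)
    (hk : k < 4096) {Alo Ahi LA rlo rhi gf : ℕ} (A gA : ℕ) (hAlo : Alo = A - 1024) (hAhi : Ahi = A + 1024)
    (c1 : S + 1 ≤ Alo) (c2 : Ahi ≤ 2 * S) (c3 : S * S ≤ pw 0 S Alo 12 k * (2 * S - Alo))
    (c4 : pw 1 S Ahi 12 k * (2 * S - Ahi) ≤ S * S) (c5 : 2 * k * S ≤ (k + 1) * Alo)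
    (hrlo : rlo = (S * (3 * Alo * ((k + 1) * Alo - 2 * k * S))) / (4 * (2 * Ahi - S) * (Ahi - S)))
    (hrhi : rhi = (S * (3 * Ahi * ((k + 1) * Ahi - 2 * k * S))) / (4 * (2 * Alo - S) * (Alo - S)) + 1)
    (c6 : rhi ≤ rlo + 1073741824) (c7 : S ≤ 2 * rlo) (c8 : rlo ≤ S) (hgA : gA = ng S P (A / 2)) (c9 : gA ≤ l2)
    (hLA : LA = l2 - gA) (hgf : gf = ng S P rlo) : KD P S k α Alo Ahi LA rlo rhi gf := by
  obtain ⟨Q, hQ⟩ : ∃ Q : ℕ, Q = 1073741824 := ⟨_, rfl⟩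
  obtain ⟨C, hC⟩ : ∃ C : ℕ, C = 1024 := ⟨_, rfl⟩
  rw [← hQ] at c6
  rw [← hC] at hAlo hAhi
  have k12 : k < 2 ^ 12 := by simpa using hk
  clear hk
  have S0 : 0 < S := by rw [hS]; exact Nat.pow_pos (by norm_num)
  have S0' : (0:ℝ) < S := by exact_mod_cast S0
  have α1 := h.lo
  have α2 := h.hi
  have hlo2 : Alo ≤ 2 * S := by omega
  have b1 : (S:ℝ) + 1 ≤ Alo := by exact_mod_cast c1
  have b2 : (Ahi:ℝ) ≤ 2 * S := by exact_mod_cast c2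
  have b3 : (Alo:ℝ) ≤ Ahi := by exact_mod_cast (by omega : Alo ≤ Ahi)
  have a1 : (Alo:ℝ) ≤ S * α := by
    by_contra hc
    push Not at hc
    have hx : α < Alo / S := by rw [lt_div_iff₀ S0']; linarith
    have h1 := h.cmp_gt hx
    have h2 := pw_lo S Alo S0 (Alo / S) (by rw [mul_div_cancel₀ _ S0'.ne']) 12 k k12
    have h3 : (S:ℝ) * S ≤ (pw 0 S Alo 12 k : ℝ) * (2 * S - Alo) := by
      have : ((S * S : ℕ):ℝ) ≤ ((pw 0 S Alo 12 k * (2 * S - Alo) : ℕ) : ℝ) := by exact_mod_cast c3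
      push_cast [Nat.cast_sub hlo2] at this
      exact this
    have h4 : (pw 0 S Alo 12 k : ℝ) * (2 * S - Alo) ≤ S * (Alo / S) ^ k * (2 * S - Alo) :=
      mul_le_mul_of_nonneg_right h2 (by linarith)
    have h5 : S * ((Alo:ℝ) / S) ^ k * (2 * S - Alo) = S * S * ((Alo / S) ^ k * (2 - Alo / S)) := by field_simp
    have h6 : (S:ℝ) * S * ((Alo / S) ^ k * (2 - Alo / S)) < S * S * 1 := mul_lt_mul_of_pos_left h1 (by positivity)
    linarith
  have a2 : S * α ≤ Ahi := by
    by_contra hc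
    push Not at hc
    have hx : Ahi / S < α := by rw [div_lt_iff₀ S0']; linarith
    have hx1 : (1:ℝ) < Ahi / S := by rw [lt_div_iff₀ S0']; linarith
    have h1 := h.cmp_lt hx1 hx
    have h2 := pw_hi S Ahi S0 (Ahi / S) (by positivity) (by rw [mul_div_cancel₀ _ S0'.ne']) 12 k k12
    have h3 : (pw 1 S Ahi 12 k : ℝ) * (2 * S - Ahi) ≤ (S:ℝ) * S := by
      have : ((pw 1 S Ahi 12 k * (2 * S - Ahi) : ℕ) : ℝ) ≤ ((S * S : ℕ):ℝ) := by exact_mod_cast c4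
      push_cast [Nat.cast_sub c2] at this
      exact this
    have h4 : S * (Ahi / S) ^ k * (2 * S - Ahi) ≤ (pw 1 S Ahi 12 k : ℝ) * (2 * S - Ahi) :=
      mul_le_mul_of_nonneg_right h2 (by linarith)
    have h5 : S * ((Ahi:ℝ) / S) ^ k * (2 * S - Ahi) = S * S * ((Ahi / S) ^ k * (2 - Ahi / S)) := by field_simp
    have h6 : (S:ℝ) * S * 1 < S * S * ((Ahi / S) ^ k * (2 - Ahi / S)) := mul_lt_mul_of_pos_left h1 (by positivity)
    linarith
  clear c3 c4
  -- the ratio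
  have k0 : (0:ℝ) ≤ k := by positivity
  have c5' : 2 * (k:ℝ) * S ≤ (k + 1) * Alo := by exact_mod_cast c5
  have c5h : 2 * k * S ≤ (k + 1) * Ahi := c5.trans (Nat.mul_le_mul_left _ (by omega))
  have eN : ∀ y : ℝ, (k + 1) * (y:ℝ) - 2 * k * S = (k+1) * y - 2 * k * S := fun y => rfl
  have nlo : ((3 * Alo * ((k + 1) * Alo - 2 * k * S) : ℕ) : ℝ) = 3 * Alo * ((k + 1) * Alo - 2 * k * S) := by
    push_cast [Nat.cast_sub c5]; ring
  have nhi : ((3 * Ahi * ((k + 1) * Ahi - 2 * k * S) : ℕ) : ℝ) = 3 * Ahi * ((k + 1) * Ahi - 2 * k * S) := by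
    push_cast [Nat.cast_sub c5h]; ring
  have dlo : ((4 * (2 * Alo - S) * (Alo - S) : ℕ) : ℝ) = 4 * (2 * Alo - S) * (Alo - S) := by
    push_cast [Nat.cast_sub (show S ≤ 2 * Alo by omega), Nat.cast_sub (show S ≤ Alo by omega)]; ring
  have dhi : ((4 * (2 * Ahi - S) * (Ahi - S) : ℕ) : ℝ) = 4 * (2 * Ahi - S) * (Ahi - S) := by
    push_cast [Nat.cast_sub (show S ≤ 2 * Ahi by omega), Nat.cast_sub (show S ≤ Ahi by omega)]; ring
  obtain ⟨y, hy⟩ : ∃ y, y = S * α := ⟨_, rfl⟩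
  have α1' : α - 1 ≠ 0 := by linarith
  have α2' : 2 * α - 1 ≠ 0 := by linarith
  have hr : S * rK k α = S * (3 * y * ((k + 1) * y - 2 * k * S)) / (4 * (2 * y - S) * (y - S)) := by
    have e1 : 2 * y - S = S * (2 * α - 1) := by rw [hy]; ring
    have e2 : y - S = S * (α - 1) := by rw [hy]; ring
    have e3 : (k + 1) * y - 2 * k * S = S * ((k+1) * α - 2 * k) := by rw [hy]; ring
    rw [e1, e2, e3, hy, rK]
    field_simp
  rw [← hy] at a1 a2
  have y1 : (S:ℝ) + 1 ≤ y := b1.trans a1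
  have hdpos : 0 < 4 * (2 * y - S) * (y - S) := by
    have : 0 < 2 * y - S := by linarith
    have : 0 < y - S := by linarith
    positivity
  have n0 : 0 ≤ (k + 1) * (Alo:ℝ) - 2 * k * S := by linarith
  have n1 : (k + 1) * (Alo:ℝ) - 2 * k * S ≤ (k + 1) * y - 2 * k * S := by
    have := mul_le_mul_of_nonneg_left a1 (show (0:ℝ) ≤ k + 1 by positivity); linarith
  have n2 : (k + 1) * y - 2 * k * S ≤ (k + 1) * (Ahi:ℝ) - 2 * k * S := by
    have := mul_le_mul_of_nonneg_left a2 (show (0:ℝ) ≤ k + 1 by positivity); linarith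
  have r1 : (rlo:ℝ) ≤ S * rK k α := by
    have : (rlo:ℝ) ≤ ((S * (3 * Alo * ((k + 1) * Alo - 2 * k * S)) : ℕ) : ℝ) / ((4 * (2 * Ahi - S) * (Ahi - S) : ℕ) : ℝ) := by
      rw [hrlo]; exact Nat.cast_div_le
    refine this.trans ?_
    rw [Nat.cast_mul, nlo, dhi, hr]
    have d1 : 4 * (2 * y - S) * (y - S) ≤ 4 * (2 * Ahi - S) * (Ahi - S) := by
      apply mul_le_mul (by linarith) (by linarith) (by linarith) (by linarith)
    apply div_le_div₀ (mul_nonneg S0'.le (mul_nonneg (by linarith) (n0.trans n1))) _ hdpos d1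
    apply mul_le_mul_of_nonneg_left _ S0'.le
    apply mul_le_mul (by linarith) n1 n0 (by linarith)
  have r2 : S * rK k α ≤ rhi := by
    have := le_div_add_one (S * (3 * Ahi * ((k + 1) * Ahi - 2 * k * S))) (4 * (2 * Alo - S) * (Alo - S)) (by
      apply Nat.mul_pos (by omega) (by omega))
    have e : S * (3 * Ahi * ((k + 1) * Ahi - 2 * k * S)) / (4 * (2 * Alo - S) * (Alo - S)) + 1 = rhi := hrhi.symm
    rw [e] at this
    refine le_trans ?_ this
    rw [Nat.cast_mul, nhi, dlo, hr]
    have d1 : 4 * (2 * (Alo:ℝ) - S) * (Alo - S) ≤ 4 * (2 * y - S) * (y - S) := by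
      apply mul_le_mul (by linarith) (by linarith) (by linarith) (by linarith)
    have d0 : 0 < 4 * (2 * (Alo:ℝ) - S) * (Alo - S) := by
      have : 0 < 2 * (Alo:ℝ) - S := by linarith
      have : 0 < (Alo:ℝ) - S := by linarith
      positivity
    apply div_le_div₀ (mul_nonneg S0'.le (mul_nonneg (by linarith) (n0.trans (n1.trans n2)))) _ d0 d1
    apply mul_le_mul_of_nonneg_left _ S0'.le
    apply mul_le_mul (by linarith) n2 (n0.trans n1) (by linarith)
  clear hrlo hrhi nlo nhi dlo dhi hr n0 n1 n2 hdpos eN c5 c5' c5h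
  have rr : (rhi:ℝ) ≤ rlo + 2 ^ 30 := by
    have : (rhi:ℝ) ≤ rlo + Q := by exact_mod_cast c6
    rw [hQ] at this
    norm_num at this ⊢
    linarith
  have rS : (S:ℝ) ≤ 2 * rlo := by exact_mod_cast c7
  -- the logarithms
  have hf := ng_apx' S P rlo hS hP c7 c8 (rK k α) (2 ^ 30) (by
      have : (S:ℝ) ≤ 2 * (S * rK k α) := by linarith
      have : (S:ℝ) * 1 ≤ S * (2 * rK k α) := by linarith
      have := le_of_mul_le_mul_left this S0'
      linarith) (by rw [abs_le]; constructor <;> linarith)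
  have hA1 : A / 2 * 2 ≤ A := Nat.div_mul_le_self _ _
  have hA2 : A ≤ A / 2 * 2 + 1 := by omega
  have hA1' : ((A / 2 : ℕ) : ℝ) * 2 ≤ A := by exact_mod_cast hA1
  have hA2' : (A : ℝ) ≤ ((A / 2 : ℕ) : ℝ) * 2 + 1 := by exact_mod_cast hA2
  have hAlo' : (A:ℝ) = Alo + C := by exact_mod_cast (by omega : A = Alo + C)
  have hAhi' : (Ahi:ℝ) = A + C := by exact_mod_cast hAhi
  have hC' : (C:ℝ) = 1024 := by rw [hC]; norm_num
  have hA := ng_apx' S P (A / 2) hS hP (by omega) (by omega) (α / 2) 1024 (by linarith) (by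
    have : α / 2 * S = y / 2 := by rw [hy]; ring
    rw [this, abs_le]; constructor <;> linarith)
  have e1 : ng S P (A / 2) = gA := hgA.symm
  rw [e1] at hA
  rw [← hgf] at hf
  have eL : (LA:ℝ) = l2 - gA := by rw [hLA, Nat.cast_sub c9]
  have lα : Real.log (α / 2) = Real.log α - Real.log 2 := Real.log_div (by linarith) (by norm_num)
  rw [lα] at hA
  refine ⟨hy ▸ a1, hy ▸ a2, c1, ?_, r1, r2, ?_, c7, c8, ?_⟩
  · rw [eL]
    rw [W] at hl2
    rw [abs_le] at hl2 hA ⊢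
    constructor <;> linarith [hl2.1, hl2.2, hA.1, hA.2]
  · rw [hQ] at c6; exact c6
  · rw [abs_le] at hf ⊢
    constructor <;> linarith [hf.1, hf.2]

lemma withK_sound {P S l2 k : ℕ} {α : ℝ} (hP : P ≤ 5000) (hS : S = 2 ^ P) (hl2 : |Real.log 2 * S - l2| ≤ W) (h : Root k α)
    (hk : k < 4096) {F : ℕ → ℕ → ℕ → ℕ → ℕ → ℕ → Bool} (hF : withK P S l2 k F = true) :
    ∃ Alo Ahi LA rlo rhi gf : ℕ, KD P S k α Alo Ahi LA rlo rhi gf ∧ F Alo Ahi LA rlo rhi gf = true := by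
  unfold withK at hF
  obtain ⟨A, -, hF⟩ := force_elim hF
  obtain ⟨Alo, hAlo, hF⟩ := force_elim hF
  obtain ⟨Ahi, hAhi, hF⟩ := force_elim hF
  obtain ⟨c1, hF⟩ := kle hF
  obtain ⟨c2, hF⟩ := kle hF
  obtain ⟨c3, hF⟩ := kle hF
  obtain ⟨c4, hF⟩ := kle hF
  obtain ⟨c5, hF⟩ := kle hF
  obtain ⟨rlo, hrlo, hF⟩ := force_elim hF
  obtain ⟨rhi, hrhi, hF⟩ := force_elim hF
  obtain ⟨c6, hF⟩ := kle hF
  obtain ⟨c7, hF⟩ := kle hF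
  obtain ⟨c8, hF⟩ := kle hF
  obtain ⟨gA, hgA, hF⟩ := force_elim hF
  obtain ⟨c9, hF⟩ := kle hF
  obtain ⟨LA, hLA, hF⟩ := force_elim hF
  obtain ⟨gf, hgf, hF⟩ := force_elim hF
  exact ⟨Alo, Ahi, LA, rlo, rhi, gf, withK_core hP hS hl2 h hk A gA hAlo hAhi c1 c2 c3 c4 c5 hrlo hrhi c6 c7 c8 hgA c9 hLA hgf, hF⟩

end TL

end

noncomputable section
namespace TL

lemma pw_ge (S A : ℕ) (hS : 0 < S) (hA : S ≤ A) (n : ℕ) : ∀ k, S ≤ pw 0 S A n k := by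
  induction n with
  | zero => intro k; exact le_rfl
  | succ n ih =>
    intro k
    cases k with
    | zero => exact le_rfl
    | succ k =>
      rw [pw_step]
      have h := ih ((k+1)/2)
      have h1 : S ≤ pw 0 S A n ((k+1)/2) * pw 0 S A n ((k+1)/2) / S + 0 := by
        rw [add_zero, Nat.le_div_iff_mul_le hS]; exact Nat.mul_le_mul h h
      split_ifs
      · exact h1
      · rw [add_zero, Nat.le_div_iff_mul_le hS]; exact Nat.mul_le_mul h1 hA

lemma red_core {S T LA q p M er NB Plo N d r : ℕ} {lam t mu E w : ℝ} (hE : 0 ≤ E) (hP : 0 < Plo)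
    (h1 : |lam * S - LA| ≤ E) (h2 : |t * S - T| ≤ E) (h3 : |mu * S - M| ≤ E)
    (hN : N + 3 ≤ NB) (hd : d ≤ N) (hw : w * Plo ≤ S)
    (hl : |N * lam - d * t + (mu - 3 * t)| ≤ 50 * w)
    (her : (q:ℝ) * E + NB * (3 * q * E + |(q:ℝ) * LA - p * T|) + 50 * q * (S * S) / Plo ≤ er)
    (hr : r = q * M % T) (c1 : er + 1 ≤ r) (c2 : er + r + 1 ≤ T) : False := by
  have hP' : (0:ℝ) < Plo := by exact_mod_cast hP
  obtain ⟨z, hz⟩ : ∃ z : ℤ, z = q * M + ((N:ℤ) * p - q * (d + 3)) * T := ⟨_, rfl⟩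
  have hzr : (z:ℝ) = q * M + ((N:ℝ) * p - q * (d + 3)) * T := by rw [hz]; push_cast; ring
  have key : (z:ℝ) = q * S * (N * lam - d * t + (mu - 3 * t)) - N * (q * (lam * S - LA)) - N * (q * LA - p * T)
      + q * (d + 3) * (t * S - T) - q * (mu * S - M) := by rw [hzr]; ring
  have q0 : (0:ℝ) ≤ q := by positivity
  have N0 : (0:ℝ) ≤ N := by positivity
  have S0 : (0:ℝ) ≤ S := by positivity
  have hN' : (N:ℝ) + 3 ≤ NB := by exact_mod_cast hN
  have hd' : (d:ℝ) ≤ N := by exact_mod_cast hd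
  have b1 : |q * S * (N * lam - d * t + (mu - 3 * t))| ≤ 50 * q * (S * S) / Plo := by
    rw [abs_mul, abs_of_nonneg (mul_nonneg q0 S0)]
    have hw' : w ≤ S / Plo := by rw [le_div_iff₀ hP']; exact hw
    calc (q:ℝ) * S * |N * lam - d * t + (mu - 3 * t)| ≤ q * S * (50 * (S / Plo)) :=
          mul_le_mul_of_nonneg_left (hl.trans (by linarith)) (mul_nonneg q0 S0)
      _ = 50 * q * (S * S) / Plo := by ring
  have b2 : |N * (q * (lam * S - LA))| ≤ NB * (q * E) := by
    rw [abs_mul, abs_mul, abs_of_nonneg q0, abs_of_nonneg N0]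
    exact mul_le_mul (by linarith) (mul_le_mul_of_nonneg_left h1 q0) (by positivity) (by positivity)
  have b3 : |(N:ℝ) * (q * LA - p * T)| ≤ NB * |(q:ℝ) * LA - p * T| := by
    rw [abs_mul, abs_of_nonneg N0]
    exact mul_le_mul_of_nonneg_right (by linarith) (abs_nonneg _)
  have b4 : |q * (d + 3) * (t * S - T)| ≤ NB * (q * E) := by
    rw [abs_mul, abs_of_nonneg (by positivity)]
    calc (q:ℝ) * (d + 3) * |t * S - T| ≤ q * NB * E :=
          mul_le_mul (mul_le_mul_of_nonneg_left (by linarith) q0) h2 (abs_nonneg _) (by positivity)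
      _ = NB * (q * E) := by ring
  have b5 : |q * (mu * S - M)| ≤ q * E := by
    rw [abs_mul, abs_of_nonneg q0]; exact mul_le_mul_of_nonneg_left h3 q0
  have b6 : 0 ≤ (NB:ℝ) * (q * E) := by positivity
  have hz1 : |(z:ℝ)| ≤ er := by
    refine le_trans ?_ her
    rw [abs_le] at b1 b2 b3 b4 b5 ⊢
    rw [key]
    constructor <;> linarith [b1.1, b1.2, b2.1, b2.2, b3.1, b3.2, b4.1, b4.2, b5.1, b5.2]
  have hz2 : |z| ≤ (er:ℤ) := by exact_mod_cast hz1
  have hm : (q:ℤ) * M = T * ((q * M / T : ℕ) : ℤ) + r := by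
    rw [hr]; exact_mod_cast (Nat.div_add_mod (q * M) T).symm
  have : ∃ s : ℤ, z = T * s + r := ⟨((q * M / T : ℕ) : ℤ) + ((N:ℤ) * p - q * (d + 3)), by rw [hz, hm]; ring⟩
  obtain ⟨s, hs⟩ := this
  rw [abs_le] at hz2
  have c1' : (er:ℤ) + 1 ≤ r := by exact_mod_cast c1
  have c2' : (er:ℤ) + r + 1 ≤ T := by exact_mod_cast c2
  rcases le_or_gt 0 s with h | h
  · have : 0 ≤ (T:ℤ) * s := by positivity
    linarith [hz2.2]
  · have : (T:ℤ) * s ≤ T * (-1) := mul_le_mul_of_nonneg_left (by omega) (by positivity)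
    linarith [hz2.1]

lemma errb_spec (S T LA q p NB E Plo : ℕ) (hP : 0 < Plo) :
    (q:ℝ) * E + NB * (3 * q * E + |(q:ℝ) * LA - p * T|) + 50 * q * (S * S) / Plo ≤ errb S T LA q p NB E Plo := by
  have e : errb S T LA q p NB E Plo = q * E + NB * (3 * q * E + ((q * LA - p * T) + (p * T - q * LA))) +
    (50 * q * (S * S) / Plo + 1) := rfl
  rw [e]
  have h1 : |(q:ℝ) * LA - p * T| = (((q * LA - p * T) + (p * T - q * LA) : ℕ) : ℝ) := by
    rcases le_total (q * LA) (p * T) with h | h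
    · rw [Nat.sub_eq_zero_of_le h, zero_add, Nat.cast_sub h, abs_of_nonpos (by rw [sub_nonpos]; exact_mod_cast h)]
      push_cast; ring
    · rw [Nat.sub_eq_zero_of_le h, add_zero, Nat.cast_sub h, abs_of_nonneg (by rw [sub_nonneg]; exact_mod_cast h)]
      push_cast; ring
  have h2 := le_div_add_one (50 * q * (S * S)) Plo hP
  rw [h1]
  have h3 : (50 * (q:ℝ) * (S * S)) / Plo ≤ ((50 * q * (S * S) / Plo + 1 : ℕ) : ℝ) := by
    refine le_trans (le_of_eq ?_) h2
    push_cast; ring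
  rw [Nat.cast_add (q * E + NB * (3 * q * E + ((q * LA - p * T) + (p * T - q * LA))))]
  refine add_le_add (le_of_eq ?_) h3
  push_cast; ring

lemma redA_elim {T q er M la : ℕ} (h : redA T q er M la = true) :
    la ≤ M ∧ ∃ r, r = q * (M - la) % T ∧ er + 1 ≤ r ∧ er + r + 1 ≤ T := by
  unfold redA at h
  obtain ⟨h1, h⟩ := kle h
  obtain ⟨r, hr, h⟩ := force_elim h
  obtain ⟨h2, h⟩ := kle h
  exact ⟨h1, r, hr, h2, Nat.le_of_ble_eq_true h⟩

lemma allA_elim {S l2 l3 l5 l7 T q er M k a : ℕ} (h : allA l2 l3 l5 l7 T q er M k = true)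
    (h2 : |Real.log 2 * S - l2| ≤ W) (h3 : |Real.log 3 * S - l3| ≤ W) (h5 : |Real.log 5 * S - l5| ≤ W)
    (h7 : |Real.log 7 * S - l7| ≤ W) (a1 : 1 ≤ a) (a9 : a ≤ 9) (ha : ¬ (k = 2 ∧ a = 9)) :
    ∃ la : ℕ, |Real.log a * S - la| ≤ 3 * W ∧ redA T q er M la = true := by
  unfold allA at h
  obtain ⟨g1, h⟩ := kand_elim h
  obtain ⟨g2, h⟩ := kand_elim h
  obtain ⟨g3, h⟩ := kand_elim h
  obtain ⟨g4, h⟩ := kand_elim h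
  obtain ⟨g5, h⟩ := kand_elim h
  obtain ⟨g6, h⟩ := kand_elim h
  obtain ⟨g7, h⟩ := kand_elim h
  obtain ⟨g8, h⟩ := kand_elim h
  have W0 : 0 ≤ W := by norm_num [W]
  have e4 : Real.log 4 = 2 * Real.log 2 := by
    rw [show (4:ℝ) = 2 ^ 2 by norm_num, Real.log_pow]; push_cast; ring
  have e8 : Real.log 8 = 3 * Real.log 2 := by
    rw [show (8:ℝ) = 2 ^ 3 by norm_num, Real.log_pow]; push_cast; ring
  have e9 : Real.log 9 = 2 * Real.log 3 := by
    rw [show (9:ℝ) = 3 ^ 2 by norm_num, Real.log_pow]; push_cast; ring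
  have e6 : Real.log 6 = Real.log 2 + Real.log 3 := by
    rw [← Real.log_mul (by norm_num) (by norm_num)]; norm_num
  rw [abs_le] at h2 h3 h5 h7
  interval_cases a
  · exact ⟨_, by simpa using W0, g1⟩
  · exact ⟨_, by rw [abs_le]; push_cast; constructor <;> linarith [h2.1, h2.2], g2⟩
  · exact ⟨_, by rw [abs_le]; push_cast; constructor <;> linarith [h3.1, h3.2], g3⟩
  · exact ⟨_, by rw [abs_le, Nat.mul_eq]; push_cast; rw [e4]; constructor <;> linarith [h2.1, h2.2], g4⟩
  · exact ⟨_, by rw [abs_le]; push_cast; constructor <;> linarith [h5.1, h5.2], g5⟩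
  · exact ⟨_, by rw [abs_le, Nat.add_eq]; push_cast; rw [e6]; constructor <;> linarith [h2.1, h2.2, h3.1, h3.2], g6⟩
  · exact ⟨_, by rw [abs_le]; push_cast; constructor <;> linarith [h7.1, h7.2], g7⟩
  · exact ⟨_, by rw [abs_le, Nat.mul_eq]; push_cast; rw [e8]; constructor <;> linarith [h2.1, h2.2], g8⟩
  · have hk : k ≠ 2 := fun h => ha ⟨h, rfl⟩
    have hb : Nat.beq k 2 = false := by
      rw [Bool.eq_false_iff]; intro h; exact hk (Nat.eq_of_beq_eq_true h)
    rw [hb] at h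
    exact ⟨_, by rw [abs_le, Nat.mul_eq]; push_cast; rw [e9]; constructor <;> linarith [h3.1, h3.2], h⟩

/-- the full reduction step -/
lemma red_sound {P S l2 l3 l5 l7 T LA q p M k a NB N d w0 w Alo Ahi rlo rhi gf : ℕ} {α X : ℝ} (S0 : 0 < S)
    (kd : KD P S k α Alo Ahi LA rlo rhi gf) (hα : 1 ≤ α)
    (h2 : |Real.log 2 * S - l2| ≤ W) (h3 : |Real.log 3 * S - l3| ≤ W) (h5 : |Real.log 5 * S - l5| ≤ W)
    (h7 : |Real.log 7 * S - l7| ≤ W) (hT : |Real.log 10 * S - T| ≤ W) (hX : |X * S - M| ≤ 2 ^ 50)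
    (a1 : 1 ≤ a) (a9 : a ≤ 9) (ha : ¬ (k = 2 ∧ a = 9)) (hN : N + 3 ≤ NB) (hd : d ≤ N) (hw0 : w0 < 4096) (hw : w0 ≤ w)
    (hl : |N * Real.log α - d * Real.log 10 + (X - Real.log a - 3 * Real.log 10)| ≤ 50 * (α ^ w)⁻¹)
    (h : allA l2 l3 l5 l7 T q (errb S T LA q p NB EE (pw 0 S Alo 12 w0)) M k = true) : False := by
  obtain ⟨la, hla, h⟩ := allA_elim h h2 h3 h5 h7 a1 a9 ha
  obtain ⟨hlaM, r, hr, c1, c2⟩ := redA_elim h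
  have hP := pw_ge S Alo S0 kd.a0.le 12 w0
  have hP0 : 0 < pw 0 S Alo 12 w0 := by omega
  have e := errb_spec S T LA q p NB EE (pw 0 S Alo 12 w0) hP0
  have hE : ((EE:ℕ):ℝ) = 2 ^ 64 := by norm_num [EE]
  rw [hE] at e
  have p1 := pw_lo S Alo S0 α kd.a1 12 w0 (by norm_num; exact hw0)
  rw [W] at hT hla
  refine red_core (w := (α ^ w)⁻¹) (mu := X - Real.log a) (M := M - la) (by norm_num) hP0 (kd.la.trans (by norm_num)) (hT.trans (by norm_num)) ?_ hN hd ?_ hl e hr c1 c2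
  · rw [Nat.cast_sub hlaM]
    rw [abs_le] at hX hla ⊢
    constructor <;> linarith [hX.1, hX.2, hla.1, hla.2]
  · have hp : 0 < α ^ w := by positivity
    rw [inv_mul_le_iff₀ hp]
    refine p1.trans ?_
    rw [mul_comm]
    exact mul_le_mul_of_nonneg_right (pow_le_pow_right₀ hα hw) (by positivity)

end TL

end

noncomputable section
namespace TL

lemma withM_sound {P S k l2 l3 T gf Alo Ahi LA rlo rhi : ℕ} {α : ℝ} (h : Root k α) (kd : KD P S k α Alo Ahi LA rlo rhi gf)
    (h2 : |Real.log 2 * S - l2| ≤ W) (h3 : |Real.log 3 * S - l3| ≤ W) (hT : |Real.log 10 * S - T| ≤ W)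
    {F : ℕ → Bool} (hF : withM l2 l3 T gf F = true) :
    ∃ M : ℕ, |(3 * Real.log (fK k α) + Real.log 9 + 3 * Real.log 10) * S - M| ≤ 2 ^ 40 ∧ F M = true := by
  unfold withM at hF
  obtain ⟨M1, hM1, hF⟩ := force_elim hF
  obtain ⟨c, hF⟩ := kle hF
  obtain ⟨M, hM, hF⟩ := force_elim hF
  refine ⟨M, ?_, hF⟩
  simp only [Nat.add_eq, Nat.mul_eq, Nat.sub_eq] at hM1 c hM
  have e : (M:ℝ) = 3 * T + 5 * l3 + 3 * gf - 6 * l2 := by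
    rw [hM, Nat.cast_sub c, hM1]; push_cast; ring
  have e9 : Real.log 9 = 2 * Real.log 3 := by
    rw [show (9:ℝ) = 3 ^ 2 by norm_num, Real.log_pow]; push_cast; ring
  have g := kd.gf
  rw [e, e9, h.log_f]
  rw [W] at h2 h3 hT
  rw [abs_le] at h2 h3 hT g ⊢
  constructor <;> linarith [h2.1, h2.2, h3.1, h3.2, hT.1, hT.2, g.1, g.2]

lemma withQ_sound {T LA B : ℕ} {F : ℕ → ℕ → Bool} (hF : withQ T LA B F = true) : ∃ q p, F q p = true := by
  unfold withQ at hF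
  obtain ⟨q, -, hF⟩ := force_elim hF
  obtain ⟨p, -, hF⟩ := force_elim hF
  exact ⟨q, p, (kle hF).2⟩

lemma loopK_sound (f : ℕ → Bool) (cnt : ℕ) : ∀ k0, loopK f cnt k0 = true → ∀ k, k0 ≤ k → k < k0 + cnt → f k = true := by
  induction cnt with
  | zero => intro k0 _ k h1 h2; omega
  | succ n ih =>
    intro k0 h k h1 h2
    have e : loopK f (n+1) k0 = kand (f k0) (force (Nat.succ k0) (loopK f n)) := rfl
    rw [e, force_eq] at h
    obtain ⟨h3, h4⟩ := kand_elim h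
    rcases Nat.eq_or_lt_of_le h1 with h5 | h5
    · rw [← h5]; exact h3
    · exact ih _ h4 k h5 (by omega)

lemma pow2_split (a b : ℕ) (h : a = 2 + b) : Nat.pow 2 a = 4 * 2 ^ b := by
  rw [h]; show 2 ^ (2 + b) = _; rw [pow_add]; norm_num

lemma run1_sound {k0 cnt : ℕ} (hr : run1 k0 cnt = true) {k n m l d a : ℕ} {α : ℝ} (hk0 : k0 ≤ k) (hk1 : k < k0 + cnt)
    (s : Sol k n m l d a) (h : Root k α) (ha : ¬ (k = 2 ∧ a = 9)) (hn : n < 2 ^ 2030) : l < 3200 := by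
  by_contra hc
  push Not at hc
  unfold run1 at hr
  obtain ⟨S, l2, l3, l5, l7, T, hS, h2, h3, h5, h7, hT, hr⟩ := withC_sound 4300 (by norm_num) _ hr
  have hr := loopK_sound _ cnt k0 hr k hk0 hk1
  have hk' := s.hk'
  obtain ⟨Alo, Ahi, LA, rlo, rhi, gf, kd, hr⟩ := withK_sound (by norm_num) hS h2 h (by omega) hr
  obtain ⟨M, hM, hr⟩ := withM_sound h kd h2 h3 hT hr
  obtain ⟨q, p, hr⟩ := withQ_sound hr
  rw [force_eq] at hr
  have S0 : 0 < S := by rw [hS]; exact Nat.pow_pos (by norm_num)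
  have hnm := s.hnm
  have hml := s.hml
  have hd := s.d_le
  have hl := s.lam1 h
  clear hS
  refine red_sound (w := l) (w0 := 3200) (N := n + m + l) (d := d) S0 kd (by linarith [h.lo]) h2 h3 h5 h7 hT (hM.trans (by norm_num)) s.ha1 s.ha9 ha ?_ (by omega)
    (by norm_num) hc ?_ hr
  · have e : Nat.pow 2 2032 = 4 * 2 ^ 2030 := pow2_split 2032 2030 rfl
    rw [e]
    have : 3 ≤ 2 ^ 2030 := (by norm_num : 3 ≤ 2 ^ 2).trans (Nat.pow_le_pow_right (by norm_num) (by norm_num))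
    generalize 2 ^ 2030 = Z at *
    omega
  · convert hl using 2
    ring

end TL

end

noncomputable section
namespace TL

/-- `β = L_l / (f α^l)` -/
def bK (k l : ℕ) (α : ℝ) : ℝ := 4 * lucasK k l * rK k α / (3 * α ^ l)

lemma Root.bK_log {k l : ℕ} {α : ℝ} (h : Root k α) :
    Real.log (lucasK k l) = Real.log (bK k l α) + Real.log (fK k α) + l * Real.log α := by
  have r := h.rK_pos
  have α0 : 0 < α := by linarith [h.lo]
  have L0 : (0:ℝ) < lucasK k l := by exact_mod_cast lucasK_pos k l h.hk
  have f0 := h.f_pos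
  have b0 : 0 < bK k l α := by unfold bK; positivity
  rw [← Real.log_mul b0.ne' f0.ne', ← Real.log_pow, ← Real.log_mul (by positivity) (by positivity)]
  congr 1
  rw [h.fK_eq, bK]
  field_simp

lemma Root.bK_ge {k l : ℕ} {α : ℝ} (h : Root k α) (hl : 301 ≤ l) : 3 / 4 ≤ bK k l α := by
  have r := h.rK_pos
  have α0 : 0 < α := by linarith [h.lo]
  have p := pow16_big h.lo hl
  have f := h.f_bd
  have L := h.L_bd l
  have e : bK k l α = lucasK k l / (fK k α * α ^ l) := by
    rw [h.fK_eq, bK]; field_simp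
  have f0 := h.f_pos
  rw [e, le_div_iff₀ (by positivity)]
  rw [abs_le] at L
  have : 1 / 3 * α ^ l ≤ fK k α * α ^ l := mul_le_mul_of_nonneg_right f.1 (by positivity)
  have p1 : 24 ≤ α ^ l := le_trans (by norm_num) p
  linarith [L.1]

lemma chkB_core {P S k l Q : ℕ} {α : ℝ} (S0 : 0 < S) (h : Root k α) (hS : S = 2 ^ P) (hP : P ≤ 5000)
    {Alo Ahi LA rlo rhi gf : ℕ} (kd : KD P S k α Alo Ahi LA rlo rhi gf) (hl : 301 ≤ l) (hl2 : l < 4096)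
    {blo bhi b D : ℕ} (D0' : (4:ℝ) ≤ D) (hQ : (Q:ℝ) ≤ 2 ^ 40)
    (hblo : blo = 4 * lucasK k l * rlo * S / (3 * pw 1 S Ahi 12 l))
    (hbhi : bhi = 4 * lucasK k l * rhi * S / (3 * pw 0 S Alo 12 l) + 1)
    (hb2 : bhi ≤ blo + Q)
    (hb : b = blo - blo / D) (hbS : b ≤ S) (hSb : S ≤ 2 * b) :
    |(S:ℝ) * (Real.log (bK k l α) + Real.log (1 - 1 / D)) + ng S P b| ≤ 2 ^ 43 := by
  have hge := h.bK_ge hl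
  have α0 : 0 < α := by linarith [h.lo]
  have r := h.rK_pos
  have S0' : (0:ℝ) < S := by exact_mod_cast S0
  have p1 := pw_hi S Ahi S0 α α0.le kd.a2 12 l hl2
  have p2 := pw_lo S Alo S0 α kd.a1 12 l hl2
  have p3 := pw_ge S Alo S0 kd.a0.le 12 l
  clear hl2
  have q1 : (blo:ℝ) ≤ S * bK k l α := by
    have : (blo:ℝ) ≤ ((4 * lucasK k l * rlo * S : ℕ) : ℝ) / ((3 * pw 1 S Ahi 12 l : ℕ) : ℝ) := by
      rw [hblo]; exact Nat.cast_div_le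
    refine this.trans ?_
    push_cast
    have e : S * bK k l α = 4 * lucasK k l * (S * rK k α) * S / (3 * (S * α ^ l)) := by
      rw [bK]; field_simp
    rw [e]
    apply div_le_div₀ (by positivity) _ (by positivity) (by linarith)
    exact mul_le_mul_of_nonneg_right (mul_le_mul_of_nonneg_left kd.r1 (by positivity)) S0'.le
  have q2 : S * bK k l α ≤ bhi := by
    have := le_div_add_one (4 * lucasK k l * rhi * S) (3 * pw 0 S Alo 12 l) (by omega)
    rw [← hbhi] at this
    refine le_trans ?_ this
    push_cast
    have e : S * bK k l α = 4 * lucasK k l * (S * rK k α) * S / (3 * (S * α ^ l)) := by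
      rw [bK]; field_simp
    rw [e]
    have p0 : (0:ℝ) < pw 0 S Alo 12 l := by exact_mod_cast (by omega : 0 < pw 0 S Alo 12 l)
    apply div_le_div₀ (by positivity) _ (by positivity) (by linarith)
    exact mul_le_mul_of_nonneg_right (mul_le_mul_of_nonneg_left kd.r2 (by positivity)) S0'.le
  have q3 : (bhi:ℝ) ≤ blo + 2 ^ 40 := by
    have : (bhi:ℝ) ≤ ((blo + Q : ℕ) : ℝ) := by exact_mod_cast hb2
    push_cast at this
    linarith
  have D0 : 0 < D := by
    have : (0:ℝ) < D := by linarith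
    exact_mod_cast this
  clear hb2 hblo hbhi
  have hb3 : (b:ℝ) = blo - ((blo / D : ℕ) : ℝ) := by rw [hb, Nat.cast_sub (Nat.div_le_self _ _)]
  have d1 : ((blo / D : ℕ) : ℝ) ≤ blo / D := Nat.cast_div_le
  have d2 := le_div_add_one blo D D0
  push_cast at d2
  have c1 : (1:ℝ) / D ≤ 1 / 4 := one_div_le_one_div_of_le (by norm_num) D0'
  have c0 : (0:ℝ) < 1 / D := by positivity
  have hu : 1 / 2 ≤ bK k l α * (1 - 1 / D) := by
    calc (1:ℝ) / 2 ≤ 3 / 4 * (3 / 4) := by norm_num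
      _ ≤ bK k l α * (1 - 1 / D) := mul_le_mul hge (by linarith) (by norm_num) (by linarith)
  have hng := ng_apx' S P b hS hP hSb hbS (bK k l α * (1 - 1 / D)) (2 ^ 41) hu (by
    have e1 : bK k l α * (1 - 1 / D) * S - b = (S * bK k l α - blo) * (1 - 1 / D) + (((blo / D : ℕ) : ℝ) - blo / D) := by
      rw [hb3]; ring
    have e2 : (S * bK k l α - blo) * (1 - 1 / D) ≤ (S * bK k l α - blo) * 1 :=
      mul_le_mul_of_nonneg_left (by linarith) (by linarith)
    have e3 : 0 ≤ (S * bK k l α - blo) * (1 - 1 / (D:ℝ)) := mul_nonneg (by linarith) (by linarith)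
    rw [e1, abs_le]
    constructor <;> linarith)
  rw [Real.log_mul (by linarith) (by linarith)] at hng
  refine hng.trans (by norm_num)

lemma chkB_sound {S l2 l3 l5 l7 T Gc q er M k l : ℕ} {α X : ℝ} (S0 : 0 < S) (h : Root k α) (hS : S = 2 ^ 1650)
    {Alo Ahi LA rlo rhi gf : ℕ} (kd : KD 1650 S k α Alo Ahi LA rlo rhi gf) (hl : 301 ≤ l) (hl2 : l < 4096)
    (hG : |(S:ℝ) * Real.log (1 - 1 / 2 ^ 200) + Gc| ≤ 2 ^ 20) (hM : |X * S - M| ≤ 2 ^ 40)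
    (hc : chkB 1650 S l2 l3 l5 l7 T Gc q er Alo Ahi rlo rhi M k l (lucasK k l) = true) :
    ∃ M' : ℕ, |(X + Real.log (bK k l α)) * S - M'| ≤ 2 ^ 50 ∧ allA l2 l3 l5 l7 T q er M' k = true := by
  unfold chkB at hc
  have hP : 1650 ≤ 5000 := by norm_num
  have hDe : ((Nat.pow 2 200 : ℕ) : ℝ) = 2 ^ 200 := Nat.cast_pow 2 200
  have hD : (4:ℝ) ≤ ((Nat.pow 2 200 : ℕ) : ℝ) := by rw [hDe]; norm_num
  have hQ : ((1099511627776:ℕ):ℝ) ≤ 2 ^ 40 := by norm_num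
  obtain ⟨blo, hblo, hc⟩ := force_elim hc
  obtain ⟨hbhi, hc⟩ := kle hc
  obtain ⟨b, hb, hc⟩ := force_elim hc
  obtain ⟨hbS, hc⟩ := kle hc
  obtain ⟨hSb, hc⟩ := kle hc
  obtain ⟨g, hg, hc⟩ := force_elim hc
  obtain ⟨hgM, hc⟩ := kle hc
  obtain ⟨M', hM', hc⟩ := force_elim hc
  refine ⟨M', ?_, hc⟩
  have key := chkB_core S0 h hS hP kd hl hl2 hD hQ hblo rfl hbhi hb hbS hSb
  rw [hDe] at key
  rw [← hg] at key
  have e : (M':ℝ) = M + Gc - g := by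
    have e1 : M' = M + Gc - g := hM'
    have e2 : g ≤ M + Gc := hgM
    rw [e1, Nat.cast_sub e2]; push_cast; ring
  rw [e]
  clear hblo hbhi hb hbS hSb hgM hM' hg
  rw [abs_le] at key hG hM ⊢
  constructor <;> linarith [key.1, key.2, hG.1, hG.2, hM.1, hM.2]

end TL

end

noncomputable section
namespace TL

lemma rv_eq (l : List ℕ) : ∀ acc, rv l acc = l.reverse ++ acc := by
  induction l with
  | nil => intro acc; rfl
  | cons y ys ih =>
    intro acc
    have e : rv (y :: ys) acc = rv ys (y :: acc) := rfl
    rw [e, ih]; simp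

lemma pop_elim {front back : List ℕ} {F : ℕ → List ℕ → List ℕ → Bool} (h : pop front back F = true) :
    ∃ x xs b', F x xs b' = true ∧ front ++ back.reverse = x :: (xs ++ b'.reverse) := by
  cases front with
  | cons x xs => exact ⟨x, xs, back, h, rfl⟩
  | nil =>
    have e : rv back [] = back.reverse := by rw [rv_eq]; simp
    have e2 : pop [] back F = List.rec (motive := fun _ => Bool) false (fun x xs _ => F x xs []) (rv back []) := rfl
    rw [e2, e] at h
    generalize back.reverse = B at *
    cases B with
    | nil => exact absurd h (by simp)
    | cons x xs => exact ⟨x, xs, [], h, by simp⟩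

def gK (k i : ℕ) : ℕ := lucasK k i + i

lemma pows_eq (k : ℕ) (hk : 2 ≤ k) (c : ℕ) : ∀ i, i + c + 1 ≤ k →
    pows c (3 * 2 ^ i + (i + 2)) (i + 2) = (List.range' (i + 2) c).map (gK k) := by
  induction c with
  | zero => intro i _; rfl
  | succ c ih =>
    intro i hi
    have e : pows (c+1) (3 * 2 ^ i + (i + 2)) (i + 2) = (3 * 2 ^ i + (i + 2)) ::
      force (Nat.sub (Nat.succ (Nat.mul 2 (3 * 2 ^ i + (i + 2)))) (i + 2)) fun x' => force (Nat.succ (i+2)) fun j' => pows c x' j' := rfl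
    rw [e, force_eq, force_eq]
    have e2 : Nat.sub (Nat.succ (Nat.mul 2 (3 * 2 ^ i + (i + 2)))) (i + 2) = 3 * 2 ^ (i+1) + ((i + 1) + 2) := by
      rw [pow_succ]
      simp only [Nat.mul_eq, Nat.sub_eq, Nat.succ_eq_add_one]
      omega
    rw [e2, show Nat.succ (i+2) = (i+1)+2 by omega, ih (i+1) (by omega), List.range'_succ, List.map_cons, gK,
      lucasK_small k hk i (by omega)]

lemma start_list_eq (k : ℕ) (hk : 2 ≤ k) : (2 :: 2 :: pows (Nat.pred k) 5 2) = (List.range' 0 (k+1)).map (gK k) := by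
  obtain ⟨j, rfl⟩ : ∃ j, k = j + 1 := ⟨k - 1, by omega⟩
  have := pows_eq (j+1) hk j 0 (by omega)
  norm_num at this
  rw [List.range'_succ, List.range'_succ, List.map_cons, List.map_cons]
  have e0 : gK (j+1) 0 = 2 := by rw [gK, lucasK]
  have e1 : gK (j+1) (0+1) = 2 := by rw [gK]; simp [lucasK]
  rw [e0, e1]
  congr 2

lemma stB_sound (f : ℕ → ℕ → Bool) (k : ℕ) (hk : 2 ≤ k) (cnt : ℕ) : ∀ (n Y : ℕ) (front back : List ℕ), k ≤ n → Y = gK k n →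
    front ++ back.reverse = (List.range' (n - k) (k+1)).map (gK k) → stB f (Nat.pred k) cnt n Y front back = true →
    ∀ l, n < l → l ≤ n + cnt → 301 ≤ l → lucasK k l % 16 ≠ 0 → f l (lucasK k l) = true := by
  induction cnt with
  | zero => intro n Y fr ba _ _ _ _ l h1 h2; omega
  | succ cnt ih =>
    intro n Y fr ba hn hY hl h l h1 h2 h3 h4
    have e : stB f (Nat.pred k) (cnt+1) n Y fr ba = pop fr ba fun x front' back' =>
      force (Nat.sub (Nat.mul 2 Y) (Nat.add x (Nat.pred k))) fun Y' =>
      force (Nat.succ n) fun n' =>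
      kand (Bool.rec (motive := fun _ => Bool) true (Nat.rec (motive := fun _ => Bool) true (fun _ _ => f n' (Nat.sub Y' n')) (Nat.mod (Nat.sub Y' n') 16)) (Nat.ble 301 n'))
        (stB f (Nat.pred k) cnt n' Y' front' (Y' :: back')) := rfl
    rw [e] at h
    obtain ⟨x, xs, b', h, hx⟩ := pop_elim h
    obtain ⟨Y', hY', h⟩ := force_elim h
    obtain ⟨n', hn', h⟩ := force_elim h
    obtain ⟨hA, hB⟩ := kand_elim h
    rw [hl, List.range'_succ, List.map_cons] at hx
    injection hx with hx1 hx2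
    have hrec := lucasK_succ' k n hk hn
    have hY2 : Y' = gK k (n+1) := by
      simp only [Nat.mul_eq, Nat.sub_eq, Nat.add_eq, Nat.pred_eq_sub_one] at hY'
      rw [hY', hY, ← hx1]; simp only [gK]
      omega
    have hn2 : n' = n + 1 := hn'
    have e3 : Nat.sub Y' n' = lucasK k (n+1) := by
      rw [hY2, hn2, gK]; simp
    rcases Nat.eq_or_lt_of_le (show n + 1 ≤ l from h1) with h5 | h5
    · rw [e3, hn2, h5] at hA
      have b : Nat.ble 301 l = true := Nat.ble_eq.mpr h3
      rw [b] at hA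
      have b2 : Nat.mod (lucasK k l) 16 = lucasK k l % 16 := rfl
      rw [b2] at hA
      obtain ⟨v, hv⟩ := Nat.exists_eq_succ_of_ne_zero h4
      rw [hv] at hA
      exact hA
    · refine ih n' Y' xs (Y' :: b') (by omega) (by rw [hY2, hn2]) ?_ hB l (by omega) (by omega) h3 h4
      rw [List.reverse_cons, ← List.append_assoc, ← hx2, hn2, show n + 1 - k = n - k + 1 by omega,
        List.range'_1_concat, List.map_append, hY2]
      have e5 : n - k + 1 + k = n + 1 := by omega
      simp [e5]
      done

lemma pow_split_gen (a b c : ℕ) (h : a = b + c) : 2 ^ a = 2 ^ b * Nat.pow 2 c := by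
  rw [h, pow_add]; rfl

lemma Gc_sound {S : ℕ} (hS : S = 2 ^ 1650) :
    |(S:ℝ) * Real.log (1 - 1 / 2 ^ 200) + (ng S 1650 (Nat.sub S (Nat.pow 2 1450)) : ℕ)| ≤ 2 ^ 20 := by
  obtain ⟨Z, hZ⟩ : ∃ Z : ℕ, Z = Nat.pow 2 1450 := ⟨_, rfl⟩
  obtain ⟨D, hD⟩ : ∃ D : ℕ, D = 2 ^ 200 := ⟨_, rfl⟩
  have hDr : (D:ℝ) = 2 ^ 200 := by rw [hD]; exact Nat.cast_pow 2 200
  have e : S = D * Z := by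
    rw [hS, hD, hZ]; exact pow_split_gen _ _ _ rfl
  have hD4 : 4 ≤ D := by rw [hD]; norm_num
  have hZ0 : 0 < Z := by rw [hZ]; exact Nat.pow_pos (by norm_num)
  rw [← hZ, ← hDr]
  have U : Nat.sub S Z = S - Z := rfl
  rw [U]
  have h4 : 4 * Z ≤ S := by rw [e]; exact Nat.mul_le_mul_right _ hD4
  have hD4' : (4:ℝ) ≤ D := by exact_mod_cast hD4
  have c1 : (1:ℝ) / D ≤ 1 / 4 := one_div_le_one_div_of_le (by norm_num) hD4'
  have := ng_apx' S 1650 (S - Z) hS (by norm_num) (by omega) (by omega) (1 - 1 / D) 0 (by linarith) (by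
    rw [Nat.cast_sub (by omega), e]; push_cast
    rw [abs_le]; constructor <;> apply le_of_eq <;> field_simp <;> ring)
  refine this.trans (by norm_num)

lemma l2f_lt (k : ℕ) : l2f k < 4096 := by
  unfold l2f
  cases Nat.ble 8 k
  · cases Nat.ble 4 k
    · cases Nat.ble 3 k
      · exact (by norm_num : 1200 < 4096)
      · exact (by norm_num : 950 < 4096)
    · exact (by norm_num : 880 < 4096)
  · exact (by norm_num : 820 < 4096)

lemma NB_ok {n m l a b : ℕ} (hnm : m ≤ n) (hml : l ≤ m) (hn : n < 2 ^ b) (h : a = 2 + b) (hb : 2 ≤ b) :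
    n + m + l + 3 ≤ Nat.pow 2 a := by
  rw [pow2_split a b h]
  have : 3 ≤ 2 ^ b := (by norm_num : 3 ≤ 2 ^ 2).trans (Nat.pow_le_pow_right (by norm_num) hb)
  generalize 2 ^ b = Z at *
  omega

lemma run2_sound {k0 cnt : ℕ} (hr : run2 k0 cnt = true) {k n m l d a : ℕ} {α : ℝ} (hk0 : k0 ≤ k) (hk1 : k < k0 + cnt)
    (s : Sol k n m l d a) (h : Root k α) (ha : ¬ (k = 2 ∧ a = 9)) (hl32 : l < 3200) : False := by
  have hn := s.chainA2 h hl32.le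
  unfold run2 at hr
  obtain ⟨S, l2, l3, l5, l7, T, hS, h2, h3, h5, h7, hT, hr⟩ := withC_sound 1650 (by norm_num) _ hr
  rw [force_eq] at hr
  have hG := Gc_sound hS
  have hr := loopK_sound _ cnt k0 hr k hk0 hk1
  have hk := s.hk
  have hk' := s.hk'
  obtain ⟨Alo, Ahi, LA, rlo, rhi, gf, kd, hr⟩ := withK_sound (by norm_num) hS h2 h (by omega) hr
  obtain ⟨M, hM, hr⟩ := withM_sound h kd h2 h3 hT hr
  obtain ⟨hr3, hr⟩ := kand_elim hr
  obtain ⟨q, p, hr⟩ := withQ_sound hr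
  obtain ⟨hr1, hr2⟩ := kand_elim hr
  rw [force_eq] at hr1 hr2
  have S0 : 0 < S := by rw [hS]; exact Nat.pow_pos (by norm_num)
  have hnm := s.hnm
  have hml := s.hml
  have hd := s.d_le
  have hl := s.lam1 h
  have hα1 : 1 ≤ α := by linarith [h.lo]
  have hl' : |((n + m + l : ℕ) : ℝ) * Real.log α - d * Real.log 10 + ((3 * Real.log (fK k α) + Real.log 9 + 3 * Real.log 10) - Real.log a - 3 * Real.log 10)| ≤ 50 * (α ^ l)⁻¹ := by
    convert hl using 2
    ring
  have hll := s.hl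
  by_cases hc : l2f k ≤ l
  · exact red_sound (w := l) (w0 := l2f k) (N := n + m + l) (d := d) S0 kd hα1 h2 h3 h5 h7 hT (hM.trans (by norm_num)) s.ha1 s.ha9 ha
      (NB_ok hnm hml hn rfl (by norm_num)) (by omega) (l2f_lt k) hc hl' hr1
  push Not at hc
  have hm : m ≤ 3200 := by
    by_contra hm
    push Not at hm
    rw [force_eq] at hr2
    have hkl := s.k_lt
    have hchk := stB_sound _ k hk _ k _ _ _ le_rfl (by
        have := lucasK_small k hk (k-2) (by omega)
        rw [show k - 2 + 2 = k by omega] at this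
        rw [gK, this]; rfl) (by rw [start_list_eq k hk]; simp) hr2 l hkl (by
        have : Nat.sub (l2f k) k = l2f k - k := rfl
        rw [this]; omega) s.hl s.mod16
    obtain ⟨M', hM', hA⟩ := chkB_sound S0 h hS kd s.hl (by omega) hG hM hchk
    refine red_sound (w := m) (w0 := 3200) (N := n + m + l) (d := d) S0 kd hα1 h2 h3 h5 h7 hT hM' s.ha1 s.ha9 ha
      (NB_ok hnm hml hn rfl (by norm_num)) (by omega) (by norm_num) hm.le ?_ hA
    have h22 := s.lam2 h
    rw [h.bK_log] at h22
    convert h22 using 2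
    push_cast
    ring
  obtain ⟨q, p, hr3⟩ := withQ_sound hr3
  rw [force_eq] at hr3
  refine red_sound (w := l) (w0 := 301) (N := n + m + l) (d := d) S0 kd hα1 h2 h3 h5 h7 hT (hM.trans (by norm_num)) s.ha1 s.ha9 ha
      ?_ (by omega) (by norm_num) s.hl hl' hr3
  by_cases hk2 : k = 2
  · subst hk2
    exact NB_ok hnm hml (s.chainF2 h hm) rfl (by norm_num)
  · have : Nat.beq k 2 = false := by
      rw [← Bool.not_eq_true]; exact fun c => hk2 (Nat.eq_of_beq_eq_true c)
    rw [this]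
    exact NB_ok hnm hml (s.chainF3 h hm) rfl (by norm_num)

end TL

end

noncomputable section
namespace TL

/-- Lucas numbers modulo 360 -/
def vL (r : ℕ) : ℕ := [2, 1, 3, 4, 7, 11, 18, 29, 47, 76, 123, 199, 322, 161, 123, 284, 47, 331, 18, 349, 7, 356, 3, 359, 2].getD r 0

lemma lucas2_rec (n : ℕ) : lucasK 2 (n+2) = lucasK 2 (n+1) + lucasK 2 n := by
  rw [lucasK, Finset.sum_range_succ, Finset.sum_range_succ]
  simp

lemma vL_step : ∀ r < 23, (vL r + vL (r+1)) % 360 = vL (r+2) := by decide +kernel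

lemma lucas2_mod (n : ℕ) : ∃ r < 24, lucasK 2 n % 360 = vL r ∧ lucasK 2 (n+1) % 360 = vL (r+1) := by
  induction n with
  | zero => exact ⟨0, by norm_num, by simp [lucasK, vL], by simp [lucasK, vL]⟩
  | succ n ih =>
    obtain ⟨r, hr, h1, h2⟩ := ih
    have e := lucas2_rec n
    by_cases h : r = 23
    · refine ⟨0, by norm_num, ?_, ?_⟩
      · rw [h2, h]; rfl
      · rw [h] at h1 h2
        have v1 : vL 23 = 359 := rfl
        have v2 : vL (23+1) = 2 := rfl
        have v3 : vL (0+1) = 1 := rfl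
        rw [v1] at h1
        rw [v2] at h2
        rw [v3, e]
        omega
    · have := vL_step r (by omega)
      refine ⟨r+1, by omega, h2, ?_⟩
      rw [e, ← this, ← h1, ← h2]
      omega

lemma vL_prod : ∀ i < 24, ∀ j < 24, ∀ t < 24, (vL i * vL j * vL t) % 360 ≠ 279 := by decide +kernel

lemma ten_mod (e : ℕ) : 10 ^ (e + 3) % 360 = 280 := by
  induction e with
  | zero => norm_num
  | succ e ih => rw [show e + 1 + 3 = (e + 3) + 1 by ring, pow_succ, Nat.mul_mod, ih]

lemma Sol.not29 {n m l d : ℕ} (s : Sol 2 n m l d 9) : False := by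
  have h := s.heq
  have hd := s.hd
  obtain ⟨α, r⟩ := exists_root 2 (by norm_num)
  have key : lucasK 2 n * lucasK 2 m * lucasK 2 l + 1 = 10 ^ d := by omega
  obtain ⟨i, hi, h1, -⟩ := lucas2_mod n
  obtain ⟨j, hj, h2, -⟩ := lucas2_mod m
  obtain ⟨t, ht, h3, -⟩ := lucas2_mod l
  have hp := vL_prod i hi j hj t ht
  rw [← h1, ← h2, ← h3] at hp
  have e : lucasK 2 n * lucasK 2 m * lucasK 2 l % 360 ≠ 279 := by
    intro hh; apply hp; rw [← hh]; simp [Nat.mul_mod]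
  rcases Nat.lt_or_ge d 3 with h4 | h4
  · have : d = 2 := by omega
    subst this
    have big : 100 ≤ lucasK 2 l := by
      have L := abs_le.1 (r.L_bd l)
      have p := pow16_big r.lo s.hl
      have f : 1 / 3 * α ^ l ≤ fK 2 α * α ^ l := mul_le_mul_of_nonneg_right r.f_bd.1 (by linarith)
      have : (100:ℝ) ≤ lucasK 2 l := by linarith [L.1]
      exact_mod_cast this
    have p1 := lucasK_pos 2 n (by norm_num)
    have p2 := lucasK_pos 2 m (by norm_num)
    have : 1 * 1 * 100 ≤ lucasK 2 n * lucasK 2 m * lucasK 2 l := Nat.mul_le_mul (Nat.mul_le_mul p1 p2) big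
    omega
  · have := ten_mod (d - 3)
    rw [show d - 3 + 3 = d by omega] at this
    omega

end TL

end

noncomputable section
namespace TL

set_option maxRecDepth 100000

def Cov (f : ℕ → ℕ → Bool) (b : ℕ) : Prop := ∀ k, 2 ≤ k → k < b → ∃ k0 c, f k0 c = true ∧ k0 ≤ k ∧ k < k0 + c

lemma Cov.base (f : ℕ → ℕ → Bool) : Cov f 2 := fun k h1 h2 => absurd h1 (by omega)

lemma Cov.step {f : ℕ → ℕ → Bool} {a : ℕ} (h : Cov f a) (c b : ℕ) (hr : f a c = true) (hb : b = a + c) : Cov f b := by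
  intro k h1 h2
  rcases Nat.lt_or_ge k a with h3 | h3
  · exact h k h1 h3
  · exact ⟨a, c, hr, h3, by omega⟩

theorem run1_2 : run1 2 25 = true := by decide +kernel
theorem run1_27 : run1 27 25 = true := by decide +kernel
theorem run1_52 : run1 52 25 = true := by decide +kernel
theorem run1_77 : run1 77 25 = true := by decide +kernel
theorem run1_102 : run1 102 25 = true := by decide +kernel
theorem run1_127 : run1 127 25 = true := by decide +kernel
theorem run1_152 : run1 152 25 = true := by decide +kernel
theorem run1_177 : run1 177 25 = true := by decide +kernel
theorem run1_202 : run1 202 25 = true := by decide +kernel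
theorem run1_227 : run1 227 25 = true := by decide +kernel
theorem run1_252 : run1 252 25 = true := by decide +kernel
theorem run1_277 : run1 277 25 = true := by decide +kernel
theorem run1_302 : run1 302 25 = true := by decide +kernel
theorem run1_327 : run1 327 25 = true := by decide +kernel
theorem run1_352 : run1 352 25 = true := by decide +kernel
theorem run1_377 : run1 377 25 = true := by decide +kernel
theorem run1_402 : run1 402 25 = true := by decide +kernel
theorem run1_427 : run1 427 25 = true := by decide +kernel
theorem run1_452 : run1 452 25 = true := by decide +kernel
theorem run1_477 : run1 477 25 = true := by decide +kernel
theorem run1_502 : run1 502 25 = true := by decide +kernel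
theorem run1_527 : run1 527 25 = true := by decide +kernel
theorem run1_552 : run1 552 25 = true := by decide +kernel
theorem run1_577 : run1 577 25 = true := by decide +kernel
theorem run1_602 : run1 602 25 = true := by decide +kernel
theorem run1_627 : run1 627 24 = true := by decide +kernel

theorem cov_run1 : Cov run1 651 :=
  have c2 := Cov.base run1
  have c27 := c2.step 25 27 run1_2 rfl
  have c52 := c27.step 25 52 run1_27 rfl
  have c77 := c52.step 25 77 run1_52 rfl
  have c102 := c77.step 25 102 run1_77 rfl
  have c127 := c102.step 25 127 run1_102 rfl
  have c152 := c127.step 25 152 run1_127 rfl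
  have c177 := c152.step 25 177 run1_152 rfl
  have c202 := c177.step 25 202 run1_177 rfl
  have c227 := c202.step 25 227 run1_202 rfl
  have c252 := c227.step 25 252 run1_227 rfl
  have c277 := c252.step 25 277 run1_252 rfl
  have c302 := c277.step 25 302 run1_277 rfl
  have c327 := c302.step 25 327 run1_302 rfl
  have c352 := c327.step 25 352 run1_327 rfl
  have c377 := c352.step 25 377 run1_352 rfl
  have c402 := c377.step 25 402 run1_377 rfl
  have c427 := c402.step 25 427 run1_402 rfl
  have c452 := c427.step 25 452 run1_427 rfl
  have c477 := c452.step 25 477 run1_452 rfl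
  have c502 := c477.step 25 502 run1_477 rfl
  have c527 := c502.step 25 527 run1_502 rfl
  have c552 := c527.step 25 552 run1_527 rfl
  have c577 := c552.step 25 577 run1_552 rfl
  have c602 := c577.step 25 602 run1_577 rfl
  have c627 := c602.step 25 627 run1_602 rfl
  have c651 := c627.step 24 651 run1_627 rfl
  c651

theorem run2_2 : run2 2 25 = true := by decide +kernel
theorem run2_27 : run2 27 25 = true := by decide +kernel
theorem run2_52 : run2 52 25 = true := by decide +kernel
theorem run2_77 : run2 77 25 = true := by decide +kernel
theorem run2_102 : run2 102 25 = true := by decide +kernel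
theorem run2_127 : run2 127 25 = true := by decide +kernel
theorem run2_152 : run2 152 25 = true := by decide +kernel
theorem run2_177 : run2 177 25 = true := by decide +kernel
theorem run2_202 : run2 202 25 = true := by decide +kernel
theorem run2_227 : run2 227 25 = true := by decide +kernel
theorem run2_252 : run2 252 25 = true := by decide +kernel
theorem run2_277 : run2 277 25 = true := by decide +kernel
theorem run2_302 : run2 302 25 = true := by decide +kernel
theorem run2_327 : run2 327 25 = true := by decide +kernel
theorem run2_352 : run2 352 25 = true := by decide +kernel
theorem run2_377 : run2 377 25 = true := by decide +kernel
theorem run2_402 : run2 402 25 = true := by decide +kernel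
theorem run2_427 : run2 427 25 = true := by decide +kernel
theorem run2_452 : run2 452 25 = true := by decide +kernel
theorem run2_477 : run2 477 25 = true := by decide +kernel
theorem run2_502 : run2 502 25 = true := by decide +kernel
theorem run2_527 : run2 527 25 = true := by decide +kernel
theorem run2_552 : run2 552 25 = true := by decide +kernel
theorem run2_577 : run2 577 25 = true := by decide +kernel
theorem run2_602 : run2 602 25 = true := by decide +kernel
theorem run2_627 : run2 627 24 = true := by decide +kernel

theorem cov_run2 : Cov run2 651 :=
  have c2 := Cov.base run2
  have c27 := c2.step 25 27 run2_2 rfl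
  have c52 := c27.step 25 52 run2_27 rfl
  have c77 := c52.step 25 77 run2_52 rfl
  have c102 := c77.step 25 102 run2_77 rfl
  have c127 := c102.step 25 127 run2_102 rfl
  have c152 := c127.step 25 152 run2_127 rfl
  have c177 := c152.step 25 177 run2_152 rfl
  have c202 := c177.step 25 202 run2_177 rfl
  have c227 := c202.step 25 227 run2_202 rfl
  have c252 := c227.step 25 252 run2_227 rfl
  have c277 := c252.step 25 277 run2_252 rfl
  have c302 := c277.step 25 302 run2_277 rfl
  have c327 := c302.step 25 327 run2_302 rfl
  have c352 := c327.step 25 352 run2_327 rfl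
  have c377 := c352.step 25 377 run2_352 rfl
  have c402 := c377.step 25 402 run2_377 rfl
  have c427 := c402.step 25 427 run2_402 rfl
  have c452 := c427.step 25 452 run2_427 rfl
  have c477 := c452.step 25 477 run2_452 rfl
  have c502 := c477.step 25 502 run2_477 rfl
  have c527 := c502.step 25 527 run2_502 rfl
  have c552 := c527.step 25 552 run2_527 rfl
  have c577 := c552.step 25 577 run2_552 rfl
  have c602 := c577.step 25 602 run2_577 rfl
  have c627 := c602.step 25 627 run2_602 rfl
  have c651 := c627.step 24 651 run2_627 rfl
  c651

lemma Sol.false {k n m l d a : ℕ} (s : Sol k n m l d a) : False := by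
  have ha : ¬ (k = 2 ∧ a = 9) := by
    rintro ⟨rfl, rfl⟩
    exact s.not29
  obtain ⟨α, h⟩ := exists_root k s.hk
  have hk2 : k < 651 := Nat.lt_succ_of_le s.hk'
  obtain ⟨k0, c, hr, h1, h2⟩ := cov_run1 k s.hk hk2
  obtain ⟨k0', c', hr', h1', h2'⟩ := cov_run2 k s.hk hk2
  exact run2_sound hr' h1' h2' s h ha (run1_sound hr h1 h2 s h ha (s.chainA h))

lemma heq_conv {d a X : ℕ} (h : X = a * ((10 ^ d - 1) / 9)) : 9 * X + a = a * 10 ^ d := by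
  have h9 : 9 ∣ 10 ^ d - 1 := by
    have := Nat.sub_dvd_pow_sub_pow 10 1 d
    simpa using this
  obtain ⟨c, hc⟩ := h9
  have p : 0 < 10 ^ d := Nat.pow_pos (by norm_num)
  have e : 10 ^ d = 9 * c + 1 := by omega
  rw [h, hc, e, Nat.mul_div_cancel_left _ (by norm_num)]
  ring

end TL

end

theorem l_le_300_for_small_k
    (k n m l d a : ℕ) (hk : 2 ≤ k) (hk' : k ≤ 650) (hnm : m ≤ n) (hml : l ≤ m)
    (hnk : k + 1 ≤ n) (hn : 25 < n)
    (hd : 2 ≤ d) (ha1 : 1 ≤ a) (ha9 : a ≤ 9)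
    (heq : lucasK k n * lucasK k m * lucasK k l = a * ((10 ^ d - 1) / 9)) :
    l ≤ 300 := by
  by_contra hc
  exact TL.Sol.false ⟨hk, hk', hnm, hml, by omega, hd, ha1, ha9, TL.heq_conv heq⟩
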